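/- Let N ≥ 1, m > 1, 0 < p < 1, σ > 0 with m + p ≥ 2. Let u₀ : ℝ^N → [0,∞) be continuous, bounded, compactly supported and not identically zero. Then there exist T > 0 and a weak solution u to the Cauchy problem for ∂_t u = Δ(u^m) + (1+|x|)^σ u^p on ℝ^N × (0,T) with initial datum u₀ such that, for every t ∈ (0,T), the function x ↦ u(x,t) is continuous and compactly supported on ℝ^N. -/

import Mathlib

open MeasureTheory Set Filter
open scoped RealInnerProductSpace

noncomputable section

/-- The spatial Laplacian of a function on `EuclideanSpace ℝ (Fin N)`. -/
def lapl {N : ℕ} (f : EuclideanSpace ℝ (Fin N) → ℝ) (x : EuclideanSpace ℝ (Fin N)) : ℝ :=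
  ∑ i : Fin N,
    fderiv ℝ (fun y => fderiv ℝ f y (EuclideanSpace.single i (1 : ℝ))) x
      (EuclideanSpace.single i (1 : ℝ))

/-- Test functions: smooth, compactly supported in `ℝ^N × (0,T)`. -/
def IsTestFn {N : ℕ} (T : ℝ) (η : EuclideanSpace ℝ (Fin N) → ℝ → ℝ) : Prop :=
  ContDiff ℝ (⊤ : ℕ∞) (Function.uncurry η) ∧ HasCompactSupport (Function.uncurry η) ∧
    ∀ (x : EuclideanSpace ℝ (Fin N)) (t : ℝ), t ∉ Ioo 0 T → η x t = 0

/-- Weak solution of `∂ₜ u = Δ(u^m) + (1+|x|)^σ u^p` on `ℝ^N × (0,T)` with initial datum `u₀`. -/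
structure IsWeakSolution {N : ℕ} (m p σ T : ℝ)
    (u : EuclideanSpace ℝ (Fin N) → ℝ → ℝ)
    (u₀ : EuclideanSpace ℝ (Fin N) → ℝ) : Prop where
  nonneg : ∀ x, ∀ t ∈ Ioo 0 T, 0 ≤ u x t
  timeContL1 : ∀ K : Set (EuclideanSpace ℝ (Fin N)), IsCompact K → ∀ s ∈ Ioo 0 T,
    Tendsto (fun t => ∫ x in K, |u x t - u x s|) (nhdsWithin s (Ioo 0 T)) (nhds 0)
  locBdd : ∀ K : Set (EuclideanSpace ℝ (Fin N)), IsCompact K → ∀ a b : ℝ, 0 < a → b < T →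
    ∃ C : ℝ, ∀ x ∈ K, ∀ t ∈ Icc a b, u x t ≤ C
  weakForm : ∀ η : EuclideanSpace ℝ (Fin N) → ℝ → ℝ, IsTestFn T η → ∀ t ∈ Ioo 0 T,
    ((∫ x, u x t * η x t) +
      ∫ τ in Ioo (0:ℝ) t, ∫ x,
        (-(u x τ * deriv (η x) τ) - u x τ ^ m * lapl (fun y => η y τ) x)) =
    ∫ τ in Ioo (0:ℝ) t, ∫ x, (1 + ‖x‖) ^ σ * u x τ ^ p * η x τ
  initL1 : ∀ K : Set (EuclideanSpace ℝ (Fin N)), IsCompact K →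
    Tendsto (fun t => ∫ x in K, |u x t - u₀ x|) (nhdsWithin 0 (Ioi 0)) (nhds 0)

open scoped BoundedContinuousFunction

open ProbabilityTheory in
/-- The Gaussian measure of covariance `2s`, i.e. the heat kernel of `∂ₜ - Δ` at time `s`. -/
def heatMeasure (N : ℕ) (s : ℝ) : Measure (EuclideanSpace ℝ (Fin N)) :=
  (stdGaussian (EuclideanSpace ℝ (Fin N))).map (fun ξ => √(2 * s) • ξ)

/-- The density of `heatMeasure`. -/
def heatDensity (N : ℕ) (s : ℝ) (y : EuclideanSpace ℝ (Fin N)) : ℝ :=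
  (4 * Real.pi * s) ^ (-(N : ℝ) / 2) * Real.exp (-(‖y‖ ^ 2 / (4 * s)))

instance heatMeasure_isProbabilityMeasure (N : ℕ) (s : ℝ) :
    IsProbabilityMeasure (heatMeasure N s) :=
  Measure.isProbabilityMeasure_map (Measurable.aemeasurable (by fun_prop))

lemma charFun_heatMeasure {N : ℕ} {s : ℝ} (hs : 0 ≤ s) (t : EuclideanSpace ℝ (Fin N)) :
    charFun (heatMeasure N s) t = Complex.exp (-(s * ‖t‖ ^ 2 : ℝ)) := by
  rw [heatMeasure, charFun_map_smul, ProbabilityTheory.charFun_stdGaussian, norm_smul]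
  congr 1
  rw [Real.norm_eq_abs, abs_of_nonneg (Real.sqrt_nonneg _)]
  push_cast
  rw [mul_pow, ← Complex.ofReal_pow (√(2*s)), Real.sq_sqrt (by positivity)]
  push_cast
  ring

lemma heatMeasure_conv {N : ℕ} {s t : ℝ} (hs : 0 ≤ s) (ht : 0 ≤ t) :
    (heatMeasure N s).conv (heatMeasure N t) = heatMeasure N (s + t) := by
  apply Measure.ext_of_charFun
  ext x
  rw [charFun_conv, charFun_heatMeasure hs, charFun_heatMeasure ht,
    charFun_heatMeasure (add_nonneg hs ht), ← Complex.exp_add]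
  congr 1
  push_cast
  ring

lemma heatDensity_pos {N : ℕ} {s : ℝ} (hs : 0 < s) (y : EuclideanSpace ℝ (Fin N)) :
    0 < heatDensity N s y := by
  unfold heatDensity
  have := Real.pi_pos
  positivity

lemma continuous_heatDensity {N : ℕ} {s : ℝ} : Continuous (heatDensity N s) := by
  unfold heatDensity
  fun_prop

lemma integral_heatDensity {N : ℕ} {s : ℝ} (hs : 0 < s) :
    ∫ y, heatDensity N s y = 1 := by
  have hpi := Real.pi_pos
  have h := GaussianFourier.integral_rexp_neg_mul_sq_norm
    (V := EuclideanSpace ℝ (Fin N)) (b := 1 / (4 * s)) (by positivity)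
  have h2 : ∀ y : EuclideanSpace ℝ (Fin N), heatDensity N s y
      = (4 * Real.pi * s) ^ (-(N : ℝ) / 2) * Real.exp (-(1 / (4 * s)) * ‖y‖ ^ 2) := by
    intro y
    unfold heatDensity
    congr 2
    field_simp
  simp_rw [h2]
  rw [integral_const_mul, h, finrank_euclideanSpace_fin]
  have : Real.pi / (1 / (4 * s)) = 4 * Real.pi * s := by field_simp
  rw [this, ← Real.rpow_add (by positivity)]
  simp [neg_div]

lemma integrable_heatDensity {N : ℕ} {s : ℝ} (hs : 0 < s) :
    Integrable (heatDensity N s) := by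
  by_contra h
  have := integral_heatDensity (N := N) hs
  rw [integral_undef h] at this
  exact zero_ne_one this

lemma heatMeasure_eq_withDensity {N : ℕ} {s : ℝ} (hs : 0 < s) :
    heatMeasure N s = volume.withDensity (fun y => ENNReal.ofReal (heatDensity N s y)) := by
  have hpi := Real.pi_pos
  have : IsFiniteMeasure
      (volume.withDensity (fun y => ENNReal.ofReal (heatDensity N s y))) :=
    isFiniteMeasure_withDensity_ofReal (integrable_heatDensity hs).2
  apply Measure.ext_of_charFun
  ext t
  rw [charFun_heatMeasure hs.le, charFun_apply,
    integral_withDensity_eq_integral_toReal_smul (by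
      exact (continuous_heatDensity.measurable).ennreal_ofReal) (by simp)]
  have h := GaussianFourier.integral_cexp_neg_mul_sq_norm_add
    (V := EuclideanSpace ℝ (Fin N)) (b := ((1 / (4 * s) : ℝ) : ℂ))
    (by rw [Complex.ofReal_re]; positivity) Complex.I t
  have h2 : ∀ y : EuclideanSpace ℝ (Fin N),
      (ENNReal.ofReal (heatDensity N s y)).toReal • Complex.exp (⟪y, t⟫ * Complex.I)
      = ((4 * Real.pi * s) ^ (-(N : ℝ) / 2) : ℝ) *
        Complex.exp (-((1 / (4 * s) : ℝ) : ℂ) * ‖y‖ ^ 2 + Complex.I * ⟪t, y⟫) := by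
    intro y
    rw [ENNReal.toReal_ofReal (heatDensity_pos hs y).le, heatDensity, Complex.real_smul,
      Complex.ofReal_mul, mul_assoc, Complex.ofReal_exp, ← Complex.exp_add, real_inner_comm]
    congr 2
    push_cast
    field_simp
  simp_rw [h2]
  rw [integral_const_mul, h, finrank_euclideanSpace_fin, ← mul_assoc]
  have h3 : (Real.pi / ((1 / (4 * s) : ℝ) : ℂ)) = ((4 * Real.pi * s : ℝ) : ℂ) := by
    push_cast
    field_simp
  have h4 : ((N : ℂ) / 2) = (((N : ℝ) / 2 : ℝ) : ℂ) := by push_cast; ring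
  rw [h3, h4, ← Complex.ofReal_cpow (by positivity), ← Complex.ofReal_mul,
    ← Real.rpow_add (by positivity)]
  simp only [neg_div, neg_add_cancel, Real.rpow_zero, Complex.ofReal_one, one_mul]
  congr 1
  rw [Complex.I_sq]
  push_cast
  field_simp

lemma integral_heatMeasure {N : ℕ} {s : ℝ} (hs : 0 < s) (f : EuclideanSpace ℝ (Fin N) → ℝ) :
    ∫ y, f y ∂(heatMeasure N s) = ∫ y, heatDensity N s y * f y := by
  rw [heatMeasure_eq_withDensity hs,
    integral_withDensity_eq_integral_toReal_smul (by
      exact (continuous_heatDensity.measurable).ennreal_ofReal) (by simp)]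
  refine integral_congr_ae (Eventually.of_forall fun y => ?_)
  simp [ENNReal.toReal_ofReal (heatDensity_pos hs y).le]

lemma integrable_heatMeasure_iff {N : ℕ} {s : ℝ} (hs : 0 < s)
    (f : EuclideanSpace ℝ (Fin N) → ℝ) :
    Integrable f (heatMeasure N s) ↔ Integrable (fun y => heatDensity N s y * f y) := by
  rw [heatMeasure_eq_withDensity hs,
    integrable_withDensity_iff_integrable_smul' (by
      exact (continuous_heatDensity.measurable).ennreal_ofReal) (by simp)]
  refine integrable_congr (Eventually.of_forall fun y => ?_)
  simp [ENNReal.toReal_ofReal (heatDensity_pos hs y).le]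

open ProbabilityTheory in
lemma measurePreserving_coord_stdGaussian {N : ℕ} (i : Fin N) :
    MeasurePreserving (fun x : EuclideanSpace ℝ (Fin N) => x i)
      (stdGaussian (EuclideanSpace ℝ (Fin N))) (gaussianReal 0 1) := by
  have h := measurePreserving_eval_multivariateGaussian (μ := (0 : EuclideanSpace ℝ (Fin N)))
    (S := (1 : Matrix (Fin N) (Fin N) ℝ)) Matrix.PosSemidef.one (i := i)
  rw [multivariateGaussian_zero_one] at h
  simpa using h

open ProbabilityTheory in
lemma integrable_coord_mul_stdGaussian {N : ℕ} (i j : Fin N) :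
    Integrable (fun x : EuclideanSpace ℝ (Fin N) => x i * x j)
      (stdGaussian (EuclideanSpace ℝ (Fin N))) := by
  have h : ∀ i : Fin N, MemLp (fun x : EuclideanSpace ℝ (Fin N) => x i) 2
      (stdGaussian (EuclideanSpace ℝ (Fin N))) := fun i =>
    (IsGaussian.memLp_id (stdGaussian (EuclideanSpace ℝ (Fin N))) 2 (by simp)).mono
      (by fun_prop) (Eventually.of_forall fun x => by
        simpa using PiLp.norm_apply_le x i)
  exact (h i).integrable_mul (h j)

open ProbabilityTheory in
lemma integral_coord_mul_stdGaussian {N : ℕ} (i j : Fin N) :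
    ∫ x : EuclideanSpace ℝ (Fin N), x i * x j ∂(stdGaussian (EuclideanSpace ℝ (Fin N)))
      = if i = j then 1 else 0 := by
  have h : ∀ i : Fin N, MemLp (fun x : EuclideanSpace ℝ (Fin N) => x i) 2
      (stdGaussian (EuclideanSpace ℝ (Fin N))) := fun i =>
    (IsGaussian.memLp_id (stdGaussian (EuclideanSpace ℝ (Fin N))) 2 (by simp)).mono
      (by fun_prop) (Eventually.of_forall fun x => by
        simpa using PiLp.norm_apply_le x i)
  have hc := covariance_eval_multivariateGaussian (μ := (0 : EuclideanSpace ℝ (Fin N)))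
    (S := (1 : Matrix (Fin N) (Fin N) ℝ)) Matrix.PosSemidef.one i j
  rw [multivariateGaussian_zero_one, covariance_eq_sub (h i) (h j), Matrix.one_apply] at hc
  have h0 : ∫ x : EuclideanSpace ℝ (Fin N), x i ∂(stdGaussian (EuclideanSpace ℝ (Fin N))) = 0 :=
    integral_strongDual_stdGaussian (EuclideanSpace.proj i)
  rw [h0, zero_mul, sub_zero] at hc
  exact hc

lemma integral_heatMeasure_scale {N : ℕ} {s : ℝ} (f : EuclideanSpace ℝ (Fin N) → ℝ)
    (hf : Measurable f) :
    ∫ y, f y ∂(heatMeasure N s) =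
      ∫ ξ, f (√(2 * s) • ξ) ∂(ProbabilityTheory.stdGaussian (EuclideanSpace ℝ (Fin N))) := by
  rw [heatMeasure, integral_map (by fun_prop) hf.aestronglyMeasurable]

lemma integrable_heatMeasure_scale {N : ℕ} {s : ℝ} (f : EuclideanSpace ℝ (Fin N) → ℝ)
    (hf : Measurable f) :
    Integrable f (heatMeasure N s) ↔
      Integrable (fun ξ => f (√(2 * s) • ξ))
        (ProbabilityTheory.stdGaussian (EuclideanSpace ℝ (Fin N))) := by
  rw [heatMeasure, integrable_map_measure hf.aestronglyMeasurable (by fun_prop)]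
  rfl

lemma integrable_coord_mul_heatMeasure {N : ℕ} {s : ℝ} (i j : Fin N) :
    Integrable (fun y : EuclideanSpace ℝ (Fin N) => y i * y j) (heatMeasure N s) := by
  rw [integrable_heatMeasure_scale _ (by fun_prop)]
  refine ((integrable_coord_mul_stdGaussian i j).const_mul (√(2*s) * √(2*s))).congr
    (Eventually.of_forall fun x => ?_)
  simp only [PiLp.smul_apply, smul_eq_mul]
  ring

lemma integral_coord_mul_heatMeasure {N : ℕ} {s : ℝ} (hs : 0 ≤ s) (i j : Fin N) :
    ∫ y : EuclideanSpace ℝ (Fin N), y i * y j ∂(heatMeasure N s)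
      = if i = j then 2 * s else 0 := by
  rw [integral_heatMeasure_scale _ (by fun_prop)]
  have : ∀ x : EuclideanSpace ℝ (Fin N), (√(2*s) • x) i * (√(2*s) • x) j
      = (2 * s) * (x i * x j) := by
    intro x
    simp only [PiLp.smul_apply, smul_eq_mul]
    have := Real.mul_self_sqrt (show 0 ≤ 2 * s by positivity)
    linear_combination (x i * x j) * this
  simp_rw [this]
  rw [integral_const_mul, integral_coord_mul_stdGaussian]
  split_ifs <;> simp

lemma integrable_norm_sq_heatMeasure {N : ℕ} {s : ℝ} :
    Integrable (fun y : EuclideanSpace ℝ (Fin N) => ‖y‖ ^ 2) (heatMeasure N s) := by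
  simp_rw [EuclideanSpace.norm_sq_eq, Real.norm_eq_abs, sq_abs, pow_two]
  exact integrable_finsetSum _ fun i _ => integrable_coord_mul_heatMeasure i i

lemma integral_norm_sq_heatMeasure {N : ℕ} {s : ℝ} (hs : 0 ≤ s) :
    ∫ y : EuclideanSpace ℝ (Fin N), ‖y‖ ^ 2 ∂(heatMeasure N s) = 2 * N * s := by
  simp_rw [EuclideanSpace.norm_sq_eq, Real.norm_eq_abs, sq_abs, pow_two]
  rw [integral_finsetSum _ fun i _ => integrable_coord_mul_heatMeasure i i]
  simp_rw [integral_coord_mul_heatMeasure hs]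
  simp
  ring

lemma integrable_coord_heatMeasure {N : ℕ} {s : ℝ} (i : Fin N) :
    Integrable (fun y : EuclideanSpace ℝ (Fin N) => y i) (heatMeasure N s) := by
  refine ((integrable_const (1:ℝ)).add (integrable_coord_mul_heatMeasure i i)).mono'
    (by fun_prop) (Eventually.of_forall fun y => ?_)
  simp only [Real.norm_eq_abs, Pi.add_apply]
  rw [← abs_mul_abs_self (y i)]
  nlinarith [sq_nonneg (|y i| - 1), abs_nonneg (y i)]

lemma heatMeasure_map_neg {N : ℕ} {s : ℝ} (hs : 0 ≤ s) :
    (heatMeasure N s).map (fun y => -y) = heatMeasure N s := by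
  have : IsProbabilityMeasure ((heatMeasure N s).map (fun y => -y)) :=
    Measure.isProbabilityMeasure_map (Measurable.aemeasurable (by fun_prop))
  apply Measure.ext_of_charFun
  ext t
  have : (fun y : EuclideanSpace ℝ (Fin N) => -y) = fun y => (-1:ℝ) • y := by ext; simp
  rw [this, charFun_map_smul, charFun_heatMeasure hs, charFun_heatMeasure hs]
  simp

lemma integral_heatMeasure_neg {N : ℕ} {s : ℝ} (hs : 0 ≤ s)
    (f : EuclideanSpace ℝ (Fin N) → ℝ) :
    ∫ y, f (-y) ∂(heatMeasure N s) = ∫ y, f y ∂(heatMeasure N s) := by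
  conv_rhs => rw [← heatMeasure_map_neg hs]
  exact ((MeasurableEquiv.neg (EuclideanSpace ℝ (Fin N))).measurableEmbedding.integral_map f).symm

lemma integral_coord_heatMeasure {N : ℕ} {s : ℝ} (hs : 0 ≤ s) (i : Fin N) :
    ∫ y : EuclideanSpace ℝ (Fin N), y i ∂(heatMeasure N s) = 0 := by
  have h := integral_heatMeasure_neg hs (fun y : EuclideanSpace ℝ (Fin N) => y i)
  simp only [PiLp.neg_apply, integral_neg] at h
  linarith

/-- The constant in the bound of an exponentially weighted second moment. -/
def gaussSecondMoment : ℝ :=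
  ∫ x, x ^ 2 * Real.exp (2 * |x|) ∂(ProbabilityTheory.gaussianReal 0 1)

lemma gaussSecondMoment_nonneg : 0 ≤ gaussSecondMoment :=
  integral_nonneg fun x => by positivity

lemma integrable_sq_mul_exp_gaussianReal :
    Integrable (fun x => x ^ 2 * Real.exp (2 * |x|)) (ProbabilityTheory.gaussianReal 0 1) := by
  have h1 := ProbabilityTheory.integrable_exp_mul_gaussianReal (μ := 0) (v := 1) 3
  have h2 := ProbabilityTheory.integrable_exp_mul_gaussianReal (μ := 0) (v := 1) (-3)
  refine ((h1.add h2).const_mul 2).mono' (by fun_prop) (Eventually.of_forall fun x => ?_)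
  rw [Real.norm_eq_abs, abs_of_nonneg (by positivity)]
  have h3 : x ^ 2 ≤ 2 * Real.exp |x| := by
    have := Real.quadratic_le_exp_of_nonneg (abs_nonneg x)
    rw [sq_abs] at this
    linarith [abs_nonneg x]
  have h4 : Real.exp (3 * |x|) ≤ Real.exp (3 * x) + Real.exp (-3 * x) := by
    rcases abs_cases x with ⟨h, _⟩ | ⟨h, _⟩ <;> rw [h]
    · linarith [Real.exp_pos (-3 * x)]
    · rw [mul_neg, ← neg_mul]; linarith [Real.exp_pos (3 * x)]
  calc x ^ 2 * Real.exp (2 * |x|) ≤ 2 * Real.exp |x| * Real.exp (2 * |x|) := by gcongr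
    _ = 2 * Real.exp (3 * |x|) := by rw [mul_assoc, ← Real.exp_add]; ring_nf
    _ ≤ _ := by simp only [Pi.add_apply]; linarith

lemma sq_mul_exp_coord_heatMeasure {N : ℕ} {s c : ℝ} (hs : 0 ≤ s)
    (hcs : c ^ 2 * s ≤ 1) (i : Fin N) :
    Integrable (fun y : EuclideanSpace ℝ (Fin N) => y i ^ 2 * Real.exp (c * |y i|))
      (heatMeasure N s) ∧
    ∫ y : EuclideanSpace ℝ (Fin N), y i ^ 2 * Real.exp (c * |y i|) ∂(heatMeasure N s)
      ≤ 2 * gaussSecondMoment * s := by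
  have hmp := measurePreserving_coord_stdGaussian i
  have hInt : Integrable (fun x : EuclideanSpace ℝ (Fin N) => x i ^ 2 * Real.exp (2 * |x i|))
      (ProbabilityTheory.stdGaussian (EuclideanSpace ℝ (Fin N))) :=
    hmp.integrable_comp_of_integrable integrable_sq_mul_exp_gaussianReal
  have hval : ∫ x : EuclideanSpace ℝ (Fin N), x i ^ 2 * Real.exp (2 * |x i|)
      ∂(ProbabilityTheory.stdGaussian (EuclideanSpace ℝ (Fin N))) = gaussSecondMoment := by
    rw [gaussSecondMoment, ← hmp.map_eq, integral_map (by fun_prop) (by fun_prop)]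
  have hb : ∀ x : EuclideanSpace ℝ (Fin N),
      (√(2 * s) • x) i ^ 2 * Real.exp (c * |(√(2 * s) • x) i|) ≤
      2 * s * (x i ^ 2 * Real.exp (2 * |x i|)) := by
    intro x
    simp only [PiLp.smul_apply, smul_eq_mul]
    rw [mul_pow, Real.sq_sqrt (by positivity), mul_assoc, abs_mul,
      abs_of_nonneg (Real.sqrt_nonneg _)]
    have : c * √(2 * s) ≤ 2 := by
      apply abs_le_of_sq_le_sq' _ (by norm_num) |>.2
      rw [mul_pow, Real.sq_sqrt (by positivity)]
      linarith
    have h2 : c * (√(2 * s) * |x i|) ≤ 2 * |x i| := by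
      rw [← mul_assoc]; gcongr
    gcongr
  have hi2 : Integrable (fun x : EuclideanSpace ℝ (Fin N) =>
      (√(2 * s) • x) i ^ 2 * Real.exp (c * |(√(2 * s) • x) i|))
      (ProbabilityTheory.stdGaussian (EuclideanSpace ℝ (Fin N))) := by
    refine (hInt.const_mul (2 * s)).mono' (by fun_prop) (Eventually.of_forall fun x => ?_)
    rw [Real.norm_eq_abs, abs_of_nonneg (by positivity)]
    exact hb x
  refine ⟨(integrable_heatMeasure_scale _ (by fun_prop)).2 hi2, ?_⟩
  rw [integral_heatMeasure_scale _ (by fun_prop)]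
  calc _ ≤ ∫ x : EuclideanSpace ℝ (Fin N), 2 * s * (x i ^ 2 * Real.exp (2 * |x i|))
      ∂(ProbabilityTheory.stdGaussian (EuclideanSpace ℝ (Fin N))) :=
        integral_mono hi2 (hInt.const_mul _) hb
    _ = _ := by rw [integral_const_mul, hval]; ring

lemma integrable_bcf_heatMeasure {N : ℕ} {s : ℝ} (w : EuclideanSpace ℝ (Fin N) →ᵇ ℝ)
    (x : EuclideanSpace ℝ (Fin N)) : Integrable (fun y => w (x + y)) (heatMeasure N s) :=
  (integrable_const ‖w‖).mono' (by fun_prop)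
    (Eventually.of_forall fun y => w.norm_coe_le_norm (x + y))

lemma norm_integral_bcf_heatMeasure_le {N : ℕ} {s : ℝ} (w : EuclideanSpace ℝ (Fin N) →ᵇ ℝ)
    (x : EuclideanSpace ℝ (Fin N)) : ‖∫ y, w (x + y) ∂(heatMeasure N s)‖ ≤ ‖w‖ := by
  refine (norm_integral_le_of_norm_le_const
    (Eventually.of_forall fun y => w.norm_coe_le_norm (x + y))).trans ?_
  simp

/-- The heat semigroup on bounded continuous functions. -/
def heatOp (N : ℕ) (s : ℝ) :
    (EuclideanSpace ℝ (Fin N) →ᵇ ℝ) →L[ℝ] (EuclideanSpace ℝ (Fin N) →ᵇ ℝ) :=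
  LinearMap.mkContinuous
    { toFun := fun w => BoundedContinuousFunction.ofNormedAddCommGroup
        (fun x => ∫ y, w (x + y) ∂(heatMeasure N s))
        (continuous_of_dominated (bound := fun _ => ‖w‖) (fun x => by fun_prop)
          (fun x => Eventually.of_forall fun y => w.norm_coe_le_norm (x + y))
          (integrable_const _) (Eventually.of_forall fun y => by fun_prop))
        ‖w‖ (norm_integral_bcf_heatMeasure_le w)
      map_add' := fun w v => by
        ext x
        exact integral_add (integrable_bcf_heatMeasure w x) (integrable_bcf_heatMeasure v x)
      map_smul' := fun c w => by
        ext x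
        exact integral_const_mul c _ }
    1 (fun w => by
      rw [one_mul]
      exact BoundedContinuousFunction.norm_ofNormedAddCommGroup_le _ (norm_nonneg w)
        (norm_integral_bcf_heatMeasure_le w))

lemma heatOp_apply {N : ℕ} (s : ℝ) (w : EuclideanSpace ℝ (Fin N) →ᵇ ℝ)
    (x : EuclideanSpace ℝ (Fin N)) : heatOp N s w x = ∫ y, w (x + y) ∂(heatMeasure N s) := rfl

lemma norm_heatOp_le {N : ℕ} (s : ℝ) : ‖heatOp N s‖ ≤ 1 :=
  LinearMap.mkContinuous_norm_le _ zero_le_one _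

lemma heatOp_le_integral {N : ℕ} (s : ℝ) {w : EuclideanSpace ℝ (Fin N) →ᵇ ℝ}
    {x : EuclideanSpace ℝ (Fin N)} {F : EuclideanSpace ℝ (Fin N) → ℝ}
    (hF : Integrable F (heatMeasure N s)) (h : ∀ y, w (x + y) ≤ F y) :
    heatOp N s w x ≤ ∫ y, F y ∂(heatMeasure N s) :=
  integral_mono (integrable_bcf_heatMeasure w x) hF h

lemma heatOp_le_const {N : ℕ} (s : ℝ) {w : EuclideanSpace ℝ (Fin N) →ᵇ ℝ} {C : ℝ}
    (h : ∀ x, w x ≤ C) (x : EuclideanSpace ℝ (Fin N)) : heatOp N s w x ≤ C := by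
  simpa using heatOp_le_integral s (x := x) (integrable_const C) fun y => h (x + y)

lemma heatOp_heatOp {N : ℕ} {s t : ℝ} (hs : 0 ≤ s) (ht : 0 ≤ t)
    (w : EuclideanSpace ℝ (Fin N) →ᵇ ℝ) :
    heatOp N s (heatOp N t w) = heatOp N (s + t) w := by
  ext x
  rw [heatOp_apply, heatOp_apply, ← heatMeasure_conv hs ht, integral_conv]
  · simp_rw [heatOp_apply, add_assoc]
  · rw [heatMeasure_conv hs ht]
    exact integrable_bcf_heatMeasure w x

lemma heatOp_zero {N : ℕ} (w : EuclideanSpace ℝ (Fin N) →ᵇ ℝ) : heatOp N 0 w = w := by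
  ext x
  rw [heatOp_apply, heatMeasure, integral_map (by fun_prop) (by fun_prop)]
  simp

/-- Quadratic majorants are preserved up to a linear-in-time growth. -/
lemma heatOp_le_quadratic {N : ℕ} {s : ℝ} (hs : 0 ≤ s) {w : EuclideanSpace ℝ (Fin N) →ᵇ ℝ}
    {b q : ℝ} {x₀ : EuclideanSpace ℝ (Fin N)} (h : ∀ y, w y ≤ b + q * ‖y - x₀‖ ^ 2)
    (x : EuclideanSpace ℝ (Fin N)) :
    heatOp N s w x ≤ b + q * ‖x - x₀‖ ^ 2 + q * (2 * N * s) := by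
  have hexp : ∀ y : EuclideanSpace ℝ (Fin N), ‖x + y - x₀‖ ^ 2
      = ‖x - x₀‖ ^ 2 + 2 * (∑ i, (x - x₀) i * y i) + ‖y‖ ^ 2 := by
    intro y
    have : x + y - x₀ = (x - x₀) + y := by abel
    rw [this, norm_add_sq_real]
    congr 3
    rw [PiLp.inner_apply]
    simp [mul_comm]
  have hi1 : Integrable (fun y : EuclideanSpace ℝ (Fin N) => ∑ i, (x - x₀) i * y i)
      (heatMeasure N s) :=
    integrable_finsetSum _ fun i _ => (integrable_coord_heatMeasure i).const_mul _
  have hi2 := integrable_norm_sq_heatMeasure (N := N) (s := s)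
  have hI : ∫ y : EuclideanSpace ℝ (Fin N), (b + q * ‖x - x₀‖ ^ 2)
      + ((2 * q) * (∑ i, (x - x₀) i * y i) + q * ‖y‖ ^ 2) ∂(heatMeasure N s)
      = b + q * ‖x - x₀‖ ^ 2 + q * (2 * N * s) := by
    have hi3 : Integrable (fun y : EuclideanSpace ℝ (Fin N) =>
        (2 * q) * (∑ i, (x - x₀) i * y i) + q * ‖y‖ ^ 2) (heatMeasure N s) :=
      (hi1.const_mul _).add (hi2.const_mul _)
    rw [integral_add (integrable_const _) hi3,
      integral_add (hi1.const_mul _) (hi2.const_mul _), integral_const_mul, integral_const_mul,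
      integral_norm_sq_heatMeasure hs,
      integral_finsetSum _ fun i _ => (integrable_coord_heatMeasure i).const_mul _]
    simp_rw [integral_const_mul, integral_coord_heatMeasure hs]
    simp
  rw [← hI]
  refine heatOp_le_integral s
    ((integrable_const _).add ((hi1.const_mul _).add (hi2.const_mul _))) fun y => ?_
  refine (h (x + y)).trans (le_of_eq ?_)
  rw [hexp]
  ring

/-- Second order majorants in one coordinate. -/
lemma heatOp_le_coord {N : ℕ} {s c : ℝ} (hs : 0 ≤ s) (hcs : c ^ 2 * s ≤ 1)
    {w : EuclideanSpace ℝ (Fin N) →ᵇ ℝ} {a b B : ℝ} (hB : 0 ≤ B)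
    {x : EuclideanSpace ℝ (Fin N)} (i : Fin N)
    (h : ∀ y, w (x + y) ≤ a + b * y i + B * (y i ^ 2 * Real.exp (c * |y i|))) :
    heatOp N s w x ≤ a + B * (2 * gaussSecondMoment * s) := by
  obtain ⟨hi, hle⟩ := sq_mul_exp_coord_heatMeasure (N := N) hs hcs i
  have h1 := integrable_coord_heatMeasure (N := N) (s := s) i
  have h2 : Integrable (fun y : EuclideanSpace ℝ (Fin N) => a + b * y i) (heatMeasure N s) :=
    (integrable_const a).add (h1.const_mul b)
  refine (heatOp_le_integral s (h2.add (hi.const_mul B)) h).trans ?_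
  simp only [Pi.add_apply]
  rw [integral_add h2 (hi.const_mul B),
    integral_add (integrable_const a) (h1.const_mul b), integral_const_mul, integral_const_mul,
    integral_coord_heatMeasure hs]
  simp only [integral_const, probReal_univ, one_smul, mul_zero, add_zero]
  gcongr

lemma heatDensity_add_le {N : ℕ} {s : ℝ} (hs : 0 < s) {v : EuclideanSpace ℝ (Fin N)}
    (hv : ‖v‖ ≤ 1) (z : EuclideanSpace ℝ (Fin N)) :
    heatDensity N s (z + v) ≤
      (2:ℝ) ^ ((N : ℝ) / 2) * Real.exp (1 / (4 * s)) * heatDensity N (2 * s) z := by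
  have hpi := Real.pi_pos
  unfold heatDensity
  have h1 : (4 * Real.pi * (2 * s)) ^ (-(N : ℝ) / 2)
      = (2:ℝ) ^ (-(N : ℝ) / 2) * (4 * Real.pi * s) ^ (-(N : ℝ) / 2) := by
    rw [← Real.mul_rpow (by norm_num) (by positivity)]
    congr 1; ring
  have h2 : (2:ℝ) ^ ((N : ℝ) / 2) * (2:ℝ) ^ (-(N : ℝ) / 2) = 1 := by
    rw [← Real.rpow_add (by norm_num)]; simp [neg_div]
  have h3 : (2:ℝ) ^ ((N : ℝ) / 2) * Real.exp (1 / (4 * s)) *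
      ((4 * Real.pi * (2 * s)) ^ (-(N : ℝ) / 2) * Real.exp (-(‖z‖ ^ 2 / (4 * (2 * s)))))
      = (4 * Real.pi * s) ^ (-(N : ℝ) / 2) *
        Real.exp (1 / (4 * s) + -(‖z‖ ^ 2 / (4 * (2 * s)))) := by
    rw [h1, Real.exp_add]
    linear_combination (Real.exp (1 / (4 * s)) * Real.exp (-(‖z‖ ^ 2 / (4 * (2 * s)))) *
      (4 * Real.pi * s) ^ (-(N : ℝ) / 2)) * h2
  rw [h3]
  gcongr
  have h4 : ‖z‖ ≤ ‖z + v‖ + 1 := by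
    calc ‖z‖ = ‖(z + v) - v‖ := by congr 1; abel
      _ ≤ ‖z + v‖ + ‖v‖ := norm_sub_le _ _
      _ ≤ _ := by gcongr
  have h5 : ‖z‖ ^ 2 ≤ 2 * ‖z + v‖ ^ 2 + 2 := by
    nlinarith [norm_nonneg z, norm_nonneg (z + v), sq_nonneg (‖z + v‖ - 1)]
  have h6 : 1 / (4 * s) + -(‖z‖ ^ 2 / (4 * (2 * s))) - -(‖z + v‖ ^ 2 / (4 * s))
      = (2 * ‖z + v‖ ^ 2 + 2 - ‖z‖ ^ 2) / (8 * s) := by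
    field_simp; ring
  have h7 : 0 ≤ (2 * ‖z + v‖ ^ 2 + 2 - ‖z‖ ^ 2) / (8 * s) :=
    div_nonneg (by linarith) (by positivity)
  linarith

lemma tendsto_integral_abs_heatDensity_sub {N : ℕ} {s : ℝ} (hs : 0 < s) :
    Tendsto (fun v => ∫ z, |heatDensity N s (z + v) - heatDensity N s z|) (nhds 0) (nhds 0) := by
  have key := tendsto_integral_filter_of_dominated_convergence (μ := volume)
    (l := nhds (0 : EuclideanSpace ℝ (Fin N)))
    (F := fun v z => |heatDensity N s (z + v) - heatDensity N s z|) (f := fun _ => (0:ℝ))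
    (fun z => (2:ℝ) ^ ((N : ℝ) / 2) * Real.exp (1 / (4 * s)) * heatDensity N (2 * s) z
      + heatDensity N s z) ?_ ?_ ?_ ?_
  · simpa using key
  · refine Eventually.of_forall fun v => Continuous.aestronglyMeasurable ?_
    have := continuous_heatDensity (N := N) (s := s)
    fun_prop
  · have hb : Metric.ball (0 : EuclideanSpace ℝ (Fin N)) 1 ∈ nhds 0 :=
      Metric.ball_mem_nhds _ one_pos
    filter_upwards [hb] with v hv
    refine Eventually.of_forall fun z => ?_
    rw [mem_ball_zero_iff] at hv
    have h1 := heatDensity_add_le hs hv.le z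
    have h2 := heatDensity_pos hs (z + v)
    have h3 := heatDensity_pos hs z
    rw [Real.norm_eq_abs, abs_abs, abs_le]
    constructor <;> linarith
  · exact ((integrable_heatDensity (by positivity)).const_mul _).add (integrable_heatDensity hs)
  · refine Eventually.of_forall fun z => ?_
    have hc : Continuous (fun v => |heatDensity N s (z + v) - heatDensity N s z|) := by
      have := continuous_heatDensity (N := N) (s := s)
      fun_prop
    have := hc.tendsto 0
    simpa using this

/-- Uniform equicontinuity of the image of a ball under the heat operator at a positive time. -/
lemma heatOp_equicontinuous {N : ℕ} {s : ℝ} (hs : 0 < s) {ε : ℝ} (hε : 0 < ε) :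
    ∃ ρ > 0, ∀ (w : EuclideanSpace ℝ (Fin N) →ᵇ ℝ) (x y : EuclideanSpace ℝ (Fin N)),
      ‖x - y‖ < ρ → |heatOp N s w x - heatOp N s w y| ≤ ε * ‖w‖ := by
  obtain ⟨ρ, hρ, h⟩ := Metric.tendsto_nhds_nhds.1
    (tendsto_integral_abs_heatDensity_sub (N := N) hs) ε hε
  refine ⟨ρ, hρ, fun w x y hxy => ?_⟩
  have hform : ∀ x : EuclideanSpace ℝ (Fin N), heatOp N s w x
      = ∫ z, heatDensity N s (z - x) * w z := by
    intro x
    rw [heatOp_apply, integral_heatMeasure hs,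
      ← integral_sub_right_eq_self (fun z => heatDensity N s z * w (x + z)) x]
    simp
  have hInt : ∀ x : EuclideanSpace ℝ (Fin N), Integrable
      (fun z => heatDensity N s (z - x) * w z) := by
    intro x
    refine (((integrable_heatDensity hs).comp_sub_right x).mul_const ‖w‖).mono'
      (by have := continuous_heatDensity (N := N) (s := s); fun_prop)
      (Eventually.of_forall fun z => ?_)
    rw [norm_mul, Real.norm_of_nonneg (heatDensity_pos hs _).le]
    exact mul_le_mul_of_nonneg_left (w.norm_coe_le_norm z) (heatDensity_pos hs _).le
  rw [hform, hform, ← integral_sub (hInt x) (hInt y)]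
  have hd := h (x := y - x) (by rw [dist_zero_right, norm_sub_rev]; exact hxy)
  rw [dist_zero_right, Real.norm_eq_abs] at hd
  have hint2 : Integrable (fun z => |heatDensity N s (z - x) - heatDensity N s (z - y)|) :=
    (((integrable_heatDensity hs).comp_sub_right x).sub
      ((integrable_heatDensity hs).comp_sub_right y)).abs
  have heq : ∫ z, |heatDensity N s (z - x) - heatDensity N s (z - y)|
      = ∫ z, |heatDensity N s (z + (y - x)) - heatDensity N s z| := by
    rw [← integral_sub_right_eq_self
      (fun z => |heatDensity N s (z + (y - x)) - heatDensity N s z|) y]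
    refine integral_congr_ae (Eventually.of_forall fun z => ?_)
    simp
  calc |∫ z, (heatDensity N s (z - x) * w z - heatDensity N s (z - y) * w z)|
      ≤ ∫ z, |heatDensity N s (z - x) - heatDensity N s (z - y)| * ‖w‖ := by
        rw [← Real.norm_eq_abs]
        refine norm_integral_le_of_norm_le (hint2.mul_const _)
          (Eventually.of_forall fun z => ?_)
        rw [← sub_mul, norm_mul, Real.norm_eq_abs]
        exact mul_le_mul_of_nonneg_left (w.norm_coe_le_norm z) (abs_nonneg _)
    _ ≤ ε * ‖w‖ := by
        rw [integral_mul_const, heq]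
        gcongr
        exact (le_abs_self _).trans hd.le

lemma heatDensity_le_add {N : ℕ} {s h : ℝ} (hs : 0 < s) (hh : 0 ≤ h)
    (y : EuclideanSpace ℝ (Fin N)) :
    (1 - N * h / (2 * s)) * heatDensity N s y ≤ heatDensity N (s + h) y := by
  have hpi := Real.pi_pos
  unfold heatDensity
  have h1 : (4 * Real.pi * (s + h)) ^ (-(N : ℝ) / 2)
      = ((s + h) / s) ^ (-(N : ℝ) / 2) * (4 * Real.pi * s) ^ (-(N : ℝ) / 2) := by
    rw [← Real.mul_rpow (by positivity) (by positivity)]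
    congr 1; field_simp
  have h2 : 1 - N * h / (2 * s) ≤ ((s + h) / s) ^ (-(N : ℝ) / 2) := by
    have h3 : (s + h) / s ≤ Real.exp (h / s) := by
      have := Real.add_one_le_exp (h / s)
      have h4 : (s + h) / s = h / s + 1 := by field_simp; ring
      rw [h4]; exact this
    calc 1 - N * h / (2 * s) ≤ Real.exp (-(N * h / (2 * s))) := by
          have := Real.add_one_le_exp (-(N * h / (2 * s))); linarith
      _ = (Real.exp (h / s)) ^ (-(N : ℝ) / 2) := by
          rw [← Real.exp_mul]; congr 1; field_simp
      _ ≤ _ := Real.rpow_le_rpow_of_nonpos (by positivity) h3 (by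
          have : (0:ℝ) ≤ N := Nat.cast_nonneg N
          linarith)
  rw [h1, ← mul_assoc]
  gcongr
  linarith

/-- The Harnack-type comparison of heat averages of a function with quadratic lower bound. -/
lemma heatOp_add_ge {N : ℕ} {s h q : ℝ} (hs : 0 < s) (hh : 0 ≤ h)
    {z : EuclideanSpace ℝ (Fin N) →ᵇ ℝ} {x₀ : EuclideanSpace ℝ (Fin N)}
    (hz : ∀ x, 0 ≤ z x + q * ‖x - x₀‖ ^ 2) :
    (1 - N * h / (2 * s)) * (heatOp N s z x₀ + q * (2 * N * s)) ≤
      heatOp N (s + h) z x₀ + q * (2 * N * (s + h)) := by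
  have hInt : ∀ t : ℝ, Integrable (fun y => z (x₀ + y) + q * ‖y‖ ^ 2) (heatMeasure N t) :=
    fun t => (integrable_bcf_heatMeasure z x₀).add (integrable_norm_sq_heatMeasure.const_mul q)
  have hval : ∀ t : ℝ, 0 ≤ t → ∫ y, z (x₀ + y) + q * ‖y‖ ^ 2 ∂(heatMeasure N t)
      = heatOp N t z x₀ + q * (2 * N * t) := by
    intro t ht
    rw [integral_add (integrable_bcf_heatMeasure z x₀)
      (integrable_norm_sq_heatMeasure.const_mul q), integral_const_mul,
      integral_norm_sq_heatMeasure ht, heatOp_apply]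
  rw [← hval s hs.le, ← hval (s + h) (by positivity), integral_heatMeasure hs,
    integral_heatMeasure (by positivity), ← integral_const_mul]
  refine integral_mono (((integrable_heatMeasure_iff hs _).1 (hInt s)).const_mul _)
    ((integrable_heatMeasure_iff (by positivity) _).1 (hInt (s + h))) fun y => ?_
  have := hz (x₀ + y)
  rw [add_sub_cancel_left] at this
  simp only
  rw [← mul_assoc]
  exact mul_le_mul_of_nonneg_right (heatDensity_le_add hs hh y) this

lemma abs_second_difference_le {g g' g'' : ℝ → ℝ} {s B : ℝ} (hs : 0 ≤ s)
    (h1 : ∀ r, HasDerivAt g (g' r) r) (h2 : ∀ r, HasDerivAt g' (g'' r) r)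
    (hB : ∀ r, |r| ≤ s → |g'' r| ≤ B) : |g s + g (-s) - 2 * g 0| ≤ 2 * B * s ^ 2 := by
  have hB0 : 0 ≤ B := (abs_nonneg _).trans (hB 0 (by simpa using hs))
  have hd1 : ∀ r, HasDerivAt (fun r => g r + g (-r) - 2 * g 0) (g' r - g' (-r)) r := by
    intro r
    have := ((h1 r).add ((h1 (-r)).comp r (hasDerivAt_neg r))).sub_const (2 * g 0)
    convert! this using 1
    ring
  have hd2 : ∀ r ∈ Icc 0 s, ‖g' r - g' (-r)‖ ≤ 2 * B * s := by
    intro r hr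
    have := (convex_Icc (-s) s).norm_image_sub_le_of_norm_hasDerivWithin_le
      (f := g') (f' := g'') (C := B) (x := -r) (y := r)
      (fun x _ => (h2 x).hasDerivWithinAt)
      (fun x hx => by rw [Real.norm_eq_abs]; exact hB x (abs_le.2 hx))
      ⟨by linarith [hr.2], by linarith [hr.1, hr.2]⟩ ⟨by linarith [hr.1, hr.2], hr.2⟩
    refine this.trans ?_
    rw [sub_neg_eq_add, Real.norm_of_nonneg (by linarith [hr.1])]
    nlinarith [hr.1, hr.2]
  have := (convex_Icc 0 s).norm_image_sub_le_of_norm_hasDerivWithin_le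
    (f := fun r => g r + g (-r) - 2 * g 0) (C := 2 * B * s) (x := 0) (y := s)
    (fun x _ => (hd1 x).hasDerivWithinAt) hd2 ⟨le_rfl, hs⟩ ⟨hs, le_rfl⟩
  rw [sub_zero, Real.norm_of_nonneg hs, Real.norm_eq_abs] at this
  have h0 : g 0 + g (-0) - 2 * g 0 = 0 := by rw [neg_zero]; ring
  simp only [h0, sub_zero] at this
  linarith

lemma tendsto_second_difference {g g' g'' : ℝ → ℝ}
    (h1 : ∀ r, HasDerivAt g (g' r) r) (h2 : ∀ r, HasDerivAt g' (g'' r) r)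
    (hc : ContinuousAt g'' 0) :
    Tendsto (fun s => (g s + g (-s) - 2 * g 0) / s ^ 2) (nhdsWithin 0 (Ioi 0))
      (nhds (g'' 0)) := by
  rw [Metric.tendsto_nhds]
  intro ε hε
  obtain ⟨δ, hδ, hc'⟩ := Metric.continuousAt_iff.1 hc (ε / 4) (by positivity)
  have : Ioo (0:ℝ) δ ∈ nhdsWithin (0:ℝ) (Ioi 0) := Ioo_mem_nhdsGT hδ
  filter_upwards [this] with s hs
  have hk := abs_second_difference_le (g := fun r => g r - g'' 0 * r ^ 2 / 2)
    (g' := fun r => g' r - g'' 0 * r) (g'' := fun r => g'' r - g'' 0) (s := s) (B := ε / 4)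
    hs.1.le
    (fun r => by
      have := (h1 r).sub (((hasDerivAt_pow 2 r).const_mul (g'' 0)).div_const 2)
      convert! this using 1
      simp; ring)
    (fun r => by
      have := (h2 r).sub ((hasDerivAt_id r).const_mul (g'' 0))
      convert! this using 1
      simp)
    (fun r hr => by
      have := hc' (x := r) (by rw [dist_zero_right, Real.norm_eq_abs]; linarith [hs.2])
      rw [Real.dist_eq] at this
      exact this.le)
  have hs2 : 0 < s ^ 2 := pow_pos hs.1 2
  rw [Real.dist_eq]
  have : (g s + g (-s) - 2 * g 0) / s ^ 2 - g'' 0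
      = ((g s - g'' 0 * s ^ 2 / 2) + (g (-s) - g'' 0 * (-s) ^ 2 / 2)
        - 2 * (g 0 - g'' 0 * 0 ^ 2 / 2)) / s ^ 2 := by
    have := hs.1.ne'
    field_simp; ring
  rw [this, abs_div, abs_of_pos hs2, div_lt_iff₀ hs2]
  refine hk.trans_lt ?_
  nlinarith

lemma HasCompactSupport.exists_norm_bound {V W : Type*} [NormedAddCommGroup V]
    [NormedAddCommGroup W] {G : V → W}
    (hs : HasCompactSupport G) (hG : Continuous G) : ∃ C, 0 ≤ C ∧ ∀ z, ‖G z‖ ≤ C := by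
  obtain ⟨C, hC⟩ := hs.exists_bound_of_continuous hG
  exact ⟨max C 0, le_max_right _ _, fun z => (hC z).trans (le_max_left _ _)⟩

section Line

variable {V : Type*} [NormedAddCommGroup V] [NormedSpace ℝ V] {H : V → ℝ}

lemma hasDerivAt_line (hH : ContDiff ℝ 2 H) (z v : V) (r : ℝ) :
    HasDerivAt (fun r : ℝ => H (z + r • v)) (fderiv ℝ H (z + r • v) v) r := by
  have h1 : HasDerivAt (fun r : ℝ => z + r • v) v r := by
    simpa using ((hasDerivAt_id r).smul_const v).const_add z
  exact ((hH.differentiable (by norm_num)) (z + r • v)).hasFDerivAt.comp_hasDerivAt r h1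

lemma hasDerivAt_line_fderiv (hH : ContDiff ℝ 2 H) (z v : V) (r : ℝ) :
    HasDerivAt (fun r : ℝ => fderiv ℝ H (z + r • v) v)
      (fderiv ℝ (fderiv ℝ H) (z + r • v) v v) r := by
  have h1 : HasDerivAt (fun r : ℝ => z + r • v) v r := by
    simpa using ((hasDerivAt_id r).smul_const v).const_add z
  have h2 : ContDiff ℝ 1 (fderiv ℝ H) := hH.fderiv_right (by norm_num)
  have h3 := ((h2.differentiable (by norm_num)) (z + r • v)).hasFDerivAt.comp_hasDerivAt r h1
  exact (ContinuousLinearMap.apply ℝ ℝ v).hasFDerivAt.comp_hasDerivAt r h3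

lemma abs_second_difference_line_le (hH : ContDiff ℝ 2 H) {C : ℝ}
    (hC : ∀ z, ‖fderiv ℝ (fderiv ℝ H) z‖ ≤ C) (z v : V) :
    |H (z + v) + H (z - v) - 2 * H z| ≤ 2 * C * ‖v‖ ^ 2 := by
  have := abs_second_difference_le (s := 1) (B := C * ‖v‖ ^ 2) zero_le_one
    (hasDerivAt_line hH z v) (hasDerivAt_line_fderiv hH z v) (fun r _ => by
      refine ((fderiv ℝ (fderiv ℝ H) (z + r • v)).le_opNorm₂ v v).trans ?_
      rw [pow_two, ← mul_assoc]
      gcongr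
      exact hC _)
  simp only [one_smul, zero_smul, add_zero, neg_smul, ← sub_eq_add_neg] at this
  linarith

lemma tendsto_second_difference_line (hH : ContDiff ℝ 2 H) (z v : V) :
    Tendsto (fun s : ℝ => (H (z + s • v) + H (z - s • v) - 2 * H z) / s ^ 2)
      (nhdsWithin 0 (Ioi 0)) (nhds (fderiv ℝ (fderiv ℝ H) z v v)) := by
  have hc : Continuous (fderiv ℝ (fderiv ℝ H)) := by
    have h2 : ContDiff ℝ 1 (fderiv ℝ H) := hH.fderiv_right (by norm_num)
    exact h2.continuous_fderiv (by norm_num)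
  have := tendsto_second_difference (hasDerivAt_line hH z v) (hasDerivAt_line_fderiv hH z v)
    (by fun_prop)
  simpa [← sub_eq_add_neg] using this

lemma exists_second_deriv_bound (hH : ContDiff ℝ 2 H) (hs : HasCompactSupport H) :
    ∃ C : ℝ, 0 ≤ C ∧ ∀ z : V, ‖fderiv ℝ (fderiv ℝ H) z‖ ≤ C := by
  have h2 : ContDiff ℝ 1 (fderiv ℝ H) := hH.fderiv_right (by norm_num)
  have h3 : Continuous (fderiv ℝ (fderiv ℝ H)) := h2.continuous_fderiv (by norm_num)
  have h4 : HasCompactSupport (fderiv ℝ (fderiv ℝ H)) := (hs.fderiv ℝ).fderiv ℝ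
  have := HasCompactSupport.exists_norm_bound (W := V →L[ℝ] V →L[ℝ] ℝ) h4 h3
  exact this

end Line

lemma IsTestFn.contDiff_two {N : ℕ} {T : ℝ}
    {η : EuclideanSpace ℝ (Fin N) → ℝ → ℝ} (hη : IsTestFn T η) :
    ContDiff ℝ 2 (Function.uncurry η) :=
  contDiff_infty.1 hη.1 2

lemma IsTestFn.exists_second_deriv_bound {N : ℕ} {T : ℝ}
    {η : EuclideanSpace ℝ (Fin N) → ℝ → ℝ} (hη : IsTestFn T η) :
    ∃ C, 0 ≤ C ∧ ∀ z, ‖fderiv ℝ (fderiv ℝ (Function.uncurry η)) z‖ ≤ C :=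
  _root_.exists_second_deriv_bound hη.contDiff_two hη.2.1

lemma IsTestFn.exists_bound {N : ℕ} {T : ℝ}
    {η : EuclideanSpace ℝ (Fin N) → ℝ → ℝ} (hη : IsTestFn T η) :
    ∃ C, 0 ≤ C ∧ ∀ x t, |η x t| ≤ C := by
  obtain ⟨C, hC⟩ := hη.2.1.exists_bound_of_continuous hη.1.continuous
  exact ⟨C, (norm_nonneg _).trans (hC 0), fun x t => hC (x, t)⟩

/-- The heat average of a test function at a fixed time. -/
def heatAvg {N : ℕ} (s : ℝ) (η : EuclideanSpace ℝ (Fin N) → ℝ → ℝ)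
    (x : EuclideanSpace ℝ (Fin N)) (t : ℝ) : ℝ :=
  ∫ y, η (x + y) t ∂(heatMeasure N s)

lemma IsTestFn.integrable_heatMeasure {N : ℕ} {T : ℝ}
    {η : EuclideanSpace ℝ (Fin N) → ℝ → ℝ} (hη : IsTestFn T η) (s : ℝ)
    (x : EuclideanSpace ℝ (Fin N)) (t : ℝ) :
    Integrable (fun y => η (x + y) t) (heatMeasure N s) := by
  obtain ⟨C, -, hC⟩ := hη.exists_bound
  refine (integrable_const C).mono' ?_ (Eventually.of_forall fun y => hC _ _)
  have : Continuous (fun y => Function.uncurry η (x + y, t)) :=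
    hη.1.continuous.comp (by fun_prop)
  exact this.aestronglyMeasurable

lemma IsTestFn.heatAvg_sub {N : ℕ} {T : ℝ}
    {η : EuclideanSpace ℝ (Fin N) → ℝ → ℝ} (hη : IsTestFn T η) {s : ℝ} (hs : 0 ≤ s)
    (x : EuclideanSpace ℝ (Fin N)) (t : ℝ) :
    heatAvg s η x t - η x t
      = (1 / 2) * ∫ y, (η (x + y) t + η (x - y) t - 2 * η x t) ∂(heatMeasure N s) := by
  have h1 := hη.integrable_heatMeasure s x t
  have h2 : Integrable (fun y => η (x - y) t) (heatMeasure N s) := by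
    have := h1
    rw [← heatMeasure_map_neg hs] at this
    have := (integrable_map_measure this.aestronglyMeasurable (by fun_prop)).1 this
    simpa [Function.comp_def, ← sub_eq_add_neg] using this
  have h3 : ∫ y, η (x - y) t ∂(heatMeasure N s) = heatAvg s η x t := by
    rw [heatAvg, ← integral_heatMeasure_neg hs]
    simp
  have h4 : Integrable (fun y => η (x + y) t + η (x - y) t) (heatMeasure N s) := h1.add h2
  rw [integral_sub h4 (integrable_const _), integral_add h1 h2, h3, ← heatAvg]
  simp
  ring

lemma IsTestFn.second_difference_le {N : ℕ} {T C : ℝ}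
    {η : EuclideanSpace ℝ (Fin N) → ℝ → ℝ} (hη : IsTestFn T η)
    (hC : ∀ z, ‖fderiv ℝ (fderiv ℝ (Function.uncurry η)) z‖ ≤ C)
    (x y : EuclideanSpace ℝ (Fin N)) (t : ℝ) :
    |η (x + y) t + η (x - y) t - 2 * η x t| ≤ 2 * C * ‖y‖ ^ 2 := by
  have := abs_second_difference_line_le hη.contDiff_two hC
    (x, t) (y, 0)
  simpa [Prod.norm_def] using this

lemma IsTestFn.abs_heatAvg_sub_le {N : ℕ} {T C : ℝ}
    {η : EuclideanSpace ℝ (Fin N) → ℝ → ℝ} (hη : IsTestFn T η)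
    (hC : ∀ z, ‖fderiv ℝ (fderiv ℝ (Function.uncurry η)) z‖ ≤ C) {s : ℝ} (hs : 0 ≤ s)
    (x : EuclideanSpace ℝ (Fin N)) (t : ℝ) :
    |heatAvg s η x t - η x t| ≤ C * (2 * N * s) := by
  rw [hη.heatAvg_sub hs, abs_mul, ← integral_norm_sq_heatMeasure hs]
  have : ‖∫ y, (η (x + y) t + η (x - y) t - 2 * η x t) ∂(heatMeasure N s)‖
      ≤ ∫ y, 2 * C * ‖y‖ ^ 2 ∂(heatMeasure N s) :=
    norm_integral_le_of_norm_le (integrable_norm_sq_heatMeasure.const_mul _)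
      (Eventually.of_forall fun y => hη.second_difference_le hC x y t)
  rw [integral_const_mul, Real.norm_eq_abs] at this
  rw [abs_of_pos (by norm_num : (0:ℝ) < 1 / 2)]
  linarith

lemma lapl_eq_sum {N : ℕ} {η : EuclideanSpace ℝ (Fin N) → ℝ → ℝ}
    (hη : ContDiff ℝ 2 (Function.uncurry η)) (x : EuclideanSpace ℝ (Fin N)) (t : ℝ) :
    lapl (fun y => η y t) x = ∑ i, fderiv ℝ (fderiv ℝ (Function.uncurry η)) (x, t)
      (EuclideanSpace.single i 1, 0) (EuclideanSpace.single i 1, 0) := by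
  have hd1 : ∀ (v y : EuclideanSpace ℝ (Fin N)), fderiv ℝ (fun y => η y t) y v
      = fderiv ℝ (Function.uncurry η) (y, t) (v, 0) := by
    intro v y
    have h1 := (hη.differentiable (by norm_num) (y, t)).hasFDerivAt.comp y
      (hasFDerivAt_prodMk_left (𝕜 := ℝ) y t)
    have h2 : (Function.uncurry η ∘ fun e => (e, t)) = fun y => η y t := rfl
    rw [h2] at h1
    rw [h1.fderiv]
    simp
  have h2 : ContDiff ℝ 1 (fderiv ℝ (Function.uncurry η)) := hη.fderiv_right (by norm_num)
  unfold lapl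
  refine Finset.sum_congr rfl fun i _ => ?_
  simp_rw [hd1]
  have h1 := (h2.differentiable (by norm_num) (x, t)).hasFDerivAt.comp x
      (hasFDerivAt_prodMk_left (𝕜 := ℝ) x t)
  have h3 := (ContinuousLinearMap.apply ℝ ℝ
    ((EuclideanSpace.single i (1:ℝ) : EuclideanSpace ℝ (Fin N)), (0:ℝ))).hasFDerivAt.comp x h1
  have h4 : ((ContinuousLinearMap.apply ℝ ℝ
    ((EuclideanSpace.single i (1:ℝ) : EuclideanSpace ℝ (Fin N)), (0:ℝ))) ∘
      fderiv ℝ (Function.uncurry η) ∘ fun e => (e, t))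
      = fun y => fderiv ℝ (Function.uncurry η) (y, t) (EuclideanSpace.single i 1, 0) := rfl
  rw [h4] at h3
  rw [h3.fderiv]
  simp

lemma integral_bilin_stdGaussian {N : ℕ} (B : EuclideanSpace ℝ (Fin N) →
      EuclideanSpace ℝ (Fin N) → ℝ)
    (hadd₁ : ∀ u v w, B (u + v) w = B u w + B v w) (hsmul₁ : ∀ (c : ℝ) u w, B (c • u) w = c * B u w)
    (hadd₂ : ∀ u v w, B u (v + w) = B u v + B u w)
    (hsmul₂ : ∀ (c : ℝ) u w, B u (c • w) = c * B u w) :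
    ∫ ξ, B ξ ξ ∂(ProbabilityTheory.stdGaussian (EuclideanSpace ℝ (Fin N)))
      = ∑ i, B (EuclideanSpace.single i 1) (EuclideanSpace.single i 1) := by
  have hs1 : ∀ (s : Finset (Fin N)) (f : Fin N → EuclideanSpace ℝ (Fin N)) w,
      B (∑ i ∈ s, f i) w = ∑ i ∈ s, B (f i) w := fun s f w =>
    map_sum (AddMonoidHom.mk' (fun u => B u w) fun u v => hadd₁ u v w) f s
  have hs2 : ∀ (s : Finset (Fin N)) (f : Fin N → EuclideanSpace ℝ (Fin N)) w,
      B w (∑ i ∈ s, f i) = ∑ i ∈ s, B w (f i) := fun s f w =>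
    map_sum (AddMonoidHom.mk' (fun u => B w u) fun u v => hadd₂ w u v) f s
  have hexp : ∀ ξ : EuclideanSpace ℝ (Fin N), B ξ ξ = ∑ i, ∑ j, ξ i * ξ j *
      B (EuclideanSpace.single i 1) (EuclideanSpace.single j 1) := by
    intro ξ
    have h : ξ = ∑ i, ξ i • (EuclideanSpace.single i (1:ℝ) : EuclideanSpace ℝ (Fin N)) := by
      ext j
      simp [Finset.sum_apply, Pi.single_apply]
    conv_lhs => rw [h]
    rw [hs1]
    refine Finset.sum_congr rfl fun i _ => ?_
    rw [hs2]
    refine Finset.sum_congr rfl fun j _ => ?_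
    rw [hsmul₁, hsmul₂, mul_assoc]
  simp_rw [hexp]
  rw [integral_finsetSum _ fun i _ => integrable_finsetSum _ fun j _ =>
    (integrable_coord_mul_stdGaussian i j).mul_const _]
  refine Finset.sum_congr rfl fun i _ => ?_
  rw [integral_finsetSum _ fun j _ => (integrable_coord_mul_stdGaussian i j).mul_const _]
  simp_rw [integral_mul_const, integral_coord_mul_stdGaussian]
  simp

lemma IsTestFn.tendsto_heatAvg_sub_div {N : ℕ} {T : ℝ}
    {η : EuclideanSpace ℝ (Fin N) → ℝ → ℝ} (hη : IsTestFn T η)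
    (x : EuclideanSpace ℝ (Fin N)) (t : ℝ) :
    Tendsto (fun h => (heatAvg h η x t - η x t) / h) (nhdsWithin 0 (Ioi 0))
      (nhds (lapl (fun y => η y t) x)) := by
  obtain ⟨C, hC0, hC⟩ := hη.exists_second_deriv_bound
  have hcont : Continuous (Function.uncurry η) := hη.1.continuous
  have hηc : Continuous fun y => η y t := hcont.comp (Continuous.prodMk_left t)
  have hsq : Tendsto (fun h : ℝ => √(2 * h)) (nhdsWithin 0 (Ioi 0)) (nhdsWithin 0 (Ioi 0)) := by
    refine tendsto_nhdsWithin_iff.2 ⟨?_, ?_⟩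
    · have : Continuous fun h : ℝ => √(2 * h) := by fun_prop
      simpa using (this.tendsto 0).mono_left (nhdsWithin_le_nhds (s := Ioi 0))
    · filter_upwards [self_mem_nhdsWithin] with h hh
      have : (0:ℝ) < h := hh
      exact Real.sqrt_pos.2 (by positivity)
  have key : Tendsto (fun h : ℝ => ∫ ξ, (η (x + √(2 * h) • ξ) t + η (x - √(2 * h) • ξ) t
      - 2 * η x t) / (√(2 * h)) ^ 2 ∂(ProbabilityTheory.stdGaussian (EuclideanSpace ℝ (Fin N))))
      (nhdsWithin 0 (Ioi 0)) (nhds (∫ ξ, fderiv ℝ (fderiv ℝ (Function.uncurry η)) (x, t)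
        (ξ, 0) (ξ, 0) ∂(ProbabilityTheory.stdGaussian (EuclideanSpace ℝ (Fin N))))) := by
    refine tendsto_integral_filter_of_dominated_convergence (fun ξ => 2 * C * ‖ξ‖ ^ 2) ?_ ?_ ?_ ?_
    · refine Eventually.of_forall fun h => Continuous.aestronglyMeasurable ?_
      have h1 : Continuous fun ξ => η (x + √(2 * h) • ξ) t := hηc.comp (by fun_prop)
      have h2 : Continuous fun ξ => η (x - √(2 * h) • ξ) t := hηc.comp (by fun_prop)
      fun_prop
    · filter_upwards [self_mem_nhdsWithin] with h hh
      have hh' : (0:ℝ) < h := hh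
      refine Eventually.of_forall fun ξ => ?_
      have h0 : 0 < √(2 * h) := Real.sqrt_pos.2 (by positivity)
      rw [Real.norm_eq_abs, abs_div, abs_of_pos (pow_pos h0 2), div_le_iff₀ (pow_pos h0 2)]
      refine (hη.second_difference_le hC x _ t).trans_eq ?_
      rw [norm_smul, Real.norm_of_nonneg h0.le]
      ring
    · have : Integrable (fun ξ => ‖ξ‖ ^ 2)
          (ProbabilityTheory.stdGaussian (EuclideanSpace ℝ (Fin N))) := by
        have := (ProbabilityTheory.IsGaussian.memLp_two_id
          (μ := ProbabilityTheory.stdGaussian (EuclideanSpace ℝ (Fin N))))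
        exact this.norm.integrable_sq
      exact this.const_mul _
    · refine Eventually.of_forall fun ξ => ?_
      have := (tendsto_second_difference_line hη.contDiff_two (x, t) (ξ, 0)).comp hsq
      simpa [Function.comp_def] using this
  have hlim := integral_bilin_stdGaussian
    (fun u v : EuclideanSpace ℝ (Fin N) =>
      fderiv ℝ (fderiv ℝ (Function.uncurry η)) (x, t) (u, 0) (v, 0))
    (fun u v w => by
      have : ((u + v, 0) : EuclideanSpace ℝ (Fin N) × ℝ) = (u, 0) + (v, 0) := by simp
      simp only [this, map_add, _root_.add_apply])
    (fun c u w => by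
      have : ((c • u, 0) : EuclideanSpace ℝ (Fin N) × ℝ) = c • (u, 0) := by simp
      simp only [this, map_smul, _root_.smul_apply, smul_eq_mul])
    (fun u v w => by
      have : ((v + w, 0) : EuclideanSpace ℝ (Fin N) × ℝ) = (v, 0) + (w, 0) := by simp
      simp only [this, map_add])
    (fun c u w => by
      have : ((c • w, 0) : EuclideanSpace ℝ (Fin N) × ℝ) = c • (w, 0) := by simp
      simp only [this, map_smul, smul_eq_mul])
  rw [lapl_eq_sum hη.contDiff_two, ← hlim]
  refine key.congr' ?_
  filter_upwards [self_mem_nhdsWithin] with h hh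
  have hh' : (0:ℝ) < h := hh
  rw [hη.heatAvg_sub hh'.le, integral_heatMeasure_scale
    (fun y => η (x + y) t + η (x - y) t - 2 * η x t) ?_, integral_div, Real.sq_sqrt (by positivity)]
  · field_simp
  · have h1 : Continuous fun ξ => η (x + ξ) t := hηc.comp (by fun_prop)
    have h2 : Continuous fun ξ => η (x - ξ) t := hηc.comp (by fun_prop)
    exact Continuous.measurable (by fun_prop)

lemma IsTestFn.integrable_slice {N : ℕ} {T : ℝ}
    {η : EuclideanSpace ℝ (Fin N) → ℝ → ℝ} (hη : IsTestFn T η) (t : ℝ) :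
    Integrable (fun x => η x t) := by
  have hc : Continuous fun y => η y t := hη.1.continuous.comp (Continuous.prodMk_left t)
  refine hc.integrable_of_hasCompactSupport ?_
  refine HasCompactSupport.intro (hη.2.1.isCompact.image continuous_fst) fun x hx => ?_
  by_contra hne
  exact hx ⟨(x, t), subset_tsupport _ hne, rfl⟩

lemma IsTestFn.integral_heatOp_mul {N : ℕ} {T s : ℝ} (hs : 0 ≤ s)
    {η : EuclideanSpace ℝ (Fin N) → ℝ → ℝ} (hη : IsTestFn T η)
    (w : EuclideanSpace ℝ (Fin N) →ᵇ ℝ) (t : ℝ) :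
    ∫ x, heatOp N s w x * η x t = ∫ x, w x * heatAvg s η x t := by
  have hc : Continuous fun y => η y t := hη.1.continuous.comp (Continuous.prodMk_left t)
  have hi := hη.integrable_slice t
  set μ := heatMeasure N s with hμ
  have hint1 : Integrable (fun z : EuclideanSpace ℝ (Fin N) × EuclideanSpace ℝ (Fin N) =>
      w (z.1 + z.2) * η z.2 t) (μ.prod volume) := by
    refine ((hi.norm.const_mul ‖w‖).comp_snd μ).mono' ?_ ?_
    · exact Continuous.aestronglyMeasurable
        ((w.continuous.comp (by fun_prop)).mul (hc.comp continuous_snd))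
    · refine Eventually.of_forall fun z => ?_
      rw [norm_mul]
      gcongr
      exact w.norm_coe_le_norm _
  have hT := measurePreserving_prod_add μ (volume : Measure (EuclideanSpace ℝ (Fin N)))
  have hgc : Continuous (fun z : EuclideanSpace ℝ (Fin N) × EuclideanSpace ℝ (Fin N) =>
      w z.2 * η (z.2 - z.1) t) :=
    (w.continuous.comp continuous_snd).mul (hc.comp (by fun_prop))
  have hcomp : (fun z : EuclideanSpace ℝ (Fin N) × EuclideanSpace ℝ (Fin N) =>
      w z.2 * η (z.2 - z.1) t) ∘
      (fun z : EuclideanSpace ℝ (Fin N) × EuclideanSpace ℝ (Fin N) => (z.1, z.1 + z.2))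
      = fun z : EuclideanSpace ℝ (Fin N) × EuclideanSpace ℝ (Fin N) => w (z.1 + z.2) * η z.2 t := by
    ext z; simp
  have hint2 : Integrable (fun z : EuclideanSpace ℝ (Fin N) × EuclideanSpace ℝ (Fin N) =>
      w z.2 * η (z.2 - z.1) t) (μ.prod volume) := by
    rw [← hT.integrable_comp hgc.aestronglyMeasurable, hcomp]
    exact hint1
  have heq : ∫ z : EuclideanSpace ℝ (Fin N) × EuclideanSpace ℝ (Fin N),
        w (z.1 + z.2) * η z.2 t ∂(μ.prod volume)
      = ∫ z : EuclideanSpace ℝ (Fin N) × EuclideanSpace ℝ (Fin N),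
        w z.2 * η (z.2 - z.1) t ∂(μ.prod volume) := by
    conv_rhs => rw [← hT.map_eq]
    rw [integral_map hT.measurable.aemeasurable hgc.aestronglyMeasurable, ← hcomp]
    rfl
  rw [integral_prod_symm _ hint1, integral_prod_symm _ hint2] at heq
  simp only [integral_mul_const, integral_const_mul] at heq
  have e1 : ∀ y, ∫ x, w (x + y) ∂μ = heatOp N s w y := fun y => by
    rw [heatOp_apply]; simp_rw [add_comm]; rfl
  have e2 : ∀ y, ∫ x, η (y - x) t ∂μ = heatAvg s η y t := fun y => by
    rw [heatAvg, ← integral_heatMeasure_neg hs]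
    simp [sub_eq_add_neg]
  simp_rw [e1, e2] at heq
  exact heq

lemma exists_solution_of_bounded_lipschitz {X : Type*} [NormedAddCommGroup X] [NormedSpace ℝ X]
    [CompleteSpace X] {G : X → X} {L K : NNReal} (hL : ∀ x, ‖G x‖ ≤ L) (hK : LipschitzWith K G)
    (x₀ : X) {T : ℝ} (hT : 0 ≤ T) :
    ∃ u : ℝ → X, Continuous u ∧ u 0 = x₀ ∧ ∀ t ∈ Icc 0 T, HasDerivAt u (G (u t)) t := by
  have h0 : (0:ℝ) ∈ Icc (-1) (T + 1) := ⟨by norm_num, by linarith⟩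
  have hpl : IsPicardLindelof (fun _ => G) (⟨0, h0⟩ : Icc (-1) (T + 1)) x₀
      (L * Real.toNNReal (T + 1)) 0 L K := by
    refine IsPicardLindelof.of_time_independent (fun x _ => hL x) hK.lipschitzOnWith ?_
    have : max (T + 1 - 0) (0 - (-1)) = T + 1 := by
      rw [max_eq_left (by linarith), sub_zero]
    simp only [this]
    rw [NNReal.coe_mul, Real.coe_toNNReal _ (by positivity), NNReal.coe_zero, sub_zero]
  obtain ⟨α, hα0, hα⟩ := hpl.exists_eq_forall_mem_Icc_hasDerivWithinAt₀
  have hαc : ContinuousOn α (Icc (-1) (T + 1)) := fun t ht => (hα t ht).continuousWithinAt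
  have hle : (-1:ℝ) ≤ T + 1 := by linarith
  refine ⟨fun t => α (projIcc (-1) (T + 1) hle t), ?_, ?_, ?_⟩
  · exact (continuousOn_iff_continuous_domRestrict.1 hαc).comp continuous_projIcc
  · simp only [projIcc_of_mem hle h0]
    exact hα0
  · intro t ht
    have ht' : t ∈ Icc (-1) (T + 1) := ⟨by linarith [ht.1], by linarith [ht.2]⟩
    have hn : Icc (-1) (T + 1) ∈ nhds t := Icc_mem_nhds (by linarith [ht.1]) (by linarith [ht.2])
    have h1 := (hα t ht').hasDerivAt hn
    simp only [projIcc_of_mem hle ht']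
    refine h1.congr_of_eventuallyEq ?_
    filter_upwards [hn] with r hr
    simp only [projIcc_of_mem hle hr]

/-- The field of the nonlocal approximate problem. -/
def approxField {N : ℕ} (h : ℝ) {φ g : ℝ → ℝ} {Lφ Lg : NNReal} (hφ : LipschitzWith Lφ φ)
    (hg : LipschitzWith Lg g) (f w : EuclideanSpace ℝ (Fin N) →ᵇ ℝ) :
    EuclideanSpace ℝ (Fin N) →ᵇ ℝ :=
  h⁻¹ • (heatOp N h (w.comp φ hφ) - w.comp φ hφ) + f * w.comp g hg

lemma approxField_apply {N : ℕ} (h : ℝ) {φ g : ℝ → ℝ} {Lφ Lg : NNReal} (hφ : LipschitzWith Lφ φ)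
    (hg : LipschitzWith Lg g) (f w : EuclideanSpace ℝ (Fin N) →ᵇ ℝ) (x : EuclideanSpace ℝ (Fin N)) :
    approxField h hφ hg f w x = (heatOp N h (w.comp φ hφ) x - φ (w x)) / h + f x * g (w x) := by
  simp [approxField, div_eq_inv_mul]

lemma exists_approx_solution {N : ℕ} {h : ℝ} (hh : 0 < h) {φ g : ℝ → ℝ} {Lφ Lg : NNReal}
    (hφ : LipschitzWith Lφ φ) (hg : LipschitzWith Lg g) {Bφ Bg : ℝ} (hBφ : ∀ s, |φ s| ≤ Bφ)
    (hBg : ∀ s, |g s| ≤ Bg) (f u₀ : EuclideanSpace ℝ (Fin N) →ᵇ ℝ) {T : ℝ} (hT : 0 ≤ T) :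
    ∃ u : ℝ → (EuclideanSpace ℝ (Fin N) →ᵇ ℝ), Continuous u ∧ u 0 = u₀ ∧
      ∀ t ∈ Icc 0 T, HasDerivAt u (approxField h hφ hg f (u t)) t := by
  have hBφ0 : 0 ≤ Bφ := (abs_nonneg _).trans (hBφ 0)
  have hBg0 : 0 ≤ Bg := (abs_nonneg _).trans (hBg 0)
  have hnφ : ∀ w : EuclideanSpace ℝ (Fin N) →ᵇ ℝ, ‖w.comp φ hφ‖ ≤ Bφ := fun w =>
    (BoundedContinuousFunction.norm_le hBφ0).2 fun x => hBφ _
  have hng : ∀ w : EuclideanSpace ℝ (Fin N) →ᵇ ℝ, ‖w.comp g hg‖ ≤ Bg := fun w =>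
    (BoundedContinuousFunction.norm_le hBg0).2 fun x => hBg _
  have hP : ∀ w, ‖heatOp N h w‖ ≤ ‖w‖ := fun w => by
    simpa using (heatOp N h).le_of_opNorm_le (norm_heatOp_le h) w
  have hlφ := BoundedContinuousFunction.lipschitz_comp (α := EuclideanSpace ℝ (Fin N)) hφ
  have hlg := BoundedContinuousFunction.lipschitz_comp (α := EuclideanSpace ℝ (Fin N)) hg
  refine exists_solution_of_bounded_lipschitz (G := approxField h hφ hg f)
    (L := Real.toNNReal (h⁻¹ * (Bφ + Bφ) + ‖f‖ * Bg))
    (K := Real.toNNReal (h⁻¹ * (Lφ + Lφ) + ‖f‖ * Lg)) ?_ ?_ u₀ hT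
  · intro w
    rw [Real.coe_toNNReal _ (by positivity)]
    refine (norm_add_le _ _).trans (add_le_add ?_ ?_)
    · rw [norm_smul, Real.norm_of_nonneg (by positivity)]
      gcongr
      exact (norm_sub_le _ _).trans (add_le_add ((hP _).trans (hnφ w)) (hnφ w))
    · refine (norm_mul_le _ _).trans ?_
      gcongr
      exact hng w
  · refine LipschitzWith.of_dist_le_mul fun w v => ?_
    rw [Real.coe_toNNReal _ (by positivity), dist_eq_norm, dist_eq_norm]
    have e : approxField h hφ hg f w - approxField h hφ hg f v
        = h⁻¹ • (heatOp N h (w.comp φ hφ - v.comp φ hφ) - (w.comp φ hφ - v.comp φ hφ))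
          + f * (w.comp g hg - v.comp g hg) := by
      simp only [approxField, map_sub, smul_sub, mul_sub]
      abel
    have h1 : ‖w.comp φ hφ - v.comp φ hφ‖ ≤ Lφ * ‖w - v‖ := by
      simpa [dist_eq_norm] using hlφ.dist_le_mul w v
    have h2 : ‖w.comp g hg - v.comp g hg‖ ≤ Lg * ‖w - v‖ := by
      simpa [dist_eq_norm] using hlg.dist_le_mul w v
    rw [e, add_mul]
    refine (norm_add_le _ _).trans (add_le_add ?_ ?_)
    · rw [norm_smul, Real.norm_of_nonneg (by positivity), mul_assoc, add_mul]
      gcongr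
      exact (norm_sub_le _ _).trans (add_le_add ((hP _).trans h1) h1)
    · refine (norm_mul_le _ _).trans ?_
      rw [mul_assoc]
      gcongr

lemma le_of_forall_eq_exists_deriv_lt {D G : ℝ → ℝ} {T : ℝ} (hD : ContinuousOn D (Icc 0 T))
    (hG : ContinuousOn G (Icc 0 T)) (h0 : D 0 ≤ G 0)
    (hderiv : ∀ t ∈ Ico 0 T, D t = G t → ∃ d g, HasDerivAt D d t ∧ HasDerivAt G g t ∧ d < g) :
    ∀ t ∈ Icc 0 T, D t ≤ G t := by
  have hclosed : IsClosed ({t | D t ≤ G t} ∩ Icc 0 T) := by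
    have := isClosed_Icc.isClosed_le hD hG
    convert this using 1
    ext t; simp [and_comm]
  refine hclosed.Icc_subset_of_forall_mem_nhdsWithin h0 ?_
  rintro t ⟨ht, htI⟩
  have ht : D t ≤ G t := ht
  rcases ht.lt_or_eq with hlt | heq
  · have hd : ContinuousWithinAt D (Ioi t) t :=
      (hD t ⟨htI.1, htI.2.le⟩).mono_of_mem_nhdsWithin
        (mem_of_superset (Icc_mem_nhdsGT htI.2) (Icc_subset_Icc_left htI.1))
    have hg : ContinuousWithinAt G (Ioi t) t :=
      (hG t ⟨htI.1, htI.2.le⟩).mono_of_mem_nhdsWithin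
        (mem_of_superset (Icc_mem_nhdsGT htI.2) (Icc_subset_Icc_left htI.1))
    filter_upwards [hd.tendsto.eventually_lt hg.tendsto hlt] with s hs using hs.le
  · obtain ⟨d, g, h1, h2, hdg⟩ := hderiv t htI heq
    have h3 := (hasDerivAt_iff_tendsto_slope.1 (h1.sub h2)).eventually_lt_const
      (sub_neg.2 hdg)
    have h4 := (nhdsGT_le_nhdsNE t) h3
    filter_upwards [h4, self_mem_nhdsWithin] with s hs hts
    have hts : t < s := hts
    simp only [slope_def_field, Pi.sub_apply, heq] at hs
    rw [div_lt_iff₀ (sub_pos.2 hts)] at hs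
    show D s ≤ G s
    linarith

/-- Comparison principle for the nonlocal approximate problem. -/
lemma approx_comparison {N : ℕ} {h : ℝ} (hh : 0 < h) {φ g : ℝ → ℝ} {Lφ Lg : NNReal}
    (hφ : LipschitzWith Lφ φ) (hg : LipschitzWith Lg g) (hφm : Monotone φ)
    {f : EuclideanSpace ℝ (Fin N) → ℝ} {K : ℝ} (hf0 : ∀ x, 0 ≤ f x) (hfK : ∀ x, f x ≤ K) {T : ℝ}
    {a b : EuclideanSpace ℝ (Fin N) → ℝ → ℝ}
    {A B : ℝ → (EuclideanSpace ℝ (Fin N) →ᵇ ℝ)}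
    (hA : ∀ t ∈ Icc 0 T, ∀ x, A t x ≤ φ (a x t)) (hB : ∀ t ∈ Icc 0 T, ∀ x, φ (b x t) ≤ B t x)
    (hac : ∀ x, ContinuousOn (a x) (Icc 0 T)) (hbc : ∀ x, ContinuousOn (b x) (Icc 0 T))
    (h0 : ∀ x, a x 0 ≤ b x 0) {Q : ℝ} (hQ : ∀ t ∈ Icc 0 T, ∀ x, a x t - b x t ≤ Q)
    (hd : ∀ t ∈ Ico 0 T, ∀ x, b x t < a x t → ∃ a' b', HasDerivAt (a x) a' t ∧
      HasDerivAt (b x) b' t ∧ a' ≤ (heatOp N h (A t) x - φ (a x t)) / h + f x * g (a x t) ∧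
      (heatOp N h (B t) x - φ (b x t)) / h + f x * g (b x t) ≤ b') :
    ∀ t ∈ Icc 0 T, ∀ x, a x t ≤ b x t := by
  have hK0 : 0 ≤ K := (hf0 0).trans (hfK 0)
  set C : ℝ := Lφ / h + K * Lg + 1 with hC
  have hC0 : 0 < C := by positivity
  have hφpos : ∀ r s q, r - s ≤ q → 0 ≤ q → φ r - φ s ≤ Lφ * q := by
    intro r s q hq hq0
    rcases le_total r s with hrs | hrs
    · have := hφm hrs
      have : 0 ≤ (Lφ : ℝ) * q := by positivity
      linarith
    · have := (abs_le.1 (hφ.dist_le_mul r s)).2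
      rw [Real.dist_eq, abs_of_nonneg (sub_nonneg.2 hrs)] at this
      exact this.trans (by gcongr)
  have step : ∀ q, 0 < q → (∀ t ∈ Icc 0 T, ∀ x, a x t - b x t ≤ q * Real.exp (2 * C * t)) →
      ∀ t ∈ Icc 0 T, ∀ x, a x t - b x t ≤ q / 2 * Real.exp (2 * C * t) := by
    intro q hq hle t ht x
    refine le_of_forall_eq_exists_deriv_lt (D := fun t => a x t - b x t)
      (G := fun t => q / 2 * Real.exp (2 * C * t)) ((hac x).sub (hbc x)) (by fun_prop) ?_ ?_ t ht
    · have := h0 x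
      simp only [mul_zero, Real.exp_zero]
      linarith
    · intro t ht heq
      have heq : a x t - b x t = q / 2 * Real.exp (2 * C * t) := heq
      have hpos : 0 < q / 2 * Real.exp (2 * C * t) := by positivity
      have htI : t ∈ Icc 0 T := ⟨ht.1, ht.2.le⟩
      obtain ⟨a', b', ha', hb', h1, h2⟩ := hd t ht x (by linarith)
      have hG : HasDerivAt (fun t => q / 2 * Real.exp (2 * C * t))
          (q / 2 * (Real.exp (2 * C * t) * (2 * C))) t := by
        have := ((hasDerivAt_id t).const_mul (2 * C)).exp.const_mul (q / 2)
        simpa using this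
      refine ⟨_, _, ha'.sub hb', hG, ?_⟩
      have hheat : heatOp N h (A t) x - heatOp N h (B t) x
          ≤ Lφ * (q * Real.exp (2 * C * t)) := by
        have := heatOp_le_const (N := N) h (w := A t - B t)
          (C := Lφ * (q * Real.exp (2 * C * t))) (fun y => by
            have h1 := hA t htI y
            have h2 := hB t htI y
            have h3 := hφpos _ _ _ (hle t htI y) (by positivity)
            rw [BoundedContinuousFunction.sub_apply]
            linarith) x
        rwa [map_sub, BoundedContinuousFunction.sub_apply] at this
      have hmon : φ (b x t) ≤ φ (a x t) := hφm (by linarith)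
      have hgl : f x * g (a x t) - f x * g (b x t)
          ≤ K * Lg * (q * Real.exp (2 * C * t)) := by
        have h3 := (abs_le.1 (hg.dist_le_mul (a x t) (b x t))).2
        rw [Real.dist_eq, heq, abs_of_pos hpos] at h3
        have h4 : g (a x t) - g (b x t) ≤ Lg * (q * Real.exp (2 * C * t)) := by
          refine h3.trans ?_
          gcongr
          linarith
        calc f x * g (a x t) - f x * g (b x t) = f x * (g (a x t) - g (b x t)) := by ring
          _ ≤ f x * (Lg * (q * Real.exp (2 * C * t))) :=
            mul_le_mul_of_nonneg_left h4 (hf0 x)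
          _ ≤ K * (Lg * (q * Real.exp (2 * C * t))) :=
            mul_le_mul_of_nonneg_right (hfK x) (by positivity)
          _ = _ := by ring
      have e1 : (heatOp N h (A t) x - φ (a x t)) / h - (heatOp N h (B t) x - φ (b x t)) / h
          ≤ Lφ / h * (q * Real.exp (2 * C * t)) := by
        rw [← sub_div, div_mul_eq_mul_div]
        gcongr
        linarith
      have e2 : q / 2 * (Real.exp (2 * C * t) * (2 * C)) = Lφ / h * (q * Real.exp (2 * C * t))
          + K * Lg * (q * Real.exp (2 * C * t)) + q * Real.exp (2 * C * t) := by
        rw [hC]; ring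
      have e3 : 0 < q * Real.exp (2 * C * t) := by positivity
      linarith
  have hall : ∀ k : ℕ, ∀ t ∈ Icc 0 T, ∀ x,
      a x t - b x t ≤ (|Q| + 1) / 2 ^ k * Real.exp (2 * C * t) := by
    intro k
    induction k with
    | zero =>
      intro t ht x
      have h1 := hQ t ht x
      have h2 : 1 ≤ Real.exp (2 * C * t) := Real.one_le_exp (by have := ht.1; positivity)
      have h3 := le_abs_self Q
      have h4 := abs_nonneg Q
      simp only [pow_zero, div_one]
      nlinarith
    | succ k ih =>
      have := step _ (by positivity) ih
      intro t ht x
      convert this t ht x using 2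
      rw [pow_succ, div_div]
  intro t ht x
  have hlim : Tendsto (fun k : ℕ => (|Q| + 1) / 2 ^ k * Real.exp (2 * C * t)) atTop (nhds 0) := by
    have := (tendsto_pow_atTop_nhds_zero_of_lt_one (r := (1 / 2 : ℝ)) (by norm_num)
      (by norm_num)).const_mul ((|Q| + 1) * Real.exp (2 * C * t))
    rw [mul_zero] at this
    refine this.congr fun k => ?_
    rw [one_div, inv_pow]; ring
  have := ge_of_tendsto' hlim fun k => hall k t ht x
  linarith

/-- The function `s ↦ s ^ m` frozen outside `[0, M]`. -/
def clampPow (m M s : ℝ) : ℝ := (max 0 (min s M)) ^ m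

/-- The source nonlinearity `s ^ p`, made Lipschitz near the origin. -/
def srcFun (p n s : ℝ) : ℝ := min (s ^ p) (n * s)

/-- The function `srcFun` frozen outside `[0, M]`. -/
def clampSrc (p n M s : ℝ) : ℝ := srcFun p n (max 0 (min s M))

lemma clamp_of_mem {M s : ℝ} (h0 : 0 ≤ s) (h1 : s ≤ M) : max 0 (min s M) = s := by
  rw [min_eq_left h1, max_eq_right h0]

lemma clamp_nonneg (M s : ℝ) : 0 ≤ max 0 (min s M) := le_max_left _ _

lemma clamp_le {M : ℝ} (hM : 0 ≤ M) (s : ℝ) : max 0 (min s M) ≤ M :=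
  max_le hM (min_le_right _ _)

lemma clamp_mono (M : ℝ) : Monotone fun s : ℝ => max 0 (min s M) := fun _ _ h =>
  max_le_max le_rfl (min_le_min h le_rfl)

lemma clamp_lipschitz (M : ℝ) : LipschitzWith 1 fun s : ℝ => max 0 (min s M) :=
  (LipschitzWith.id.min_const M).const_max 0

lemma clampPow_of_mem {m M s : ℝ} (h0 : 0 ≤ s) (h1 : s ≤ M) : clampPow m M s = s ^ m := by
  rw [clampPow, clamp_of_mem h0 h1]

lemma clampSrc_of_mem {p n M s : ℝ} (h0 : 0 ≤ s) (h1 : s ≤ M) :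
    clampSrc p n M s = srcFun p n s := by
  rw [clampSrc, clamp_of_mem h0 h1]

lemma clampPow_nonneg (m M s : ℝ) : 0 ≤ clampPow m M s := Real.rpow_nonneg (clamp_nonneg M s) m

lemma clampPow_le {m M : ℝ} (hm : 0 ≤ m) (hM : 0 ≤ M) (s : ℝ) : clampPow m M s ≤ M ^ m :=
  Real.rpow_le_rpow (clamp_nonneg M s) (clamp_le hM s) hm

lemma clampPow_le_rpow {m M s : ℝ} (hm : 0 ≤ m) (hs : 0 ≤ s) : clampPow m M s ≤ s ^ m :=
  Real.rpow_le_rpow (clamp_nonneg M s) (max_le hs (min_le_left _ _)) hm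

lemma clampPow_mono {m M : ℝ} (hm : 0 ≤ m) : Monotone (clampPow m M) := fun _ _ h =>
  Real.rpow_le_rpow (clamp_nonneg _ _) (clamp_mono M h) hm

lemma continuous_clampPow {m M : ℝ} (hm : 0 ≤ m) : Continuous (clampPow m M) :=
  (clamp_lipschitz M).continuous.rpow_const fun _ => Or.inr hm

lemma clampPow_lipschitz {m M : ℝ} (hm : 1 ≤ m) (hM : 0 ≤ M) :
    LipschitzWith (Real.toNNReal (m * M ^ (m - 1))) (clampPow m M) := by
  have hm0 : 0 ≤ m := by linarith
  refine LipschitzWith.of_dist_le_mul fun a b => ?_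
  rw [Real.coe_toNNReal _ (by positivity), Real.dist_eq, Real.dist_eq]
  have h := (convex_Icc 0 M).norm_image_sub_le_of_norm_hasDerivWithin_le
    (f := fun s : ℝ => s ^ m) (f' := fun s => m * s ^ (m - 1)) (C := m * M ^ (m - 1))
    (x := max 0 (min b M)) (y := max 0 (min a M))
    (fun x _ => (Real.hasDerivAt_rpow_const (Or.inr hm)).hasDerivWithinAt)
    (fun x hx => by
      rw [Real.norm_of_nonneg (mul_nonneg hm0 (Real.rpow_nonneg hx.1 _))]
      gcongr
      · exact hx.1
      · exact hx.2)
    ⟨clamp_nonneg _ _, clamp_le hM _⟩ ⟨clamp_nonneg _ _, clamp_le hM _⟩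
  refine h.trans ?_
  have h2 := (clamp_lipschitz M).dist_le_mul a b
  rw [Real.dist_eq, Real.dist_eq, NNReal.coe_one, one_mul] at h2
  rw [Real.norm_eq_abs]
  gcongr

lemma srcFun_nonneg {p n s : ℝ} (hn : 0 ≤ n) (hs : 0 ≤ s) : 0 ≤ srcFun p n s :=
  le_min (Real.rpow_nonneg hs p) (mul_nonneg hn hs)

lemma srcFun_le_rpow (p n s : ℝ) : srcFun p n s ≤ s ^ p := min_le_left _ _

lemma srcFun_mono {p n s t : ℝ} (hp : 0 ≤ p) (hn : 0 ≤ n) (hs : 0 ≤ s) (h : s ≤ t) :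
    srcFun p n s ≤ srcFun p n t :=
  min_le_min (Real.rpow_le_rpow hs h hp) (mul_le_mul_of_nonneg_left h hn)

lemma srcFun_mul_le {p n s l : ℝ} (hp : p ≤ 1) (hs : 0 ≤ s) (hl : 1 ≤ l) :
    srcFun p n (l * s) ≤ l * srcFun p n s := by
  have hl0 : 0 ≤ l := by linarith
  unfold srcFun
  rw [mul_min_of_nonneg _ _ hl0]
  refine min_le_min ?_ (by rw [mul_left_comm])
  rw [Real.mul_rpow hl0 hs]
  gcongr
  calc l ^ p ≤ l ^ (1:ℝ) := Real.rpow_le_rpow_of_exponent_le hl hp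
    _ = l := Real.rpow_one l

lemma srcFun_sub_le {p n s t : ℝ} (hp0 : 0 < p) (hp : p ≤ 1) (hs : 0 ≤ s) (h : s ≤ t) :
    srcFun p n t - srcFun p n s ≤ n * (t - s) := by
  rcases hs.eq_or_lt with rfl | hs
  · simp [srcFun, Real.zero_rpow hp0.ne']
  · have h1 := srcFun_mul_le (n := n) hp hs.le ((one_le_div hs).2 h)
    rw [div_mul_cancel₀ _ hs.ne'] at h1
    have h2 : srcFun p n s ≤ n * s := min_le_right _ _
    have h3 : srcFun p n t - srcFun p n s ≤ (t / s - 1) * srcFun p n s := by linarith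
    refine h3.trans ?_
    have h4 : 0 ≤ t / s - 1 := by
      have := (one_le_div hs).2 h
      linarith
    calc (t / s - 1) * srcFun p n s ≤ (t / s - 1) * (n * s) := by gcongr
      _ = n * (t - s) := by field_simp

lemma clampSrc_lipschitz {p n M : ℝ} (hp0 : 0 < p) (hp : p ≤ 1) (hn : 0 ≤ n) :
    LipschitzWith (Real.toNNReal n) (clampSrc p n M) := by
  refine LipschitzWith.of_le_add_mul' n fun a b => ?_
  unfold clampSrc
  have h2 := (clamp_lipschitz M).dist_le_mul a b
  rw [NNReal.coe_one, one_mul] at h2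
  rcases le_total (max 0 (min b M)) (max 0 (min a M)) with h | h
  · have h1 := srcFun_sub_le (n := n) hp0 hp (clamp_nonneg M b) h
    have h3 : max 0 (min a M) - max 0 (min b M) ≤ dist a b :=
      (le_abs_self _).trans h2
    have := mul_le_mul_of_nonneg_left h3 hn
    linarith
  · have h1 := srcFun_mono hp0.le hn (clamp_nonneg M a) h
    have := mul_nonneg hn (dist_nonneg (x := a) (y := b))
    linarith

lemma clampSrc_nonneg {p n M : ℝ} (hn : 0 ≤ n) (s : ℝ) : 0 ≤ clampSrc p n M s :=
  srcFun_nonneg hn (clamp_nonneg M s)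

lemma clampSrc_le {p n M : ℝ} (hp : 0 ≤ p) (hM : 0 ≤ M) (s : ℝ) : clampSrc p n M s ≤ M ^ p :=
  (srcFun_le_rpow _ _ _).trans (Real.rpow_le_rpow (clamp_nonneg M s) (clamp_le hM s) hp)

/-- Solutions `u` with values in `[0, M]` of the nonlocal approximate problem, together with
`W = u ^ m` and the source term `F`. -/
structure ApproxSol {N : ℕ} (m p M K h n T : ℝ) (f : EuclideanSpace ℝ (Fin N) → ℝ)
    (u₀ : EuclideanSpace ℝ (Fin N) → ℝ) (u W F : ℝ → (EuclideanSpace ℝ (Fin N) →ᵇ ℝ)) : Prop where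
  h_pos : 0 < h
  n_nonneg : 0 ≤ n
  f_nonneg : ∀ x, 0 ≤ f x
  f_le : ∀ x, f x ≤ K
  cont : Continuous u
  cont_W : Continuous W
  cont_F : Continuous F
  init_eq : ∀ x, u 0 x = u₀ x
  nonneg : ∀ t ∈ Icc 0 T, ∀ x, 0 ≤ u t x
  le_M : ∀ t ∈ Icc 0 T, ∀ x, u t x ≤ M
  W_eq : ∀ t ∈ Icc 0 T, ∀ x, W t x = u t x ^ m
  F_eq : ∀ t ∈ Icc 0 T, ∀ x, F t x = f x * srcFun p n (u t x)
  deriv : ∀ t ∈ Icc 0 T, HasDerivAt u (h⁻¹ • (heatOp N h (W t) - W t) + F t) t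

lemma hasDerivAt_bcf_apply {N : ℕ} {u : ℝ → (EuclideanSpace ℝ (Fin N) →ᵇ ℝ)}
    {v : EuclideanSpace ℝ (Fin N) →ᵇ ℝ} {t : ℝ} (hu : HasDerivAt u v t)
    (x : EuclideanSpace ℝ (Fin N)) : HasDerivAt (fun s => u s x) (v x) t :=
  (BoundedContinuousFunction.evalCLM ℝ x :
    (EuclideanSpace ℝ (Fin N) →ᵇ ℝ) →L[ℝ] ℝ).hasFDerivAt.comp_hasDerivAt t hu

lemma continuous_bcf_apply {N : ℕ} {u : ℝ → (EuclideanSpace ℝ (Fin N) →ᵇ ℝ)} (hu : Continuous u)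
    (x : EuclideanSpace ℝ (Fin N)) : Continuous fun s => u s x :=
  (BoundedContinuousFunction.evalCLM ℝ x :
    (EuclideanSpace ℝ (Fin N) →ᵇ ℝ) →L[ℝ] ℝ).continuous.comp hu

lemma exists_approxSol {N : ℕ} {m p M K h n T M₀ : ℝ} (hm : 1 ≤ m) (hp0 : 0 < p) (hp : p ≤ 1)
    (hM : 0 ≤ M) (hh : 0 < h) (hn : 0 ≤ n) (hT : 0 ≤ T) (f u₀ : EuclideanSpace ℝ (Fin N) →ᵇ ℝ)
    (hf0 : ∀ x, 0 ≤ f x) (hfK : ∀ x, f x ≤ K) (hu0 : ∀ x, 0 ≤ u₀ x) (hu1 : ∀ x, u₀ x ≤ M₀)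
    (hMT : M₀ + K * M ^ p * T ≤ M) :
    ∃ u W F, ApproxSol m p M K h n T f u₀ u W F := by
  have hm0 : 0 ≤ m := by linarith
  have hφ := clampPow_lipschitz hm hM
  have hg := clampSrc_lipschitz (M := M) hp0 hp hn
  have hφm := clampPow_mono (M := M) hm0
  have hK0 : 0 ≤ K := (hf0 0).trans (hfK 0)
  have hM0 : 0 ≤ M₀ := (hu0 0).trans (hu1 0)
  obtain ⟨u, hc, hi, hd⟩ := exists_approx_solution hh hφ hg (Bφ := M ^ m) (Bg := M ^ p)
    (fun s => by rw [abs_of_nonneg (clampPow_nonneg _ _ _)]; exact clampPow_le hm0 hM s)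
    (fun s => by rw [abs_of_nonneg (clampSrc_nonneg hn _)]; exact clampSrc_le hp0.le hM s)
    f u₀ hT
  have hdx : ∀ t ∈ Icc 0 T, ∀ x, HasDerivAt (fun s => u s x)
      ((heatOp N h ((u t).comp _ hφ) x - clampPow m M (u t x)) / h
        + f x * clampSrc p n M (u t x)) t := fun t ht x => by
    rw [← approxField_apply h hφ hg]
    exact hasDerivAt_bcf_apply (hd t ht) x
  obtain ⟨Q, hQ⟩ := (isCompact_Icc (a := (0:ℝ)) (b := T)).exists_bound_of_continuousOn
    hc.norm.continuousOn
  have hQ' : ∀ t ∈ Icc 0 T, ∀ x, |u t x| ≤ Q := fun t ht x => by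
    have h1 := hQ t ht
    rw [norm_norm] at h1
    exact ((u t).norm_coe_le_norm x).trans h1
  have hpow0 : clampPow m M 0 = 0 := by
    rw [clampPow_of_mem le_rfl hM, Real.zero_rpow (by linarith)]
  have hsrc0 : clampSrc p n M 0 = 0 := by
    rw [clampSrc_of_mem le_rfl hM]
    simp [srcFun, Real.zero_rpow hp0.ne']
  have hnn : ∀ t ∈ Icc 0 T, ∀ x, 0 ≤ u t x := by
    refine approx_comparison hh hφ hg hφm hf0 hfK (a := fun _ _ => 0) (b := fun x t => u t x)
      (A := fun _ => 0) (B := fun t => (u t).comp _ hφ) ?_ ?_ ?_ ?_ ?_ (Q := Q) ?_ ?_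
    · intro t _ x; exact clampPow_nonneg _ _ _
    · intro t _ x; exact le_rfl
    · intro x; exact continuousOn_const
    · intro x; exact (continuous_bcf_apply hc x).continuousOn
    · intro x; simpa [hi] using hu0 x
    · intro t ht x
      have := (abs_le.1 (hQ' t ht x)).1
      linarith
    · intro t ht x _
      refine ⟨_, _, hasDerivAt_const t 0, hdx t ⟨ht.1, ht.2.le⟩ x, ?_, le_rfl⟩
      simp [hpow0, hsrc0]
  have hle : ∀ t ∈ Icc 0 T, ∀ x, u t x ≤ M₀ + K * M ^ p * t := by
    refine approx_comparison hh hφ hg hφm hf0 hfK (a := fun x t => u t x)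
      (b := fun x t => M₀ + K * M ^ p * t)
      (A := fun t => (u t).comp _ hφ) (B := fun t => BoundedContinuousFunction.const _
        (clampPow m M (M₀ + K * M ^ p * t))) ?_ ?_ ?_ ?_ ?_ (Q := Q) ?_ ?_
    · intro t _ x; exact le_rfl
    · intro t _ x; exact le_rfl
    · intro x; exact (continuous_bcf_apply hc x).continuousOn
    · intro x; fun_prop
    · intro x; simpa [hi] using hu1 x
    · intro t ht x
      have h1 := (abs_le.1 (hQ' t ht x)).2
      have h2 : 0 ≤ M₀ + K * M ^ p * t := by have := ht.1; positivity
      linarith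
    · intro t ht x _
      refine ⟨_, _, hdx t ⟨ht.1, ht.2.le⟩ x,
        ((hasDerivAt_id t).const_mul (K * M ^ p)).const_add M₀, le_rfl, ?_⟩
      have h1 := heatOp_le_const h (w := BoundedContinuousFunction.const
        (EuclideanSpace ℝ (Fin N)) (clampPow m M (M₀ + K * M ^ p * t)))
        (C := clampPow m M (M₀ + K * M ^ p * t)) (fun y => le_rfl) x
      have h2 : f x * clampSrc p n M (M₀ + K * M ^ p * t) ≤ K * M ^ p :=
        mul_le_mul (hfK x) (clampSrc_le hp0.le hM _) (clampSrc_nonneg hn _) hK0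
      have h3 := div_nonpos_of_nonpos_of_nonneg (sub_nonpos.2 h1) hh.le
      simp only [mul_one]
      linarith
  have hleM : ∀ t ∈ Icc 0 T, ∀ x, u t x ≤ M := fun t ht x => by
    refine (hle t ht x).trans (le_trans ?_ hMT)
    have := ht.2
    gcongr
  refine ⟨u, fun t => (u t).comp _ hφ, fun t => f * (u t).comp _ hg, hh, hn, hf0, hfK, hc,
    (BoundedContinuousFunction.lipschitz_comp hφ).continuous.comp hc,
    continuous_const.mul ((BoundedContinuousFunction.lipschitz_comp hg).continuous.comp hc),
    fun x => by rw [hi], hnn, hleM, fun t ht x => clampPow_of_mem (hnn t ht x) (hleM t ht x),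
    fun t ht x => ?_, hd⟩
  show f x * clampSrc p n M (u t x) = _
  rw [clampSrc_of_mem (hnn t ht x) (hleM t ht x)]

section

variable {N : ℕ} {m p M K h n T : ℝ} {f u₀ : EuclideanSpace ℝ (Fin N) → ℝ}
  {u W F : ℝ → (EuclideanSpace ℝ (Fin N) →ᵇ ℝ)}

lemma ApproxSol.hasDerivAt_apply (H : ApproxSol m p M K h n T f u₀ u W F) {t : ℝ}
    (ht : t ∈ Icc 0 T) (x : EuclideanSpace ℝ (Fin N)) :
    HasDerivAt (fun s => u s x) ((heatOp N h (W t) x - u t x ^ m) / h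
      + f x * srcFun p n (u t x)) t := by
  have := hasDerivAt_bcf_apply (H.deriv t ht) x
  convert! this using 1
  simp [H.W_eq t ht, H.F_eq t ht, div_eq_inv_mul]

lemma ApproxSol.le_of_super (H : ApproxSol m p M K h n T f u₀ u W F) (hm : 1 ≤ m) (hp0 : 0 < p)
    (hp : p ≤ 1) (hM : 0 ≤ M) {T' : ℝ} (hT' : T' ≤ T) {v : EuclideanSpace ℝ (Fin N) → ℝ → ℝ}
    {B : ℝ → (EuclideanSpace ℝ (Fin N) →ᵇ ℝ)}
    (hv0 : ∀ t ∈ Icc 0 T', ∀ x, 0 ≤ v x t)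
    (hB : ∀ t ∈ Icc 0 T', ∀ x, clampPow m M (v x t) ≤ B t x)
    (hvc : ∀ x, ContinuousOn (v x) (Icc 0 T')) (hi : ∀ x, u₀ x ≤ v x 0)
    (hd : ∀ t ∈ Ico 0 T', ∀ x, v x t < u t x → ∃ v', HasDerivAt (v x) v' t ∧
      (heatOp N h (B t) x - v x t ^ m) / h + f x * srcFun p n (v x t) ≤ v') :
    ∀ t ∈ Icc 0 T', ∀ x, u t x ≤ v x t := by
  have hsub : Icc 0 T' ⊆ Icc 0 T := Icc_subset_Icc_right hT'
  refine approx_comparison H.h_pos (clampPow_lipschitz hm hM)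
    (clampSrc_lipschitz (M := M) hp0 hp H.n_nonneg)
    (clampPow_mono (by linarith)) H.f_nonneg H.f_le
    (a := fun x t => u t x) (b := v) (A := W) (B := B)
    ?_ hB ?_ hvc ?_ (Q := M) ?_ ?_
  · intro t ht x
    rw [H.W_eq t (hsub ht), clampPow_of_mem (H.nonneg t (hsub ht) x) (H.le_M t (hsub ht) x)]
  · intro x; exact (continuous_bcf_apply H.cont x).continuousOn
  · intro x; simpa [H.init_eq] using hi x
  · intro t ht x
    have := hv0 t ht x
    have := H.le_M t (hsub ht) x
    linarith
  · intro t ht x hlt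
    have htI : t ∈ Icc 0 T' := ⟨ht.1, ht.2.le⟩
    obtain ⟨v', h1, h2⟩ := hd t ht x hlt
    have hle := H.le_M t (hsub htI) x
    refine ⟨_, v', H.hasDerivAt_apply (hsub htI) x, h1, le_of_eq ?_, ?_⟩
    · rw [clampPow_of_mem (H.nonneg t (hsub htI) x) hle,
        clampSrc_of_mem (H.nonneg t (hsub htI) x) hle]
    · rwa [clampPow_of_mem (hv0 t htI x) (by linarith),
        clampSrc_of_mem (hv0 t htI x) (by linarith)]

lemma ApproxSol.ge_of_sub (H : ApproxSol m p M K h n T f u₀ u W F) (hm : 1 ≤ m) (hp0 : 0 < p)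
    (hp : p ≤ 1) (hM : 0 ≤ M) {v : EuclideanSpace ℝ (Fin N) → ℝ → ℝ}
    {A : ℝ → (EuclideanSpace ℝ (Fin N) →ᵇ ℝ)}
    (hvM : ∀ t ∈ Icc 0 T, ∀ x, v x t ≤ M)
    (hA : ∀ t ∈ Icc 0 T, ∀ x, A t x ≤ clampPow m M (v x t))
    (hvc : ∀ x, ContinuousOn (v x) (Icc 0 T)) (hi : ∀ x, v x 0 ≤ u₀ x)
    (hd : ∀ t ∈ Ico 0 T, ∀ x, 0 < v x t → ∃ v', HasDerivAt (v x) v' t ∧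
      v' ≤ (heatOp N h (A t) x - v x t ^ m) / h) :
    ∀ t ∈ Icc 0 T, ∀ x, v x t ≤ u t x := by
  refine approx_comparison H.h_pos (clampPow_lipschitz hm hM)
    (clampSrc_lipschitz (M := M) hp0 hp H.n_nonneg)
    (clampPow_mono (by linarith)) H.f_nonneg H.f_le
    (a := v) (b := fun x t => u t x) (A := A) (B := W)
    hA ?_ hvc ?_ ?_ (Q := M) ?_ ?_
  · intro t ht x
    rw [H.W_eq t ht, clampPow_of_mem (H.nonneg t ht x) (H.le_M t ht x)]
  · intro x; exact (continuous_bcf_apply H.cont x).continuousOn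
  · intro x; simpa [H.init_eq] using hi x
  · intro t ht x
    have := hvM t ht x
    have := H.nonneg t ht x
    linarith
  · intro t ht x hlt
    have htI : t ∈ Icc 0 T := ⟨ht.1, ht.2.le⟩
    have hu := H.nonneg t htI x
    have hpos : 0 < v x t := lt_of_le_of_lt hu hlt
    obtain ⟨v', h1, h2⟩ := hd t ht x hpos
    refine ⟨v', _, h1, H.hasDerivAt_apply htI x, ?_, le_of_eq ?_⟩
    · rw [clampPow_of_mem hpos.le (hvM t htI x)]
      have := mul_nonneg (H.f_nonneg x) (clampSrc_nonneg (p := p) (M := M) H.n_nonneg (v x t))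
      linarith
    · rw [clampPow_of_mem hu (H.le_M t htI x), clampSrc_of_mem hu (H.le_M t htI x)]

end

section

variable {N : ℕ} {m p M K h n T : ℝ} {f u₀ : EuclideanSpace ℝ (Fin N) → ℝ}
  {u W F : ℝ → (EuclideanSpace ℝ (Fin N) →ᵇ ℝ)}

lemma ApproxSol.le_mul_scaled (H : ApproxSol m p M K h n T f u₀ u W F) (hm : 1 < m) (hp0 : 0 < p)
    (hp : p ≤ 1) (hM : 0 ≤ M) (hT : 0 ≤ T) {l : ℝ} (hl : 1 ≤ l) :
    ∀ t ∈ Icc 0 (T / l ^ (m - 1)), ∀ x, u t x ≤ l * u (l ^ (m - 1) * t) x := by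
  have hl0 : 0 < l := by linarith
  have hc1 : 1 ≤ l ^ (m - 1) := Real.one_le_rpow hl (by linarith)
  have hlm : l ^ m = l * l ^ (m - 1) := by
    rw [← Real.rpow_one_add' hl0.le (by linarith)]
    congr 1
    ring
  set c := l ^ (m - 1) with hc
  have hc0 : 0 < c := by linarith
  have hmem : ∀ t ∈ Icc 0 (T / c), c * t ∈ Icc 0 T := fun t ht => by
    refine ⟨mul_nonneg hc0.le ht.1, ?_⟩
    have := (le_div_iff₀ hc0).1 ht.2
    linarith
  have hpow : ∀ t ∈ Icc 0 (T / c), ∀ x, (l * u (c * t) x) ^ m = l ^ m * W (c * t) x :=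
    fun t ht x => by
      rw [Real.mul_rpow hl0.le (H.nonneg _ (hmem t ht) x), H.W_eq _ (hmem t ht)]
  refine H.le_of_super hm.le hp0 hp hM (div_le_self hT hc1)
    (v := fun x t => l * u (c * t) x) (B := fun t => l ^ m • W (c * t)) ?_ ?_ ?_ ?_ ?_
  · intro t ht x
    exact mul_nonneg hl0.le (H.nonneg _ (hmem t ht) x)
  · intro t ht x
    have h0 : 0 ≤ l * u (c * t) x := mul_nonneg hl0.le (H.nonneg _ (hmem t ht) x)
    refine (clampPow_le_rpow (by linarith) h0).trans (le_of_eq ?_)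
    rw [hpow t ht x]
    simp
  · intro x
    have := continuous_bcf_apply H.cont x
    fun_prop
  · intro x
    rw [mul_zero, H.init_eq]
    have := H.nonneg 0 ⟨le_rfl, hT⟩ x
    rw [H.init_eq] at this
    nlinarith
  · intro t ht x _
    have htI : t ∈ Icc 0 (T / c) := ⟨ht.1, ht.2.le⟩
    have h1 := H.hasDerivAt_apply (hmem t htI) x
    have h2 : HasDerivAt (fun s => c * s) c t := by simpa using (hasDerivAt_id t).const_mul c
    refine ⟨_, (HasDerivAt.comp t h1 h2).const_mul l, ?_⟩
    have h3 : srcFun p n (l * u (c * t) x) ≤ l * srcFun p n (u (c * t) x) :=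
      srcFun_mul_le hp (H.nonneg _ (hmem t htI) x) hl
    have h4 : f x * srcFun p n (l * u (c * t) x) ≤ l * c * (f x * srcFun p n (u (c * t) x)) := by
      have h5 : l * srcFun p n (u (c * t) x) ≤ l * c * srcFun p n (u (c * t) x) := by
        have := srcFun_nonneg (p := p) H.n_nonneg (H.nonneg _ (hmem t htI) x)
        gcongr
        nlinarith
      calc _ ≤ f x * (l * c * srcFun p n (u (c * t) x)) :=
            mul_le_mul_of_nonneg_left (h3.trans h5) (H.f_nonneg x)
        _ = _ := by ring
    rw [hpow t htI x, H.W_eq _ (hmem t htI), map_smul, hlm]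
    simp only [BoundedContinuousFunction.coe_smul, smul_eq_mul]
    calc _ ≤ (l * c * (heatOp N h (W (c * t))) x - l * c * u (c * t) x ^ m) / h
        + l * c * (f x * srcFun p n (u (c * t) x)) := by gcongr
      _ = _ := by ring

lemma one_sub_le_rpow_div {a t t' : ℝ} (ha : 1 ≤ a) (ht : 0 < t) (h : t ≤ t') :
    1 - a * (t' - t) / t ≤ (t / t') ^ a := by
  have ht' : 0 < t' := ht.trans_le h
  have h1 := one_add_mul_self_le_rpow_one_add (s := t / t' - 1) (p := a)
    (by have : 0 ≤ t / t' := by positivity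
        linarith) ha
  rw [add_sub_cancel] at h1
  refine le_trans ?_ h1
  have h2 : t / t' - 1 = - ((t' - t) / t') := by field_simp; ring
  have h3 : (t' - t) / t' ≤ (t' - t) / t := div_le_div_of_nonneg_left (by linarith) ht h
  rw [h2, mul_div_assoc]
  nlinarith

lemma ApproxSol.le_rpow_mul (H : ApproxSol m p M K h n T f u₀ u W F) (hm : 1 < m) (hp0 : 0 < p)
    (hp : p ≤ 1) (hM : 0 ≤ M) {t t' : ℝ} (ht : 0 < t) (htt' : t ≤ t') (ht' : t' ≤ T)
    (x : EuclideanSpace ℝ (Fin N)) :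
    (t / t') ^ (1 / (m - 1)) * u t x ≤ u t' x := by
  have ht0' : 0 < t' := ht.trans_le htt'
  have hm1 : m - 1 ≠ 0 := by linarith
  have hl : 1 ≤ (t' / t) ^ (1 / (m - 1)) :=
    Real.one_le_rpow ((one_le_div ht).2 htt') (by have : 0 < m - 1 := by linarith
                                                  positivity)
  have hl2 : ((t' / t) ^ (1 / (m - 1))) ^ (m - 1) = t' / t := by
    rw [← Real.rpow_mul (by positivity), one_div_mul_cancel hm1, Real.rpow_one]
  have h1 := H.le_mul_scaled hm hp0 hp hM (by linarith) hl t ⟨ht.le, by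
    rw [hl2, le_div_iff₀ (by positivity), mul_div_cancel₀ _ ht.ne']; exact ht'⟩ x
  rw [hl2, div_mul_cancel₀ _ ht.ne'] at h1
  calc _ ≤ (t / t') ^ (1 / (m - 1)) * ((t' / t) ^ (1 / (m - 1)) * u t' x) := by gcongr
    _ = u t' x := by
      rw [← mul_assoc, ← Real.mul_rpow (by positivity) (by positivity)]
      have : t / t' * (t' / t) = 1 := by field_simp
      rw [this, Real.one_rpow, one_mul]

lemma one_le_div_sub_one (hm : 1 < m) : 1 ≤ m * (1 / (m - 1)) := by
  have : 0 < m - 1 := by linarith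
  rw [mul_one_div, le_div_iff₀ this]
  linarith

lemma ApproxSol.sub_le (H : ApproxSol m p M K h n T f u₀ u W F) (hm : 1 < m) (hp0 : 0 < p)
    (hp : p ≤ 1) (hM : 0 ≤ M) {t t' : ℝ} (ht : 0 < t) (htt' : t ≤ t') (ht' : t' ≤ T)
    (x : EuclideanSpace ℝ (Fin N)) :
    u t x - m * (1 / (m - 1)) * M / t * (t' - t) ≤ u t' x := by
  have ht0' : 0 < t' := ht.trans_le htt'
  have htI : t ∈ Icc 0 T := ⟨ht.le, htt'.trans ht'⟩
  have h1 := H.le_rpow_mul hm hp0 hp hM ht htt' ht' x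
  have h2 := one_sub_le_rpow_div (one_le_div_sub_one hm) ht htt'
  have hm0 : 0 < m - 1 := by linarith
  have h3 : (t / t') ^ (m * (1 / (m - 1))) ≤ (t / t') ^ (1 / (m - 1)) :=
    Real.rpow_le_rpow_of_exponent_ge (by positivity) ((div_le_one ht0').2 htt')
      (by have : 0 < 1 / (m - 1) := by positivity
          nlinarith)
  have h4 := mul_le_mul_of_nonneg_right (h2.trans h3) (H.nonneg t htI x)
  have h5 : m * (1 / (m - 1)) * (t' - t) / t * u t x ≤ m * (1 / (m - 1)) * (t' - t) / t * M := by
    have := H.le_M t htI x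
    have : 0 ≤ t' - t := by linarith
    gcongr
  have h6 : m * (1 / (m - 1)) * M / t * (t' - t) = m * (1 / (m - 1)) * (t' - t) / t * M := by ring
  rw [h6]
  linarith

lemma ApproxSol.pow_sub_le (H : ApproxSol m p M K h n T f u₀ u W F) (hm : 1 < m) (hp0 : 0 < p)
    (hp : p ≤ 1) (hM : 0 ≤ M) {t t' : ℝ} (ht : 0 < t) (htt' : t ≤ t') (ht' : t' ≤ T)
    (x : EuclideanSpace ℝ (Fin N)) :
    W t x - m * (1 / (m - 1)) * M ^ m / t * (t' - t) ≤ W t' x := by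
  have ht0' : 0 < t' := ht.trans_le htt'
  have htI : t ∈ Icc 0 T := ⟨ht.le, htt'.trans ht'⟩
  have hu := H.nonneg t htI x
  have h1 := H.le_rpow_mul hm hp0 hp hM ht htt' ht' x
  have h1' := Real.rpow_le_rpow (by positivity) h1 (by linarith : 0 ≤ m)
  rw [Real.mul_rpow (by positivity) hu, ← Real.rpow_mul (by positivity), mul_comm _ m,
    ← H.W_eq t htI, ← H.W_eq t' ⟨ht0'.le, ht'⟩] at h1'
  have h2 := one_sub_le_rpow_div (one_le_div_sub_one hm) ht htt'
  have hW : 0 ≤ W t x := by rw [H.W_eq t htI]; positivity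
  have hWM : W t x ≤ M ^ m := by
    rw [H.W_eq t htI]
    exact Real.rpow_le_rpow hu (H.le_M t htI x) (by linarith)
  have h4 := mul_le_mul_of_nonneg_right h2 hW
  have hm0 : 0 < m - 1 := by linarith
  have h5 : m * (1 / (m - 1)) * (t' - t) / t * W t x
      ≤ m * (1 / (m - 1)) * (t' - t) / t * M ^ m := by
    have : 0 ≤ t' - t := by linarith
    gcongr
  have h6 : m * (1 / (m - 1)) * M ^ m / t * (t' - t)
    = m * (1 / (m - 1)) * (t' - t) / t * M ^ m := by ring
  rw [h6]
  linarith

/-- The Bénilan–Crandall estimate, for the approximate problem. -/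
lemma ApproxSol.deriv_ge (H : ApproxSol m p M K h n T f u₀ u W F) (hm : 1 < m) (hp0 : 0 < p)
    (hp : p ≤ 1) (hM : 0 ≤ M) {t : ℝ} (ht : 0 < t) (htT : t < T)
    (x : EuclideanSpace ℝ (Fin N)) :
    -(m * (1 / (m - 1)) * M / t) ≤ (heatOp N h (W t) x - W t x) / h + F t x := by
  have htI : t ∈ Icc 0 T := ⟨ht.le, htT.le⟩
  have h1 := H.hasDerivAt_apply htI x
  rw [H.W_eq t htI x, H.F_eq t htI x]
  have h2 := (hasDerivWithinAt_iff_tendsto_slope' (s := Ioi t) (by simp)).1 h1.hasDerivWithinAt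
  refine ge_of_tendsto h2 ?_
  filter_upwards [Ioo_mem_nhdsGT htT] with s hs
  have h3 := H.sub_le hm hp0 hp hM ht hs.1.le hs.2.le x
  rw [slope_def_field, le_div_iff₀ (by linarith [hs.1])]
  linarith

end

/-- The smooth approximation `log (1 + exp (n z)) / n` of the positive part. -/
def softPlus (n z : ℝ) : ℝ := Real.log (1 + Real.exp (n * z)) / n

/-- The derivative of `softPlus n`. -/
def softStep (n z : ℝ) : ℝ := Real.exp (n * z) / (1 + Real.exp (n * z))

section SoftPlus

variable {n : ℝ}

lemma softPlus_pos (hn : 0 < n) (z : ℝ) : 0 < softPlus n z :=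
  div_pos (Real.log_pos (by have := Real.exp_pos (n * z); linarith)) hn

lemma softStep_pos (n z : ℝ) : 0 < softStep n z := by unfold softStep; positivity

lemma softStep_le_one (n z : ℝ) : softStep n z ≤ 1 := by
  unfold softStep
  rw [div_le_one (by positivity)]
  linarith

lemma hasDerivAt_softPlus (hn : 0 < n) (z : ℝ) : HasDerivAt (softPlus n) (softStep n z) z := by
  have h1 : HasDerivAt (fun z => n * z) n z := by simpa using (hasDerivAt_id z).const_mul n
  have h2 := (((h1.exp.const_add 1).log (by positivity)).div_const n)
  convert! h2 using 1
  unfold softStep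
  field_simp

lemma hasDerivAt_softStep (n z : ℝ) :
    HasDerivAt (softStep n) (n * softStep n z * (1 - softStep n z)) z := by
  have h1 : HasDerivAt (fun z => n * z) n z := by simpa using (hasDerivAt_id z).const_mul n
  have h2 := h1.exp.div (h1.exp.const_add 1) (by positivity)
  convert! h2 using 1
  unfold softStep
  field_simp

lemma le_softPlus (hn : 0 < n) (z : ℝ) : z ≤ softPlus n z := by
  unfold softPlus
  rw [le_div_iff₀ hn, Real.le_log_iff_exp_le (by positivity), mul_comm]
  linarith

lemma softPlus_le (hn : 0 < n) (z : ℝ) : softPlus n z ≤ Real.exp (n * z) / n := by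
  unfold softPlus
  gcongr
  have := Real.log_le_sub_one_of_pos (x := 1 + Real.exp (n * z)) (by positivity)
  linarith

lemma one_sub_softStep (hn : 0 < n) (z : ℝ) :
    1 - softStep n z = Real.exp (-(n * softPlus n z)) := by
  unfold softStep softPlus
  rw [mul_div_cancel₀ _ hn.ne', Real.exp_neg, Real.exp_log (by positivity)]
  field_simp
  ring

lemma softPlus_mul_deriv_softStep_le (hn : 0 < n) (z : ℝ) :
    softPlus n z * (n * softStep n z * (1 - softStep n z)) ≤ softStep n z := by
  rw [one_sub_softStep hn]
  have h1 : n * softPlus n z * Real.exp (-(n * softPlus n z)) ≤ 1 := by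
    rw [Real.exp_neg, ← div_eq_mul_inv, div_le_one (by positivity)]
    have := Real.add_one_le_exp (n * softPlus n z)
    linarith
  have h2 := mul_le_mul_of_nonneg_left h1 (softStep_pos n z).le
  linarith

lemma min_le_softStep (hn : 0 < n) (z : ℝ) : min 1 (n * softPlus n z) ≤ 2 * softStep n z := by
  have h0 := one_sub_softStep hn z
  set y := n * softPlus n z with hy
  have hy0 : 0 < y := mul_pos hn (softPlus_pos hn z)
  have h1 : Real.exp (-y) ≤ 1 / (1 + y) := by
    rw [Real.exp_neg, ← one_div]
    have := Real.add_one_le_exp y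
    exact one_div_le_one_div_of_le (by positivity) (by linarith)
  have h2 : min 1 y ≤ 2 * (1 - 1 / (1 + y)) := by
    have : 1 - 1 / (1 + y) = y / (1 + y) := by field_simp; ring
    rw [this, ← mul_div_assoc, le_div_iff₀ (by positivity)]
    rcases le_total 1 y with h | h
    · rw [min_eq_left h]; linarith
    · rw [min_eq_right h]; nlinarith
  linarith

lemma exp_mul_le_exp_abs (hn : 0 < n) (s : ℝ) :
    Real.exp (n * s) ≤ Real.exp (n * |s|) ∧ 1 ≤ Real.exp (n * |s|) :=
  ⟨Real.exp_le_exp.2 (mul_le_mul_of_nonneg_left (le_abs_self s) hn.le),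
    Real.one_le_exp (by positivity)⟩

lemma softStep_add_le (hn : 0 < n) (z s : ℝ) :
    softStep n (z + s) ≤ softStep n z * Real.exp (n * |s|) := by
  obtain ⟨h1, h2⟩ := exp_mul_le_exp_abs hn s
  have ha := Real.exp_pos (n * z)
  have hb := Real.exp_pos (n * s)
  unfold softStep
  rw [mul_add, Real.exp_add]
  set a := Real.exp (n * z)
  set b := Real.exp (n * s)
  set B := Real.exp (n * |s|)
  rw [div_mul_eq_mul_div, div_le_div_iff₀ (by positivity) (by positivity)]
  have h3 : b + a * b ≤ B + B * (a * b) := by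
    have : 0 < a * b := by positivity
    nlinarith
  nlinarith

lemma softPlus_add_le (hn : 0 < n) (z s : ℝ) :
    softPlus n (z + s) ≤ softPlus n z * Real.exp (n * |s|) := by
  obtain ⟨h1, h2⟩ := exp_mul_le_exp_abs hn s
  have ha := Real.exp_pos (n * z)
  have hb := Real.exp_pos (n * s)
  unfold softPlus
  rw [mul_add, Real.exp_add, div_mul_eq_mul_div]
  set a := Real.exp (n * z)
  set b := Real.exp (n * s)
  set B := Real.exp (n * |s|)
  gcongr
  rw [mul_comm (Real.log (1 + a)), ← Real.log_rpow (by positivity)]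
  refine Real.log_le_log (by positivity) ?_
  have h3 := one_add_mul_self_le_rpow_one_add (s := a) (p := B) (by linarith) h2
  nlinarith

lemma softPlus_rpow_add_le (hn : 0 < n) (a z s : ℝ) :
    softPlus n (z + s) ^ a ≤ softPlus n z ^ a * Real.exp (|a| * n * |s|) := by
  have h0 := softPlus_pos hn z
  have h0' := softPlus_pos hn (z + s)
  have hE : ∀ b : ℝ, Real.exp (n * |s|) ^ b = Real.exp (b * n * |s|) := fun b => by
    rw [← Real.exp_mul]; congr 1; ring
  rcases le_total 0 a with ha | ha
  · rw [abs_of_nonneg ha, ← hE, ← Real.mul_rpow h0.le (Real.exp_pos _).le]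
    exact Real.rpow_le_rpow h0'.le (softPlus_add_le hn z s) ha
  · have h1 := softPlus_add_le hn (z + s) (-s)
    rw [add_neg_cancel_right, abs_neg] at h1
    have h2 := Real.rpow_le_rpow h0.le h1 (neg_nonneg.2 ha)
    rw [Real.mul_rpow h0'.le (Real.exp_pos _).le, Real.rpow_neg h0.le, Real.rpow_neg h0'.le, hE]
      at h2
    have h3 : 0 < softPlus n z ^ a := by positivity
    have h4 : 0 < softPlus n (z + s) ^ a := by positivity
    rw [abs_of_nonpos ha]
    rw [← div_eq_inv_mul, inv_eq_one_div, div_le_div_iff₀ h3 h4] at h2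
    linarith

/-- An upper bound for the second derivative of `softPlus n ^ (1 + γ)`. -/
def softCurv (γ n z : ℝ) : ℝ := (1 + γ) ^ 2 * (softPlus n z ^ (γ - 1) * softStep n z)

lemma softCurv_nonneg (hn : 0 < n) (γ z : ℝ) : 0 ≤ softCurv γ n z := by
  have := softPlus_pos hn z
  have := softStep_pos n z
  unfold softCurv
  positivity

lemma softCurv_add_le (hn : 0 < n) (γ z s : ℝ) :
    softCurv γ n (z + s) ≤ softCurv γ n z * Real.exp ((|γ - 1| + 1) * n * |s|) := by
  have h0 := softPlus_pos hn z
  have h1 := softPlus_rpow_add_le hn (γ - 1) z s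
  have h2 := softStep_add_le hn z s
  have h3 := mul_le_mul h1 h2 (softStep_pos n _).le (by positivity)
  unfold softCurv
  have h4 : Real.exp ((|γ - 1| + 1) * n * |s|)
      = Real.exp (|γ - 1| * n * |s|) * Real.exp (n * |s|) := by
    rw [← Real.exp_add]; congr 1; ring
  rw [h4]
  calc _ ≤ (1 + γ) ^ 2 * (softPlus n z ^ (γ - 1) * Real.exp (|γ - 1| * n * |s|) *
        (softStep n z * Real.exp (n * |s|))) := by gcongr
    _ = _ := by ring

/-- The derivative of `softPlus n ^ (1 + γ)`. -/
def softSlope (γ n z : ℝ) : ℝ := (1 + γ) * (softPlus n z ^ γ * softStep n z)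

lemma hasDerivAt_softPlus_rpow (hn : 0 < n) (γ z : ℝ) :
    HasDerivAt (fun z => softPlus n z ^ γ) (γ * (softPlus n z ^ (γ - 1) * softStep n z)) z := by
  have h := (hasDerivAt_softPlus hn z).rpow_const (p := γ) (Or.inl (softPlus_pos hn z).ne')
  convert! h using 1
  ring

lemma hasDerivAt_softPlus_rpow_one_add (hn : 0 < n) (γ z : ℝ) :
    HasDerivAt (fun z => softPlus n z ^ (1 + γ)) (softSlope γ n z) z := by
  have h := hasDerivAt_softPlus_rpow hn (1 + γ) z
  rwa [add_sub_cancel_left] at h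

lemma exists_hasDerivAt_softSlope (hn : 0 < n) {γ : ℝ} (hγ : 0 ≤ γ) (z : ℝ) :
    ∃ d, HasDerivAt (softSlope γ n) d z ∧ d ≤ softCurv γ n z := by
  have h := ((hasDerivAt_softPlus_rpow hn γ z).mul (hasDerivAt_softStep n z)).const_mul (1 + γ)
  refine ⟨_, h, ?_⟩
  have h0 := softPlus_pos hn z
  have hs := softStep_pos n z
  have hP : softPlus n z ^ γ = softPlus n z ^ (γ - 1) * softPlus n z := by
    rw [← Real.rpow_add_one h0.ne', sub_add_cancel]
  have h1 := softPlus_mul_deriv_softStep_le hn z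
  have h2 := softStep_le_one n z
  have hP0 : 0 < softPlus n z ^ (γ - 1) := by positivity
  unfold softCurv
  rw [hP]
  set P := softPlus n z ^ (γ - 1)
  set S := softStep n z
  have h3 : γ * (P * S) * S ≤ γ * (P * S) * 1 := by gcongr
  have h4 : P * (softPlus n z * (n * S * (1 - S))) ≤ P * S := by gcongr
  have h5 : γ * (P * S) * S + P * softPlus n z * (n * S * (1 - S)) ≤ (1 + γ) * (P * S) := by
    linarith
  calc _ ≤ (1 + γ) * ((1 + γ) * (P * S)) := by gcongr
    _ = _ := by ring

lemma le_taylor_of_second_deriv_le {φ φ' : ℝ → ℝ} {Q : ℝ} (h1 : ∀ s, HasDerivAt φ (φ' s) s)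
    {b : ℝ} (h2 : ∀ s ∈ Icc 0 b, ∃ d, HasDerivAt φ' d s ∧ d ≤ Q) (hb : 0 ≤ b) :
    φ b ≤ φ 0 + φ' 0 * b + Q / 2 * b ^ 2 := by
  choose! d hd hdQ using h2
  have hA : ∀ s ∈ Icc 0 b, φ' s ≤ φ' 0 + Q * s := by
    refine image_le_of_deriv_right_le_deriv_boundary (f' := d) (B' := fun _ => Q) ?_ ?_ ?_ ?_ ?_ ?_
    · exact fun s hs => (hd s hs).continuousAt.continuousWithinAt
    · exact fun s hs => (hd s ⟨hs.1, hs.2.le⟩).hasDerivWithinAt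
    · simp
    · fun_prop
    · intro s _
      have : HasDerivAt (fun s => φ' 0 + Q * s) Q s := by
        simpa using ((hasDerivAt_id s).const_mul Q).const_add (φ' 0)
      exact this.hasDerivWithinAt
    · exact fun s hs => hdQ s ⟨hs.1, hs.2.le⟩
  have hB : ∀ s ∈ Icc 0 b, φ s ≤ φ 0 + φ' 0 * s + Q / 2 * s ^ 2 := by
    refine image_le_of_deriv_right_le_deriv_boundary (f' := φ') (B' := fun s => φ' 0 + Q * s)
      ?_ ?_ ?_ ?_ ?_ ?_
    · exact fun s hs => (h1 s).continuousAt.continuousWithinAt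
    · exact fun s hs => (h1 s).hasDerivWithinAt
    · simp
    · fun_prop
    · intro s _
      have : HasDerivAt (fun s => φ 0 + φ' 0 * s + Q / 2 * s ^ 2) (φ' 0 + Q * s) s := by
        have h := (((hasDerivAt_id s).const_mul (φ' 0)).const_add (φ 0)).add
          ((hasDerivAt_pow 2 s).const_mul (Q / 2))
        convert! h using 1
        simp
        ring
      exact this.hasDerivWithinAt
    · exact fun s hs => hA s ⟨hs.1, hs.2.le⟩
  exact hB b ⟨hb, le_rfl⟩

lemma softPlus_taylor (hn : 0 < n) {γ : ℝ} (hγ : 0 ≤ γ) (z s : ℝ) :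
    softPlus n (z + s) ^ (1 + γ) ≤ softPlus n z ^ (1 + γ) + softSlope γ n z * s
      + softCurv γ n z / 2 * (s ^ 2 * Real.exp ((|γ - 1| + 1) * n * |s|)) := by
  have hlin : ∀ τ : ℝ, HasDerivAt (fun τ => z + τ * s) s τ := fun τ => by
    simpa using ((hasDerivAt_id τ).mul_const s).const_add z
  have hcomp : ∀ {g : ℝ → ℝ} {g' τ : ℝ}, HasDerivAt g g' (z + τ * s) →
      HasDerivAt (fun τ => g (z + τ * s)) (g' * s) τ := fun h => HasDerivAt.comp _ h (hlin _)
  have h := le_taylor_of_second_deriv_le (φ := fun τ => softPlus n (z + τ * s) ^ (1 + γ))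
    (φ' := fun τ => softSlope γ n (z + τ * s) * s)
    (Q := softCurv γ n z * Real.exp ((|γ - 1| + 1) * n * |s|) * s ^ 2) (b := 1)
    (fun τ => hcomp (hasDerivAt_softPlus_rpow_one_add hn γ (z + τ * s)))
    (fun τ hτ => by
      obtain ⟨d, hd, hd2⟩ := exists_hasDerivAt_softSlope hn hγ (z + τ * s)
      refine ⟨d * s * s, (hcomp hd).mul_const s, ?_⟩
      have h3 := hd2.trans (softCurv_add_le hn γ z (τ * s))
      have h4 : |τ * s| ≤ |s| := by
        rw [abs_mul, abs_of_nonneg hτ.1]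
        exact mul_le_of_le_one_left (abs_nonneg s) hτ.2
      have h5 : Real.exp ((|γ - 1| + 1) * n * |τ * s|) ≤ Real.exp ((|γ - 1| + 1) * n * |s|) := by
        gcongr
      have h6 := h3.trans (mul_le_mul_of_nonneg_left h5 (softCurv_nonneg hn γ z))
      calc d * s * s = d * s ^ 2 := by ring
        _ ≤ _ := by gcongr) zero_le_one
  simp only [zero_mul, add_zero, one_mul, mul_one, one_pow] at h
  linarith

lemma srcFun_softPlus_le (hn : 0 < n) {γ p Z z : ℝ} (hq0 : 0 ≤ 1 - γ * (1 - p))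
    (hq1 : 1 - γ * (1 - p) ≤ 1) (hZ : softPlus n z ≤ Z) :
    srcFun p n (softPlus n z ^ γ) ≤ 2 * max 1 Z * (softPlus n z ^ (γ - 1) * softStep n z) := by
  have h0 := softPlus_pos hn z
  have hmin := min_le_softStep hn z
  set ψ := softPlus n z with hψ
  have hP : 0 < ψ ^ (γ - 1) := by positivity
  have h1 : (ψ ^ γ) ^ p = ψ ^ (γ - 1) * ψ ^ (1 - γ * (1 - p)) := by
    rw [← Real.rpow_mul h0.le, ← Real.rpow_add h0]
    congr 1; ring
  have h2 : n * ψ ^ γ = ψ ^ (γ - 1) * (n * ψ) := by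
    have : ψ ^ γ = ψ ^ (γ - 1) * ψ := by rw [← Real.rpow_add_one h0.ne', sub_add_cancel]
    rw [this]; ring
  have h3 : ψ ^ (1 - γ * (1 - p)) ≤ max 1 Z := by
    rcases le_total ψ 1 with h | h
    · exact (Real.rpow_le_one h0.le h hq0).trans (le_max_left _ _)
    · have := Real.rpow_le_rpow_of_exponent_le h hq1
      rw [Real.rpow_one] at this
      exact this.trans (hZ.trans (le_max_right _ _))
  have h4 : min (ψ ^ (1 - γ * (1 - p))) (n * ψ) ≤ max 1 Z * min 1 (n * ψ) := by
    have hX : 1 ≤ max 1 Z := le_max_left _ _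
    rcases le_total 1 (n * ψ) with h | h
    · rw [min_eq_left h, mul_one]
      exact (min_le_left _ _).trans h3
    · rw [min_eq_right h]
      exact (min_le_right _ _).trans (le_mul_of_one_le_left (by positivity) hX)
  unfold srcFun
  rw [h1, h2, ← mul_min_of_nonneg _ _ hP.le]
  calc _ ≤ ψ ^ (γ - 1) * (max 1 Z * (2 * softStep n z)) := by
        gcongr
        exact h4.trans (by gcongr)
    _ = _ := by ring

end SoftPlus

/-- `clampPow m M ∘ v` as a bounded continuous function. -/
def clampBcf {N : ℕ} {m M : ℝ} (hm : 0 ≤ m) (hM : 0 ≤ M) {v : EuclideanSpace ℝ (Fin N) → ℝ}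
    (hv : Continuous v) : EuclideanSpace ℝ (Fin N) →ᵇ ℝ :=
  BoundedContinuousFunction.ofNormedAddCommGroup (fun x => clampPow m M (v x))
    ((continuous_clampPow hm).comp hv) (M ^ m) fun x => by
      rw [Real.norm_of_nonneg (clampPow_nonneg _ _ _)]
      exact clampPow_le hm hM _

lemma clampBcf_apply {N : ℕ} {m M : ℝ} (hm : 0 ≤ m) (hM : 0 ≤ M)
    {v : EuclideanSpace ℝ (Fin N) → ℝ} (hv : Continuous v) (x : EuclideanSpace ℝ (Fin N)) :
    clampBcf hm hM hv x = clampPow m M (v x) := rfl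

lemma continuous_softPlus_rpow {n : ℝ} (hn : 0 < n) (γ : ℝ) :
    Continuous fun z => softPlus n z ^ γ :=
  continuous_iff_continuousAt.2 fun z => (hasDerivAt_softPlus_rpow hn γ z).continuousAt

section

variable {N : ℕ} {m p M K h n T : ℝ} {f u₀ : EuclideanSpace ℝ (Fin N) → ℝ}
  {u W F : ℝ → (EuclideanSpace ℝ (Fin N) →ᵇ ℝ)}

/-- Finite speed of propagation, for the approximate problem. -/
lemma ApproxSol.le_softPlus_rpow (H : ApproxSol m p M K h n T f u₀ u W F) (hm : 1 < m) (hp0 : 0 < p)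
    (hp : p ≤ 1) (hmp : 2 ≤ m + p) (hM : 0 ≤ M) (hn : 0 < n) {γ : ℝ} (hγ : γ = 1 / (m - 1))
    (hnh : ((|γ - 1| + 1) * n) ^ 2 * h ≤ 1) {L r : ℝ}
    (hL : (1 + γ) ^ 2 * gaussSecondMoment + K * (2 * max 1 (M ^ (m - 1))) ≤ γ * L)
    {i : Fin N} {e : ℝ} (he : e ^ 2 = 1) (hu1 : ∀ x, u₀ x ≤ M)
    (hr : ∀ x, u₀ x ≠ 0 → -r ≤ e * x i) :
    ∀ t ∈ Icc 0 T, ∀ x, u t x ≤ softPlus n (L * t + (r + M ^ (m - 1)) + e * x i) ^ γ := by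
  have hm1 : 0 < m - 1 := by linarith
  have hm0 : 0 ≤ m := by linarith
  have hγ0 : 0 < γ := by rw [hγ]; positivity
  have hγm1 : γ * (m - 1) = 1 := by rw [hγ]; field_simp
  have hγm : γ * m = 1 + γ := by linarith
  have hq0 : 0 ≤ 1 - γ * (1 - p) := by
    have : γ * (1 - p) ≤ γ * (m - 1) := mul_le_mul_of_nonneg_left (by linarith) hγ0.le
    linarith
  have hq1 : 1 - γ * (1 - p) ≤ 1 := by
    have := mul_nonneg hγ0.le (sub_nonneg.2 hp)
    linarith
  have hpos : ∀ z, 0 < softPlus n z ^ γ := fun z => Real.rpow_pos_of_pos (softPlus_pos hn z) _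
  have hpowm : ∀ z, (softPlus n z ^ γ) ^ m = softPlus n z ^ (1 + γ) := fun z => by
    rw [← Real.rpow_mul (softPlus_pos hn z).le, hγm]
  have hpowm1 : ∀ z, (softPlus n z ^ γ) ^ (m - 1) = softPlus n z := fun z => by
    rw [← Real.rpow_mul (softPlus_pos hn z).le, hγm1, Real.rpow_one]
  have hvc : ∀ t : ℝ, Continuous fun x : EuclideanSpace ℝ (Fin N) =>
      softPlus n (L * t + (r + M ^ (m - 1)) + e * x i) ^ γ := fun t =>
    (continuous_softPlus_rpow hn γ).comp (by fun_prop)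
  refine H.le_of_super hm.le hp0 hp hM le_rfl (B := fun t => clampBcf hm0 hM (hvc t))
    ?_ ?_ ?_ ?_ ?_
  · exact fun t _ x => (hpos _).le
  · exact fun t _ x => le_rfl
  · intro x
    exact ((continuous_softPlus_rpow hn γ).comp (by fun_prop)).continuousOn
  · intro x
    by_cases hx : u₀ x = 0
    · rw [hx]; exact (hpos _).le
    · have h1 := hr x hx
      have h2 : M ^ (m - 1) ≤ softPlus n (L * 0 + (r + M ^ (m - 1)) + e * x i) :=
        le_trans (by linarith) (le_softPlus hn _)
      have h3 := Real.rpow_le_rpow (by positivity) h2 hγ0.le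
      rw [← Real.rpow_mul hM, mul_comm (m - 1), hγm1, Real.rpow_one] at h3
      exact (hu1 x).trans h3
  · intro t ht x hlt
    set z := L * t + (r + M ^ (m - 1)) + e * x i with hz
    have hvM : softPlus n z ^ γ ≤ M := hlt.le.trans (H.le_M t ⟨ht.1, ht.2.le⟩ x)
    have hψM : softPlus n z ≤ M ^ (m - 1) := by
      rw [← hpowm1]
      exact Real.rpow_le_rpow (hpos _).le hvM hm1.le
    have hlin : HasDerivAt (fun t => L * t + (r + M ^ (m - 1)) + e * x i) L t := by
      simpa using ((((hasDerivAt_id t).const_mul L).add_const (r + M ^ (m - 1))).add_const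
        (e * x i))
    refine ⟨_, HasDerivAt.comp (h₂ := fun z => softPlus n z ^ γ) t
      (hasDerivAt_softPlus_rpow hn γ z) hlin, ?_⟩
    have h1 := heatOp_le_coord H.h_pos.le hnh (w := clampBcf hm0 hM (hvc t))
      (a := softPlus n z ^ (1 + γ)) (b := softSlope γ n z * e) (B := softCurv γ n z / 2)
      (by have := softCurv_nonneg hn γ z; positivity) (x := x) i (fun y => by
        rw [clampBcf_apply]
        refine (clampPow_le_rpow hm0 (hpos _).le).trans ?_
        rw [hpowm]
        have hzy : L * t + (r + M ^ (m - 1)) + e * (x + y) i = z + e * y i := by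
          rw [hz, PiLp.add_apply]; ring
        have habs : |e| = 1 := by
          rw [← sq_eq_sq₀ (abs_nonneg e) zero_le_one, sq_abs, he, one_pow]
        rw [hzy]
        refine (softPlus_taylor hn hγ0.le z (e * y i)).trans (le_of_eq ?_)
        rw [mul_pow, he, abs_mul, habs, one_mul, one_mul]
        ring)
    have h2 : ((heatOp N h (clampBcf hm0 hM (hvc t))) x - (softPlus n z ^ γ) ^ m) / h
        ≤ softCurv γ n z * gaussSecondMoment := by
      rw [div_le_iff₀ H.h_pos, hpowm]
      linarith
    have h3 := srcFun_softPlus_le hn hq0 hq1 hψM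
    have hD : 0 ≤ softPlus n z ^ (γ - 1) * softStep n z := by
      have := softPlus_pos hn z
      have := softStep_pos n z
      positivity
    have hK : 0 ≤ K := (H.f_nonneg x).trans (H.f_le x)
    have h4 : f x * srcFun p n (softPlus n z ^ γ)
        ≤ K * (2 * max 1 (M ^ (m - 1)) * (softPlus n z ^ (γ - 1) * softStep n z)) :=
      mul_le_mul (H.f_le x) h3 (srcFun_nonneg hn.le (hpos z).le) hK
    have h5 := mul_le_mul_of_nonneg_right hL hD
    unfold softCurv at h2
    linarith

lemma ApproxSol.pow_le_initial (H : ApproxSol m p M K h n T f u₀ u W F) (hm : 1 < m) (hp0 : 0 < p)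
    (hp : p ≤ 1) (hM : 0 < M) {c q l : ℝ} (hc : 0 < c) (hq : 0 ≤ q)
    (hl : m * M ^ (m - 1) * (2 * N * q + K * M ^ p) ≤ l)
    {x₀ : EuclideanSpace ℝ (Fin N)} (hi : ∀ x, u₀ x ^ m ≤ c + q * ‖x - x₀‖ ^ 2) :
    ∀ t ∈ Icc 0 T, W t x₀ ≤ c + l * t := by
  have hm0 : 0 < m := by linarith
  have hK : 0 ≤ K := (H.f_nonneg 0).trans (H.f_le 0)
  have hl0 : 0 ≤ l := le_trans (by positivity) hl
  have hpos : ∀ t ∈ Icc 0 T, ∀ x, 0 < c + q * ‖x - x₀‖ ^ 2 + l * t := fun t ht x => by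
    have := ht.1
    positivity
  have hpm : ∀ t ∈ Icc 0 T, ∀ x,
      ((c + q * ‖x - x₀‖ ^ 2 + l * t) ^ (1 / m)) ^ m = c + q * ‖x - x₀‖ ^ 2 + l * t :=
    fun t ht x => by
      rw [← Real.rpow_mul (hpos t ht x).le, one_div_mul_cancel hm0.ne', Real.rpow_one]
  have hvc : ∀ t : ℝ, Continuous fun x : EuclideanSpace ℝ (Fin N) =>
      (c + q * ‖x - x₀‖ ^ 2 + l * t) ^ (1 / m) := fun t =>
    Continuous.rpow_const (by fun_prop) fun _ => Or.inr (by positivity)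
  have key : ∀ t ∈ Icc 0 T, ∀ x, u t x ≤ (c + q * ‖x - x₀‖ ^ 2 + l * t) ^ (1 / m) := by
    refine H.le_of_super hm.le hp0 hp hM.le le_rfl (B := fun t => clampBcf hm0.le hM.le (hvc t))
      ?_ ?_ ?_ ?_ ?_
    · exact fun t ht x => Real.rpow_nonneg (hpos t ht x).le _
    · exact fun t _ x => le_rfl
    · intro x
      exact (Continuous.rpow_const (by fun_prop) fun _ => Or.inr (by positivity)).continuousOn
    · intro x
      by_cases hT : 0 ≤ T
      · have h0 : 0 ≤ u₀ x := by rw [← H.init_eq]; exact H.nonneg 0 ⟨le_rfl, hT⟩ x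
        rw [← Real.rpow_le_rpow_iff h0 (Real.rpow_nonneg (hpos 0 ⟨le_rfl, hT⟩ x).le _) hm0,
          hpm 0 ⟨le_rfl, hT⟩]
        simpa using hi x
      · have h0 := hi x
        have hp1 : 0 < c + q * ‖x - x₀‖ ^ 2 + l * 0 := by positivity
        rcases le_total 0 (u₀ x) with h1 | h1
        · rw [← Real.rpow_le_rpow_iff h1 (Real.rpow_nonneg hp1.le _) hm0,
            ← Real.rpow_mul hp1.le, one_div_mul_cancel hm0.ne', Real.rpow_one]
          simpa using h0
        · exact h1.trans (Real.rpow_nonneg hp1.le _)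
    · intro t ht x hlt
      have htI : t ∈ Icc 0 T := ⟨ht.1, ht.2.le⟩
      have hp1 := hpos t htI x
      have hp2 := hpm t htI x
      have hlin : HasDerivAt (fun t => c + q * ‖x - x₀‖ ^ 2 + l * t) l t := by
        simpa using ((hasDerivAt_id t).const_mul l).const_add (c + q * ‖x - x₀‖ ^ 2)
      refine ⟨_, hlin.rpow_const (Or.inl hp1.ne'), ?_⟩
      set G := c + q * ‖x - x₀‖ ^ 2 + l * t with hG
      have hvM : G ^ (1 / m) ≤ M := hlt.le.trans (H.le_M t htI x)
      have hv0 : 0 < G ^ (1 / m) := by positivity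
      have h1 := heatOp_le_quadratic H.h_pos.le (w := clampBcf hm0.le hM.le (hvc t))
        (b := c + l * t) (q := q) (x₀ := x₀) (fun y => by
          rw [clampBcf_apply]
          refine (clampPow_le_rpow hm0.le (Real.rpow_nonneg (hpos t htI y).le _)).trans ?_
          rw [hpm t htI]
          linarith) x
      have h2 : ((heatOp N h (clampBcf hm0.le hM.le (hvc t))) x - (G ^ (1 / m)) ^ m) / h
          ≤ 2 * N * q := by
        rw [div_le_iff₀ H.h_pos, hp2]
        linarith
      have h4 : f x * srcFun p n (G ^ (1 / m)) ≤ K * M ^ p :=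
        mul_le_mul (H.f_le x) ((srcFun_le_rpow _ _ _).trans (Real.rpow_le_rpow hv0.le hvM hp0.le))
          (srcFun_nonneg H.n_nonneg hv0.le) hK
      have h5 : m * G ^ (1 - 1 / m) ≤ m * M ^ (m - 1) := by
        have : G ^ (1 - 1 / m) = (G ^ (1 / m)) ^ (m - 1) := by
          rw [← Real.rpow_mul hp1.le]; congr 1; field_simp
        rw [this]
        gcongr
      have h6 : l * (1 / m) * G ^ (1 / m - 1) = l / (m * G ^ (1 - 1 / m)) := by
        rw [← neg_sub 1 (1 / m), Real.rpow_neg hp1.le]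
        field_simp
      rw [h6, le_div_iff₀ (by positivity)]
      refine le_trans ?_ hl
      calc _ ≤ (2 * N * q + K * M ^ p) * (m * G ^ (1 - 1 / m)) := by gcongr
        _ ≤ (2 * N * q + K * M ^ p) * (m * M ^ (m - 1)) := by gcongr
        _ = _ := by ring
  intro t ht
  rw [H.W_eq t ht]
  have h1 := Real.rpow_le_rpow (H.nonneg t ht x₀) (key t ht x₀) hm0.le
  rw [hpm t ht] at h1
  simpa using h1

lemma ApproxSol.initial_le_pow (H : ApproxSol m p M K h n T f u₀ u W F) (hm : 1 < m) (hp0 : 0 < p)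
    (hp : p ≤ 1) (hM : 0 < M) (hu0 : ∀ x, 0 ≤ u₀ x) {c q l : ℝ} (hcM : c ≤ M ^ m) (hq : 0 ≤ q)
    (hl : m * M ^ (m - 1) * (2 * N * q) ≤ l)
    {x₀ : EuclideanSpace ℝ (Fin N)} (hi : ∀ x, c - q * ‖x - x₀‖ ^ 2 ≤ u₀ x ^ m) :
    ∀ t ∈ Icc 0 T, c - l * t ≤ W t x₀ := by
  have hm0 : 0 < m := by linarith
  have hl0 : 0 ≤ l := le_trans (by positivity) hl
  have hG0 : ∀ t x, 0 ≤ max 0 (c - q * ‖x - x₀‖ ^ 2 - l * t) := fun t x => le_max_left _ _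
  have hpm : ∀ G : ℝ, 0 ≤ G → (G ^ (1 / m)) ^ m = G := fun G hG => by
    rw [← Real.rpow_mul hG, one_div_mul_cancel hm0.ne', Real.rpow_one]
  have hGM : ∀ t ∈ Icc 0 T, ∀ x, (max 0 (c - q * ‖x - x₀‖ ^ 2 - l * t)) ^ (1 / m) ≤ M :=
    fun t ht x => by
      rw [← Real.rpow_le_rpow_iff (Real.rpow_nonneg (hG0 t x) _) hM.le hm0, hpm _ (hG0 t x)]
      refine max_le (by positivity) ?_
      have h1 := mul_nonneg hl0 ht.1
      have h2 : 0 ≤ q * ‖x - x₀‖ ^ 2 := by positivity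
      linarith
  have hvc : ∀ t : ℝ, Continuous fun x : EuclideanSpace ℝ (Fin N) =>
      (max 0 (c - q * ‖x - x₀‖ ^ 2 - l * t)) ^ (1 / m) := fun t =>
    Continuous.rpow_const (by fun_prop) fun _ => Or.inr (by positivity)
  have key : ∀ t ∈ Icc 0 T, ∀ x, (max 0 (c - q * ‖x - x₀‖ ^ 2 - l * t)) ^ (1 / m) ≤ u t x := by
    refine H.ge_of_sub hm.le hp0 hp hM.le (A := fun t => clampBcf hm0.le hM.le (hvc t))
      (v := fun x t => (max 0 (c - q * ‖x - x₀‖ ^ 2 - l * t)) ^ (1 / m)) hGM ?_ ?_ ?_ ?_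
    · exact fun t _ x => le_rfl
    · intro x
      exact (Continuous.rpow_const (by fun_prop) fun _ => Or.inr (by positivity)).continuousOn
    · intro x
      show (max 0 (c - q * ‖x - x₀‖ ^ 2 - l * 0)) ^ (1 / m) ≤ u₀ x
      rw [← Real.rpow_le_rpow_iff (Real.rpow_nonneg (hG0 0 x) _) (hu0 x) hm0, hpm _ (hG0 0 x)]
      refine max_le (Real.rpow_nonneg (hu0 x) _) ?_
      simpa using hi x
    · intro t ht x hlt
      have htI : t ∈ Icc 0 T := ⟨ht.1, ht.2.le⟩
      have hGpos : 0 < c - q * ‖x - x₀‖ ^ 2 - l * t := by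
        by_contra hcon
        rw [max_eq_left (not_lt.1 hcon), Real.zero_rpow (by positivity)] at hlt
        exact lt_irrefl _ hlt
      have hlin : HasDerivAt (fun t => c - q * ‖x - x₀‖ ^ 2 - l * t) (-l) t := by
        simpa using ((hasDerivAt_id t).const_mul l).const_sub (c - q * ‖x - x₀‖ ^ 2)
      have hev : (fun t => (max 0 (c - q * ‖x - x₀‖ ^ 2 - l * t)) ^ (1 / m)) =ᶠ[nhds t]
          fun t => (c - q * ‖x - x₀‖ ^ 2 - l * t) ^ (1 / m) := by
        filter_upwards [hlin.continuousAt.eventually (lt_mem_nhds hGpos)] with s hs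
        rw [max_eq_right hs.le]
      refine ⟨_, (hlin.rpow_const (Or.inl hGpos.ne')).congr_of_eventuallyEq hev, ?_⟩
      have hMv := hGM t htI x
      rw [max_eq_right hGpos.le] at hMv ⊢
      rw [hpm _ hGpos.le]
      have h1 := heatOp_le_quadratic H.h_pos.le (w := -clampBcf hm0.le hM.le (hvc t))
        (b := -(c - l * t)) (q := q) (x₀ := x₀) (fun y => by
          rw [BoundedContinuousFunction.coe_neg, Pi.neg_apply, clampBcf_apply,
            clampPow_of_mem (Real.rpow_nonneg (hG0 t y) _) (hGM t htI y), hpm _ (hG0 t y)]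
          have := le_max_right 0 (c - q * ‖y - x₀‖ ^ 2 - l * t)
          linarith) x
      rw [map_neg, BoundedContinuousFunction.coe_neg, Pi.neg_apply] at h1
      set G := c - q * ‖x - x₀‖ ^ 2 - l * t with hG
      have h2 : -(2 * N * q) ≤ ((heatOp N h (clampBcf hm0.le hM.le (hvc t))) x - G) / h := by
        rw [le_div_iff₀ H.h_pos]
        linarith
      refine le_trans ?_ h2
      have h5 : m * G ^ (1 - 1 / m) ≤ m * M ^ (m - 1) := by
        have : G ^ (1 - 1 / m) = (G ^ (1 / m)) ^ (m - 1) := by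
          rw [← Real.rpow_mul hGpos.le]; congr 1; field_simp
        rw [this]
        gcongr
      have h6 : -l * (1 / m) * G ^ (1 / m - 1) = -(l / (m * G ^ (1 - 1 / m))) := by
        rw [← neg_sub 1 (1 / m), Real.rpow_neg hGpos.le]
        field_simp
      rw [h6, neg_le_neg_iff, le_div_iff₀ (by positivity)]
      refine le_trans ?_ hl
      calc _ ≤ (2 * N * q) * (m * M ^ (m - 1)) := by gcongr
        _ = _ := by ring
  intro t ht
  rw [H.W_eq t ht]
  have h1 := Real.rpow_le_rpow (Real.rpow_nonneg (hG0 t x₀) _) (key t ht x₀) hm0.le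
  rw [hpm _ (hG0 t x₀)] at h1
  refine le_trans ?_ h1
  simp

end

lemma intervalIntegral_le_of_le {g : ℝ → ℝ} (hg : Continuous g) {a b C : ℝ} (hab : a ≤ b)
    (h : ∀ s ∈ Icc a b, g s ≤ C) : ∫ s in a..b, g s ≤ C * (b - a) := by
  have := intervalIntegral.integral_mono_on (μ := volume) hab (hg.intervalIntegrable a b)
    (continuous_const.intervalIntegrable a b) (g := fun _ => C) h
  rwa [intervalIntegral.integral_const, smul_eq_mul, mul_comm] at this

lemma le_intervalIntegral_of_le {g : ℝ → ℝ} (hg : Continuous g) {a b C : ℝ} (hab : a ≤ b)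
    (h : ∀ s ∈ Icc a b, C ≤ g s) : C * (b - a) ≤ ∫ s in a..b, g s := by
  have := intervalIntegral.integral_mono_on (μ := volume) hab
    (continuous_const.intervalIntegrable a b) (hg.intervalIntegrable a b) (f := fun _ => C) h
  rwa [intervalIntegral.integral_const, smul_eq_mul, mul_comm] at this

section

variable {N : ℕ}

lemma bcf_integral_apply {W : ℝ → (EuclideanSpace ℝ (Fin N) →ᵇ ℝ)} (hW : Continuous W) (a b : ℝ)
    (x : EuclideanSpace ℝ (Fin N)) : (∫ s in a..b, W s) x = ∫ s in a..b, W s x :=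
  ((BoundedContinuousFunction.evalCLM ℝ x :
    (EuclideanSpace ℝ (Fin N) →ᵇ ℝ) →L[ℝ] ℝ).intervalIntegral_comp_comm
      (hW.intervalIntegrable a b)).symm

lemma heatOp_integral_apply {W : ℝ → (EuclideanSpace ℝ (Fin N) →ᵇ ℝ)} (hW : Continuous W)
    (a b S : ℝ) (x : EuclideanSpace ℝ (Fin N)) :
    heatOp N S (∫ s in a..b, W s) x = ∫ s in a..b, heatOp N S (W s) x := by
  rw [← (heatOp N S).intervalIntegral_comp_comm (hW.intervalIntegrable a b)]
  exact bcf_integral_apply ((heatOp N S).continuous.comp hW) a b x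

lemma heatOp_iterate_le {h c : ℝ} (hh : 0 ≤ h) {w : EuclideanSpace ℝ (Fin N) →ᵇ ℝ}
    (H : ∀ x, heatOp N h w x ≤ w x + c) (k : ℕ) (x : EuclideanSpace ℝ (Fin N)) :
    heatOp N (k * h) w x ≤ w x + k * c := by
  induction k generalizing x with
  | zero => simp [heatOp_zero]
  | succ k ih =>
    have h1 : heatOp N ((k + 1 : ℕ) * h) w = heatOp N h (heatOp N (k * h) w) := by
      rw [heatOp_heatOp hh (by positivity)]
      congr 2
      push_cast
      ring
    rw [h1]
    have h2 : heatOp N h (heatOp N (k * h) w - w) x ≤ k * c :=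
      heatOp_le_const h (fun y => by
        rw [BoundedContinuousFunction.coe_sub, Pi.sub_apply]; linarith [ih y]) x
    rw [map_sub, BoundedContinuousFunction.coe_sub, Pi.sub_apply] at h2
    have := H x
    push_cast
    linarith

lemma le_heatOp_iterate {h c : ℝ} (hh : 0 ≤ h) {w : EuclideanSpace ℝ (Fin N) →ᵇ ℝ}
    (H : ∀ x, w x ≤ heatOp N h w x + c) (k : ℕ) (x : EuclideanSpace ℝ (Fin N)) :
    w x ≤ heatOp N (k * h) w x + k * c := by
  have h1 := heatOp_iterate_le (w := -w) (c := c) hh (fun x => by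
    rw [map_neg, BoundedContinuousFunction.coe_neg, Pi.neg_apply, BoundedContinuousFunction.coe_neg,
      Pi.neg_apply]
    linarith [H x]) k x
  rw [map_neg, BoundedContinuousFunction.coe_neg, Pi.neg_apply, BoundedContinuousFunction.coe_neg,
    Pi.neg_apply] at h1
  linarith

end

section

variable {N : ℕ} {m p M K h n T : ℝ} {f u₀ : EuclideanSpace ℝ (Fin N) → ℝ}
  {u W F : ℝ → (EuclideanSpace ℝ (Fin N) →ᵇ ℝ)}

lemma ApproxSol.W_nonneg (H : ApproxSol m p M K h n T f u₀ u W F) {t : ℝ} (ht : t ∈ Icc 0 T)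
    (x : EuclideanSpace ℝ (Fin N)) : 0 ≤ W t x := by
  rw [H.W_eq t ht]
  exact Real.rpow_nonneg (H.nonneg t ht x) _

lemma ApproxSol.W_le (H : ApproxSol m p M K h n T f u₀ u W F) (hm : 1 < m) {t : ℝ}
    (ht : t ∈ Icc 0 T) (x : EuclideanSpace ℝ (Fin N)) : W t x ≤ M ^ m := by
  rw [H.W_eq t ht]
  exact Real.rpow_le_rpow (H.nonneg t ht x) (H.le_M t ht x) (by linarith)

lemma ApproxSol.F_nonneg (H : ApproxSol m p M K h n T f u₀ u W F) {t : ℝ} (ht : t ∈ Icc 0 T)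
    (x : EuclideanSpace ℝ (Fin N)) : 0 ≤ F t x := by
  rw [H.F_eq t ht]
  exact mul_nonneg (H.f_nonneg x) (srcFun_nonneg H.n_nonneg (H.nonneg t ht x))

lemma ApproxSol.F_le (H : ApproxSol m p M K h n T f u₀ u W F) (hp : 0 < p) {t : ℝ}
    (ht : t ∈ Icc 0 T) (x : EuclideanSpace ℝ (Fin N)) : F t x ≤ K * M ^ p := by
  rw [H.F_eq t ht]
  exact mul_le_mul (H.f_le x) ((srcFun_le_rpow _ _ _).trans
    (Real.rpow_le_rpow (H.nonneg t ht x) (H.le_M t ht x) hp.le))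
    (srcFun_nonneg H.n_nonneg (H.nonneg t ht x)) ((H.f_nonneg x).trans (H.f_le x))

lemma ApproxSol.heatOp_integral_sub (H : ApproxSol m p M K h n T f u₀ u W F) {a b : ℝ}
    (ha : 0 ≤ a) (hab : a ≤ b) (hb : b ≤ T) (x : EuclideanSpace ℝ (Fin N)) :
    heatOp N h (∫ s in a..b, W s) x - (∫ s in a..b, W s x)
      = h * (u b x - u a x - ∫ s in a..b, F s x) := by
  have hcW := continuous_bcf_apply H.cont_W x
  have hcF := continuous_bcf_apply H.cont_F x
  have hcP : Continuous fun s => heatOp N h (W s) x :=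
    continuous_bcf_apply ((heatOp N h).continuous.comp H.cont_W) x
  have hcD : Continuous fun s => (heatOp N h (W s) x - W s x) / h := (hcP.sub hcW).div_const h
  have hmem : ∀ s ∈ uIcc a b, s ∈ Icc 0 T := fun s hs => by
    rw [uIcc_of_le hab] at hs
    exact ⟨ha.trans hs.1, hs.2.trans hb⟩
  have h1 := intervalIntegral.integral_eq_sub_of_hasDerivAt
    (f := fun s => u s x) (f' := fun s => (heatOp N h (W s) x - W s x) / h + F s x)
    (a := a) (b := b) (fun s hs => by
      have := H.hasDerivAt_apply (hmem s hs) x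
      rwa [← H.W_eq s (hmem s hs), ← H.F_eq s (hmem s hs)] at this)
    ((hcD.add hcF).intervalIntegrable a b)
  rw [intervalIntegral.integral_add (hcD.intervalIntegrable a b)
    (hcF.intervalIntegrable a b), intervalIntegral.integral_div,
    intervalIntegral.integral_sub (hcP.intervalIntegrable a b) (hcW.intervalIntegrable a b)] at h1
  rw [heatOp_integral_apply H.cont_W, ← h1, add_sub_cancel_right,
    mul_div_cancel₀ _ H.h_pos.ne']

lemma ApproxSol.heatOp_integral_le (H : ApproxSol m p M K h n T f u₀ u W F) {a b : ℝ}
    (ha : 0 ≤ a) (hab : a ≤ b) (hb : b ≤ T) (k : ℕ) (x : EuclideanSpace ℝ (Fin N)) :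
    heatOp N (k * h) (∫ s in a..b, W s) x ≤ (∫ s in a..b, W s x) + k * h * M := by
  rw [← bcf_integral_apply H.cont_W, mul_assoc]
  refine heatOp_iterate_le H.h_pos.le (fun x => ?_) k x
  have h1 := H.heatOp_integral_sub ha hab hb x
  rw [bcf_integral_apply H.cont_W]
  have h2 : 0 ≤ ∫ s in a..b, F s x := intervalIntegral.integral_nonneg hab fun s hs =>
    H.F_nonneg ⟨ha.trans hs.1, hs.2.trans hb⟩ x
  have h3 := H.le_M b ⟨ha.trans hab, hb⟩ x
  have h4 := H.nonneg a ⟨ha, hab.trans hb⟩ x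
  have h5 : h * (u b x - u a x - ∫ s in a..b, F s x) ≤ h * M := by
    have := H.h_pos
    gcongr
    linarith
  linarith

lemma ApproxSol.le_heatOp_integral (H : ApproxSol m p M K h n T f u₀ u W F) (hp : 0 < p) {a b : ℝ}
    (ha : 0 ≤ a) (hab : a ≤ b) (hb : b ≤ T) (k : ℕ) (x : EuclideanSpace ℝ (Fin N)) :
    (∫ s in a..b, W s x) ≤ heatOp N (k * h) (∫ s in a..b, W s) x
      + k * h * (M + K * M ^ p * (b - a)) := by
  rw [← bcf_integral_apply H.cont_W, mul_assoc]
  refine le_heatOp_iterate H.h_pos.le (fun x => ?_) k x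
  have h1 := H.heatOp_integral_sub ha hab hb x
  rw [bcf_integral_apply H.cont_W]
  have h2 : ∫ s in a..b, F s x ≤ K * M ^ p * (b - a) :=
    intervalIntegral_le_of_le (continuous_bcf_apply H.cont_F x) hab
      fun s hs => H.F_le hp ⟨ha.trans hs.1, hs.2.trans hb⟩ x
  have h3 := H.le_M a ⟨ha, hab.trans hb⟩ x
  have h4 := H.nonneg b ⟨ha.trans hab, hb⟩ x
  have h5 : h * (-(M + K * M ^ p * (b - a))) ≤ h * (u b x - u a x - ∫ s in a..b, F s x) := by
    have := H.h_pos
    gcongr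
    linarith
  linarith

lemma ApproxSol.integral_W_nonneg (H : ApproxSol m p M K h n T f u₀ u W F) {a b : ℝ}
    (ha : 0 ≤ a) (hab : a ≤ b) (hb : b ≤ T) (x : EuclideanSpace ℝ (Fin N)) :
    0 ≤ ∫ s in a..b, W s x :=
  intervalIntegral.integral_nonneg hab fun _ hs => H.W_nonneg ⟨ha.trans hs.1, hs.2.trans hb⟩ x

lemma ApproxSol.integral_W_le (H : ApproxSol m p M K h n T f u₀ u W F) (hm : 1 < m) {a b : ℝ}
    (ha : 0 ≤ a) (hab : a ≤ b) (hb : b ≤ T) (x : EuclideanSpace ℝ (Fin N)) :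
    ∫ s in a..b, W s x ≤ M ^ m * (b - a) :=
  intervalIntegral_le_of_le (continuous_bcf_apply H.cont_W x) hab
    fun _ hs => H.W_le hm ⟨ha.trans hs.1, hs.2.trans hb⟩ x

/-- The modulus of continuity in space of the time integral of `u ^ m` is uniform, up to an error
that is small with the time step. -/
lemma ApproxSol.integral_equicontinuous (hm : 1 < m) (hp : 0 < p) (hM : 0 ≤ M) (hK : 0 ≤ K)
    (hT : 0 ≤ T) (N : ℕ) {ε : ℝ} (hε : 0 < ε) : ∃ ρ > 0, ∃ i₀ : ℕ, ∀ i ≥ i₀,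
      ∀ {n : ℝ} {f u₀ : EuclideanSpace ℝ (Fin N) → ℝ}
        {u W F : ℝ → (EuclideanSpace ℝ (Fin N) →ᵇ ℝ)},
      ApproxSol m p M K ((1 / 2 : ℝ) ^ i) n T f u₀ u W F → ∀ t ∈ Icc 0 T, ∀ x y, ‖x - y‖ < ρ →
        |(∫ s in (0:ℝ)..t, W s x) - ∫ s in (0:ℝ)..t, W s y| ≤ ε := by
  set C := M + K * M ^ p * T with hC
  have hC0 : 0 ≤ C := by positivity
  have hB : 0 ≤ M ^ m * T := by positivity
  obtain ⟨i₀, hi₀⟩ := exists_pow_lt_of_lt_one (show 0 < ε / (4 * (C + 1)) by positivity)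
    (show (1 / 2 : ℝ) < 1 by norm_num)
  obtain ⟨ρ, hρ, hρ'⟩ := heatOp_equicontinuous (N := N) (s := (1 / 2 : ℝ) ^ i₀) (by positivity)
    (ε := ε / (2 * (M ^ m * T + 1))) (by positivity)
  refine ⟨ρ, hρ, i₀, fun i hi n f u₀ u W F H t ht x y hxy => ?_⟩
  have hk : ((2 ^ (i - i₀) : ℕ) : ℝ) * (1 / 2) ^ i = (1 / 2 : ℝ) ^ i₀ := by
    obtain ⟨d, rfl⟩ := Nat.exists_eq_add_of_le hi
    rw [Nat.add_sub_cancel_left]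
    push_cast
    rw [pow_add, mul_left_comm, ← mul_pow]
    norm_num
  have hlo := fun x => H.le_heatOp_integral hp le_rfl ht.1 ht.2 (2 ^ (i - i₀)) x
  have hup := fun x => H.heatOp_integral_le le_rfl ht.1 ht.2 (2 ^ (i - i₀)) x
  rw [hk] at hlo hup
  have hnorm : ‖∫ s in (0:ℝ)..t, W s‖ ≤ M ^ m * T := by
    refine (BoundedContinuousFunction.norm_le hB).2 fun x => ?_
    rw [bcf_integral_apply H.cont_W,
      Real.norm_of_nonneg (H.integral_W_nonneg le_rfl ht.1 ht.2 x)]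
    refine (H.integral_W_le hm le_rfl ht.1 ht.2 x).trans ?_
    have := ht.2
    gcongr
    linarith
  have h1 : |heatOp N ((1 / 2 : ℝ) ^ i₀) (∫ s in (0:ℝ)..t, W s) x
      - heatOp N ((1 / 2 : ℝ) ^ i₀) (∫ s in (0:ℝ)..t, W s) y| ≤ ε / 2 := by
    refine (hρ' _ x y hxy).trans ?_
    rw [div_mul_eq_mul_div, div_le_div_iff₀ (by positivity) (by positivity)]
    nlinarith
  have hS : (1 / 2 : ℝ) ^ i₀ * C ≤ ε / 4 := by
    rw [lt_div_iff₀ (by positivity)] at hi₀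
    have : 0 < (1 / 2 : ℝ) ^ i₀ := by positivity
    nlinarith
  have hS1 : (1 / 2 : ℝ) ^ i₀ * M ≤ ε / 4 := by
    refine le_trans ?_ hS
    have : 0 ≤ K * M ^ p * T := by positivity
    gcongr
    linarith
  have hS2 : (1 / 2 : ℝ) ^ i₀ * (M + K * M ^ p * (t - 0)) ≤ ε / 4 := by
    refine le_trans ?_ hS
    have := ht.2
    rw [hC]
    gcongr
    linarith
  have a1 := hlo x
  have a2 := hlo y
  have a3 := hup x
  have a4 := hup y
  have h2 := abs_le.1 h1
  rw [abs_le]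
  constructor <;> linarith

end

lemma exists_tendsto_of_forall_approx {x : ℕ → ℝ}
    (h : ∀ ε > 0, ∃ (y : ℕ → ℝ) (l : ℝ), Tendsto y atTop (nhds l) ∧
      ∀ᶠ j in atTop, |x j - y j| ≤ ε) : ∃ l, Tendsto x atTop (nhds l) := by
  refine cauchySeq_tendsto_of_complete (Metric.cauchySeq_iff'.2 fun ε hε => ?_)
  obtain ⟨y, l, hy, hxy⟩ := h (ε / 5) (by positivity)
  obtain ⟨J, hJ⟩ := eventually_atTop.1
    (hxy.and (hy.eventually (Metric.ball_mem_nhds l (show 0 < ε / 5 by positivity))))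
  refine ⟨J, fun k hk => ?_⟩
  have h1 := abs_le.1 (hJ k hk).1
  have h2 := abs_le.1 (hJ J le_rfl).1
  have h3 := abs_lt.1 (hJ k hk).2
  have h4 := abs_lt.1 (hJ J le_rfl).2
  rw [Real.dist_eq, abs_lt]
  constructor <;> linarith

lemma exists_subseq_tendsto_of_equicontinuous {α : Type*} [TopologicalSpace α]
    [TopologicalSpace.SeparableSpace α] [Nonempty α] (g : ℕ → α → ℝ) {B : ℝ}
    (hB : ∀ j a, |g j a| ≤ B)
    (heq : ∀ a, ∀ ε > 0, ∀ᶠ b in nhds a, ∀ᶠ j in atTop, |g j b - g j a| ≤ ε) :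
    ∃ φ : ℕ → ℕ, StrictMono φ ∧ ∃ G : α → ℝ, ∀ a, Tendsto (fun j => g (φ j) a) atTop
      (nhds (G a)) := by
  have hc : IsCompact (univ.pi fun _ : ℕ => Icc (-B) B) := isCompact_univ_pi fun _ => isCompact_Icc
  obtain ⟨G₀, _, φ, hφ, hlim⟩ := hc.tendsto_subseq
    (x := fun j k => g j (TopologicalSpace.denseSeq α k))
    (fun j => fun k _ => abs_le.1 (hB j _))
  rw [tendsto_pi_nhds] at hlim
  have hcau : ∀ a, ∃ l, Tendsto (fun j => g (φ j) a) atTop (nhds l) := by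
    intro a
    refine exists_tendsto_of_forall_approx fun ε hε => ?_
    obtain ⟨k, hk⟩ := (TopologicalSpace.denseRange_denseSeq α).exists_mem_open
      (isOpen_interior (s := {b | ∀ᶠ j in atTop, |g j b - g j a| ≤ ε}))
      ⟨a, mem_interior_iff_mem_nhds.2 (heq a ε hε)⟩
    have hk' : ∀ᶠ j in atTop, |g j (TopologicalSpace.denseSeq α k) - g j a| ≤ ε :=
      interior_subset (s := {b | ∀ᶠ j in atTop, |g j b - g j a| ≤ ε}) hk
    refine ⟨_, _, hlim k, (hφ.tendsto_atTop.eventually hk').mono fun j hj => ?_⟩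
    rw [abs_sub_comm]
    exact hj
  choose G hG using hcau
  exact ⟨φ, hφ, G, hG⟩

lemma pow_sub_pow_comparison {m a v : ℝ} (hm : 1 < m) (ha : 0 < a) (hv : 0 ≤ v) (hva : v ≤ a) :
    a ^ (m - 1) * (a - v) ≤ a ^ m - v ^ m ∧ a ^ m - v ^ m ≤ m * a ^ (m - 1) * (a - v) := by
  have h1 : a ^ m = a ^ (m - 1) * a := by
    rw [← Real.rpow_add_one ha.ne', sub_add_cancel]
  constructor
  · have h2 : v ^ m = v ^ (m - 1) * v := by
      rw [← Real.rpow_add_one' hv (by linarith), sub_add_cancel]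
    have h3 : v ^ (m - 1) ≤ a ^ (m - 1) := Real.rpow_le_rpow hv hva (by linarith)
    have h4 := mul_le_mul_of_nonneg_right h3 hv
    rw [h1, h2]
    linarith
  · have h2 := one_add_mul_self_le_rpow_one_add (s := v / a - 1) (p := m)
      (by have : 0 ≤ v / a := by positivity
          linarith) hm.le
    rw [add_sub_cancel, Real.div_rpow hv ha.le, le_div_iff₀ (by positivity)] at h2
    have h3 : (1 + m * (v / a - 1)) * a ^ m = a ^ m - m * a ^ (m - 1) * (a - v) := by
      rw [h1]
      field_simp
      ring
    linarith

lemma gap_comparison {m M a r ρ κ κ' q v : ℝ} (hm : 1 < m) (ha : 0 < a) (hκ3 : 3 ≤ κ)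
    (hκ : m * a ^ (m - 1) ≤ κ) (hκ3' : 3 ≤ κ') (hκ' : 1 ≤ κ' * a ^ (m - 1)) (hρ : 0 ≤ ρ)
    (hq : 0 ≤ q) (hq1 : 2 * (a + M) ≤ q * ρ ^ 2) (hq2 : 2 * (a ^ m + M ^ m) ≤ q * ρ ^ 2)
    (hv : 0 ≤ v) (hvM : v ≤ M) (hva : r < ρ → v ≤ a) :
    0 ≤ a - v + q * r ^ 2 ∧ a ^ m - v ^ m + q * r ^ 2 ≤ κ * (a - v + q * r ^ 2) ∧
      a - v + q * r ^ 2 ≤ κ' * (a ^ m - v ^ m + q * r ^ 2) := by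
  have hQ : 0 ≤ q * r ^ 2 := by positivity
  rcases lt_or_ge r ρ with hr | hr
  · obtain ⟨h1, h2⟩ := pow_sub_pow_comparison hm ha hv (hva hr)
    have hd : 0 ≤ a - v := sub_nonneg.2 (hva hr)
    refine ⟨by positivity, ?_, ?_⟩
    · have h3 := mul_le_mul_of_nonneg_right hκ hd
      nlinarith
    · have h3 := mul_le_mul_of_nonneg_right hκ' hd
      have h4 := mul_le_mul_of_nonneg_left h1 (by linarith : 0 ≤ κ')
      nlinarith
  · have h1 : q * ρ ^ 2 ≤ q * r ^ 2 := by gcongr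
    have h2 : v ^ m ≤ M ^ m := Real.rpow_le_rpow hv hvM (by linarith)
    have h3 : 0 ≤ v ^ m := by positivity
    have h4 : 0 < a ^ m := by positivity
    have hM : 0 ≤ M := hv.trans hvM
    set Q := q * r ^ 2
    refine ⟨by linarith, ?_, ?_⟩
    · calc _ ≤ 3 * (a - v + Q) := by linarith
        _ ≤ _ := by
          have : 0 ≤ a - v + Q := by linarith
          gcongr
    · calc _ ≤ 3 * (a ^ m - v ^ m + Q) := by linarith
        _ ≤ _ := by
          have : 0 ≤ a ^ m - v ^ m + Q := by linarith
          gcongr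

lemma heatOp_const {N : ℕ} (s c : ℝ) :
    heatOp N s (BoundedContinuousFunction.const _ c) = BoundedContinuousFunction.const _ c := by
  ext x
  simp [heatOp_apply]

lemma le_exp_mul_of_deriv_ge {Y Y' : ℝ → ℝ} {a b k c : ℝ} (hab : a ≤ b) (hk : 0 ≤ k) (hc : 0 ≤ c)
    (hY : ∀ s ∈ Icc a b, HasDerivAt Y (Y' s) s) (hY' : ∀ s ∈ Icc a b, -(k * Y s) - c ≤ Y' s) :
    Y a ≤ Real.exp (k * (b - a)) * (Y b + c * (b - a)) := by
  have hG : ∀ s ∈ Icc a b, HasDerivAt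
      (fun s => Real.exp (k * (s - a)) * Y s + c * Real.exp (k * (b - a)) * s)
      (Real.exp (k * (s - a)) * (k * Y s + Y' s) + c * Real.exp (k * (b - a))) s := fun s hs => by
    have h1 : HasDerivAt (fun s => k * (s - a)) k s := by
      simpa using ((hasDerivAt_id s).sub_const a).const_mul k
    have h2 := (h1.exp.mul (hY s hs)).add ((hasDerivAt_id s).const_mul (c * Real.exp (k * (b - a))))
    convert! h2 using 1
    ring
  have hmono : MonotoneOn
      (fun s => Real.exp (k * (s - a)) * Y s + c * Real.exp (k * (b - a)) * s) (Icc a b) := by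
    refine monotoneOn_of_hasDerivWithinAt_nonneg (convex_Icc a b)
      (fun s hs => (hG s hs).continuousAt.continuousWithinAt)
      (fun s hs => (hG s (interior_subset hs)).hasDerivWithinAt) fun s hs => ?_
    have hs' := interior_subset hs
    have h1 := hY' s hs'
    have h2 : Real.exp (k * (s - a)) ≤ Real.exp (k * (b - a)) :=
      Real.exp_le_exp.2 (by have := hs'.2; gcongr)
    have h3 := mul_le_mul_of_nonneg_right h2 hc
    have h4 := mul_le_mul_of_nonneg_left (by linarith : -c ≤ k * Y s + Y' s)
      (Real.exp_pos (k * (s - a))).le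
    linarith
  have h := hmono ⟨le_rfl, hab⟩ ⟨hab, le_rfl⟩ hab
  simp only [sub_self, mul_zero, Real.exp_zero, one_mul] at h
  linarith

section

variable {N : ℕ} {m p M K h n T : ℝ} {f u₀ : EuclideanSpace ℝ (Fin N) → ℝ}
  {u W F : ℝ → (EuclideanSpace ℝ (Fin N) →ᵇ ℝ)}

/-- If `u` stays below `a` near `x₀` and almost reaches this value at time `t₁`, then it is close
to it in time average over a window before `t₁`. -/
lemma ApproxSol.integral_W_ge (H : ApproxSol m p M K h n T f u₀ u W F) (hm : 1 < m) (hp0 : 0 < p)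
    (hp : p ≤ 1) (hM : 0 ≤ M) (hK : 0 ≤ K) {a κ κ' q ρ L θ b t₁ C : ℝ} {k : ℕ}
    {x₀ : EuclideanSpace ℝ (Fin N)} (ha : 0 < a) (hκ3 : 3 ≤ κ)
    (hκ : m * a ^ (m - 1) ≤ κ) (hκ3' : 3 ≤ κ') (hκ' : 1 ≤ κ' * a ^ (m - 1)) (hρ : 0 ≤ ρ)
    (hq : 0 ≤ q) (hq1 : 2 * (a + M) ≤ q * ρ ^ 2) (hq2 : 2 * (a ^ m + M ^ m) ≤ q * ρ ^ 2)
    (hk : 0 < k) (hL : 0 ≤ L) (hb : 0 ≤ b) (hbt : t₁ - b = L * (k * h)) (ht₁ : 0 < t₁)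
    (htT : t₁ < T) (hC : m * (1 / (m - 1)) * M / t₁ ≤ C)
    (hloc : ∀ s ∈ Icc b t₁, ∀ x, ‖x - x₀‖ < ρ → u s x ≤ a) (hθ : a ^ m - θ ≤ W t₁ x₀) :
    L * (k * h) * (a ^ m - κ * (Real.exp (N * κ / 2 * L) * (κ' * (θ + (C + K * M ^ p) * (k * h)
      + q * (2 * N * (k * h))) + (2 * N * q + K * M ^ p) * (L * (k * h))))) - k * h * M
      ≤ ∫ s in b..t₁, W s x₀ := by
  have hh := H.h_pos
  set S : ℝ := k * h with hS
  have hS0 : 0 < S := by positivity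
  have hbt1 : b ≤ t₁ := by
    have : 0 ≤ L * S := by positivity
    linarith
  have hmem : ∀ s ∈ Icc b t₁, s ∈ Icc 0 T := fun s hs => ⟨hb.trans hs.1, hs.2.trans htT.le⟩
  set A := a ^ m with hA
  have hm1 : 0 < m - 1 := by linarith
  have hC0 : 0 ≤ C := le_trans (by positivity) hC
  set d : ℝ → (EuclideanSpace ℝ (Fin N) →ᵇ ℝ) := fun s =>
    BoundedContinuousFunction.const _ a - u s with hd
  set z : ℝ → (EuclideanSpace ℝ (Fin N) →ᵇ ℝ) := fun s =>
    BoundedContinuousFunction.const _ A - W s with hz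
  have hgap : ∀ s ∈ Icc b t₁, ∀ x, 0 ≤ d s x + q * ‖x - x₀‖ ^ 2 ∧
      z s x + q * ‖x - x₀‖ ^ 2 ≤ κ * (d s x + q * ‖x - x₀‖ ^ 2) ∧
      d s x + q * ‖x - x₀‖ ^ 2 ≤ κ' * (z s x + q * ‖x - x₀‖ ^ 2) := fun s hs x => by
    have hdx : d s x = a - u s x := rfl
    have hzx : z s x = a ^ m - u s x ^ m := by rw [← H.W_eq s (hmem s hs)]; rfl
    rw [hdx, hzx]
    exact gap_comparison hm ha hκ3 hκ hκ3' hκ' hρ hq hq1 hq2 (H.nonneg s (hmem s hs) x)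
      (H.le_M s (hmem s hs) x) (hloc s hs x)
  set Y : ℝ → ℝ := fun s => heatOp N S (d s) x₀ + q * (2 * N * S) with hY
  set Z : ℝ → ℝ := fun s => heatOp N S (z s) x₀ + q * (2 * N * S) with hZ
  have hY0 : ∀ s ∈ Icc b t₁, 0 ≤ Y s := fun s hs => by
    have h1 := heatOp_le_quadratic hS0.le (w := -d s) (b := 0) (q := q) (x₀ := x₀) (fun y => by
      have := (hgap s hs y).1
      rw [BoundedContinuousFunction.coe_neg, Pi.neg_apply]
      linarith) x₀
    rw [map_neg, BoundedContinuousFunction.coe_neg, Pi.neg_apply, sub_self, norm_zero] at h1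
    simp only [hY]
    linarith
  have hZY : ∀ s ∈ Icc b t₁, Z s ≤ κ * Y s := fun s hs => by
    have h1 := heatOp_le_quadratic hS0.le (w := z s - κ • d s) (b := 0) (q := (κ - 1) * q)
      (x₀ := x₀) (fun y => by
        have := (hgap s hs y).2.1
        show z s y - κ * d s y ≤ _
        linarith) x₀
    rw [map_sub, map_smul, sub_self, norm_zero] at h1
    have h2 : heatOp N S (z s) x₀ - κ * heatOp N S (d s) x₀
      ≤ 0 + (κ - 1) * q * 0 ^ 2 + (κ - 1) * q * (2 * N * S) := h1
    simp only [hY, hZ]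
    linarith
  have hYZ : ∀ s ∈ Icc b t₁, Y s ≤ κ' * Z s := fun s hs => by
    have h1 := heatOp_le_quadratic hS0.le (w := d s - κ' • z s) (b := 0) (q := (κ' - 1) * q)
      (x₀ := x₀) (fun y => by
        have := (hgap s hs y).2.2
        show d s y - κ' * z s y ≤ _
        linarith) x₀
    rw [map_sub, map_smul, sub_self, norm_zero] at h1
    have h2 : heatOp N S (d s) x₀ - κ' * heatOp N S (z s) x₀
      ≤ 0 + (κ' - 1) * q * 0 ^ 2 + (κ' - 1) * q * (2 * N * S) := h1
    simp only [hY, hZ]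
    linarith
  have hPz : ∀ r s, heatOp N r (z s) x₀ = A - heatOp N r (W s) x₀ := fun r s => by
    simp only [hz]
    rw [map_sub, heatOp_const]
    rfl
  have hZ1 : Z t₁ ≤ θ + (C + K * M ^ p) * S + q * (2 * N * S) := by
    have h1 := le_heatOp_iterate hh.le (w := W t₁) (c := (C + K * M ^ p) * h) (fun x => by
      have h2 := H.deriv_ge hm hp0 hp hM ht₁ htT x
      have h3 := H.F_le hp0 ⟨ht₁.le, htT.le⟩ x
      have h4 : -(C + K * M ^ p) ≤ (heatOp N h (W t₁) x - W t₁ x) / h := by linarith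
      rw [le_div_iff₀ hh] at h4
      linarith) k x₀
    simp only [hZ, hPz]
    have h5 : (k : ℝ) * ((C + K * M ^ p) * h) = (C + K * M ^ p) * S := by rw [hS]; ring
    rw [h5, ← hS] at h1
    linarith
  set c := 2 * N * q + K * M ^ p with hc
  have hc0 : 0 ≤ c := by positivity
  set Ymax := Real.exp (N * κ / 2 * L) * (κ' * (θ + (C + K * M ^ p) * S + q * (2 * N * S))
    + c * (L * S)) with hYmax
  have hYbound : ∀ s ∈ Icc b t₁, Y s ≤ Ymax := fun s hs => by
    have hsub : ∀ τ ∈ Icc s t₁, τ ∈ Icc b t₁ := fun τ hτ => ⟨hs.1.trans hτ.1, hτ.2⟩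
    have h1 := le_exp_mul_of_deriv_ge (Y := Y)
      (Y' := fun τ => (heatOp N (S + h) (z τ) x₀ - heatOp N S (z τ) x₀) / h - heatOp N S (F τ) x₀)
      (a := s) (b := t₁) (k := N * κ / (2 * S)) (c := c) hs.2 (by positivity) hc0
      (fun τ hτ => by
        have h2 := H.deriv τ (hmem τ (hsub τ hτ))
        have h3 := h2.const_sub (BoundedContinuousFunction.const _ a)
        have h4 := (heatOp N S).hasFDerivAt.comp_hasDerivAt τ h3
        have h5 := (hasDerivAt_bcf_apply h4 x₀).add_const (q * (2 * N * S))
        have h6 : heatOp N S (-(h⁻¹ • (heatOp N h (W τ) - W τ) + F τ)) x₀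
            = -(h⁻¹ * (heatOp N (S + h) (W τ) x₀ - heatOp N S (W τ) x₀) + heatOp N S (F τ) x₀) := by
          rw [map_neg, map_add, map_smul, map_sub, heatOp_heatOp hS0.le hh.le]
          rfl
        convert! h5 using 1
        rw [h6]
        simp only [hPz]
        ring)
      (fun τ hτ => by
        have hτ' := hsub τ hτ
        have h2 := heatOp_add_ge (N := N) hS0 hh.le (z := z τ) (x₀ := x₀) (q := q) (fun x => by
          obtain ⟨g1, -, g3⟩ := hgap τ hτ' x
          have : 0 ≤ κ' * (z τ x + q * ‖x - x₀‖ ^ 2) := g1.trans g3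
          exact nonneg_of_mul_nonneg_right this (by linarith))
        have h3 : heatOp N S (F τ) x₀ ≤ K * M ^ p :=
          heatOp_le_const S (H.F_le hp0 (hmem τ hτ')) x₀
        have h4 := hZY τ hτ'
        have h5 : -(N / (2 * S) * Z τ) - 2 * N * q
            ≤ (heatOp N (S + h) (z τ) x₀ - heatOp N S (z τ) x₀) / h := by
          rw [le_div_iff₀ hh]
          have h6 : N * h / (2 * S) * (heatOp N S (z τ) x₀ + q * (2 * N * S))
            = N / (2 * S) * Z τ * h := by simp only [hZ]; ring
          linarith
        have h7 : N / (2 * S) * Z τ ≤ N / (2 * S) * (κ * Y τ) := by gcongr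
        have h8 : N * κ / (2 * S) * Y τ = N / (2 * S) * (κ * Y τ) := by ring
        rw [h8, hc]
        linarith)
    refine h1.trans ?_
    have h2 : N * κ / (2 * S) * (t₁ - s) ≤ N * κ / 2 * L := by
      calc _ ≤ N * κ / (2 * S) * (L * S) := by
            have := hs.1
            gcongr
            linarith
        _ = _ := by field_simp
    have ht1 : t₁ ∈ Icc b t₁ := ⟨hbt1, le_rfl⟩
    have h3 : Y t₁ ≤ κ' * (θ + (C + K * M ^ p) * S + q * (2 * N * S)) :=
      (hYZ t₁ ht1).trans (mul_le_mul_of_nonneg_left hZ1 (by linarith))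
    have h4 : c * (t₁ - s) ≤ c * (L * S) := by
      have := hs.1
      gcongr
      linarith
    have h5 : 0 ≤ Y t₁ + c * (t₁ - s) :=
      add_nonneg (hY0 t₁ ht1) (mul_nonneg hc0 (sub_nonneg.2 hs.2))
    rw [hYmax]
    gcongr
  have hfin := H.heatOp_integral_le hb hbt1 htT.le k x₀
  rw [heatOp_integral_apply H.cont_W, ← hS] at hfin
  have hge := le_intervalIntegral_of_le (g := fun s => heatOp N S (W s) x₀) (C := A - κ * Ymax)
    (continuous_bcf_apply ((heatOp N S).continuous.comp H.cont_W) x₀) hbt1 (fun s hs => by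
      have h1 := hZY s hs
      have h2 := mul_le_mul_of_nonneg_left (hYbound s hs) (by linarith : 0 ≤ κ)
      have h3 : 0 ≤ q * (2 * N * S) := by positivity
      have h4 : A - heatOp N S (W s) x₀ + q * (2 * N * S) = Z s := by simp only [hZ, hPz]
      linarith)
  rw [hbt] at hge
  linarith

end

section

variable {N : ℕ} {m p M K h n T : ℝ} {f u₀ : EuclideanSpace ℝ (Fin N) → ℝ}
  {u W F : ℝ → (EuclideanSpace ℝ (Fin N) →ᵇ ℝ)}

lemma ApproxSol.pow_sub_le_of_le (H : ApproxSol m p M K h n T f u₀ u W F) (hm : 1 < m)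
    (hp0 : 0 < p) (hp : p ≤ 1) (hM : 0 ≤ M) {a₀ t t' : ℝ} (ha₀ : 0 < a₀) (hat : a₀ ≤ t)
    (htt' : t ≤ t') (ht' : t' ≤ T) (x : EuclideanSpace ℝ (Fin N)) :
    W t x - m * (1 / (m - 1)) * M ^ m / a₀ * (t' - t) ≤ W t' x := by
  refine le_trans ?_ (H.pow_sub_le hm hp0 hp hM (ha₀.trans_le hat) htt' ht' x)
  have hm1 : 0 < m - 1 := by linarith
  have h1 : m * (1 / (m - 1)) * M ^ m / t ≤ m * (1 / (m - 1)) * M ^ m / a₀ := by gcongr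
  have := mul_le_mul_of_nonneg_right h1 (sub_nonneg.2 htt')
  linarith

end

section

variable {N : ℕ} {m p M K T : ℝ} {f u₀ : EuclideanSpace ℝ (Fin N) → ℝ} {e : ℕ → ℕ} {n : ℕ → ℝ}
  {u W F : ℕ → ℝ → (EuclideanSpace ℝ (Fin N) →ᵇ ℝ)} {U : ℝ → EuclideanSpace ℝ (Fin N) → ℝ}

lemma tendsto_integral_sub
    (hH : ∀ j, ApproxSol m p M K ((1 / 2) ^ e j) (n j) T f u₀ (u j) (W j) (F j))
    (hU : ∀ t ∈ Icc 0 T, ∀ x, Tendsto (fun j => ∫ s in 0..t, W j s x) atTop (nhds (U t x)))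
    {a b : ℝ} (ha : a ∈ Icc 0 T) (hb : b ∈ Icc 0 T) (x : EuclideanSpace ℝ (Fin N)) :
    Tendsto (fun j => ∫ s in a..b, W j s x) atTop (nhds (U b x - U a x)) := by
  refine ((hU b hb x).sub (hU a ha x)).congr fun j => ?_
  have hc := continuous_bcf_apply (hH j).cont_W x
  exact intervalIntegral.integral_interval_sub_left (hc.intervalIntegrable _ _)
    (hc.intervalIntegrable _ _)

/-- A bound on the forward time average of the limit at one point bounds the approximate solutions
in a neighbourhood. -/
lemma eventually_W_le_near
    (hH : ∀ j, ApproxSol m p M K ((1 / 2) ^ e j) (n j) T f u₀ (u j) (W j) (F j))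
    (he : Tendsto e atTop atTop)
    (hU : ∀ t ∈ Icc 0 T, ∀ x, Tendsto (fun j => ∫ s in 0..t, W j s x) atTop (nhds (U t x)))
    (hm : 1 < m) (hp0 : 0 < p) (hp : p ≤ 1) (hM : 0 < M) (hK : 0 ≤ K) {t₀ C A η ε : ℝ}
    (ht₀ : 0 < t₀) (hε : 0 < ε) (hεT : t₀ + ε ≤ T)
    (hC : C = m * (1 / (m - 1)) * M ^ m / (t₀ / 2)) (hA : 0 ≤ A) (hη : 0 < η)
    (x₀ : EuclideanSpace ℝ (Fin N)) (hAε : U (t₀ + ε) x₀ - U t₀ x₀ + C * ε * ε < (A + η) * ε) :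
    ∃ ρ > 0, ∃ Λ > 0, Λ < ε ∧ Λ ≤ t₀ / 2 ∧ ∀ᶠ j in atTop, ∀ s ∈ Icc (t₀ - Λ) (t₀ + Λ), ∀ x,
      ‖x - x₀‖ < ρ → W j s x ≤ A + 2 * η := by
  have hm1 : 0 < m - 1 := by linarith
  have hC0 : 0 ≤ C := by rw [hC]; positivity
  have hT : 0 < T := by linarith
  obtain ⟨ρ, hρ, i₀, hi₀⟩ := ApproxSol.integral_equicontinuous (p := p) hm hp0 hM.le hK hT.le N
    (by positivity : 0 < η * ε / 6)
  have hΛ0 : 0 < η * ε / (2 * (A + 2 * η)) := by positivity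
  refine ⟨ρ, hρ, min (η * ε / (2 * (A + 2 * η))) (t₀ / 2), by positivity, ?_, min_le_right _ _, ?_⟩
  · refine (min_le_left _ _).trans_lt ?_
    rw [div_lt_iff₀ (by positivity)]
    nlinarith [mul_nonneg hA hε.le, mul_pos hη hε]
  set Λ := min (η * ε / (2 * (A + 2 * η))) (t₀ / 2) with hΛ
  have hΛ1 : (A + 2 * η) * Λ ≤ η * ε / 2 := by
    have := min_le_left (η * ε / (2 * (A + 2 * η))) (t₀ / 2)
    rw [← hΛ, le_div_iff₀ (by positivity)] at this
    linarith
  have hΛ2 : Λ ≤ t₀ / 2 := min_le_right _ _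
  have hΛp : 0 < Λ := by positivity
  have hΛε : Λ < ε := by nlinarith [mul_nonneg hA hΛp.le, mul_pos hη hε]
  have ht₀m : t₀ ∈ Icc 0 T := ⟨ht₀.le, by linarith⟩
  have ht₁m : t₀ + ε ∈ Icc 0 T := ⟨by linarith, hεT⟩
  have hev := (tendsto_integral_sub hH hU ht₀m ht₁m x₀).eventually_lt_const
    (u := U (t₀ + ε) x₀ - U t₀ x₀ + η * ε / 6) (by linarith [mul_pos hη hε])
  filter_upwards [hev, he.eventually_ge_atTop i₀] with j hj hji s hs x hx
  have h1 := hi₀ (e j) hji (hH j) t₀ ht₀m x x₀ hx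
  have h2 := hi₀ (e j) hji (hH j) (t₀ + ε) ht₁m x x₀ hx
  rw [abs_le] at h1 h2
  have hc := fun x => continuous_bcf_apply (hH j).cont_W x
  have h3 := fun x => intervalIntegral.integral_interval_sub_left
    ((hc x).intervalIntegrable 0 (t₀ + ε)) ((hc x).intervalIntegrable 0 t₀) (μ := volume)
  have h4 := le_intervalIntegral_of_le (hc x) (a := t₀ + Λ) (b := t₀ + ε)
    (C := W j s x - C * (ε + Λ)) (by linarith) (fun τ hτ => by
      have h5 := (hH j).pow_sub_le_of_le hm hp0 hp hM.le (a₀ := t₀ / 2) (by linarith)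
        (by linarith [hs.1] : t₀ / 2 ≤ s) (by linarith [hs.2, hτ.1] : s ≤ τ)
        (hτ.2.trans hεT) x
      rw [← hC] at h5
      have h6 : C * (τ - s) ≤ C * (ε + Λ) := by
        have := hs.1
        have := hτ.2
        gcongr
        linarith
      linarith)
  have h5 : 0 ≤ ∫ s in t₀..t₀ + Λ, W j s x := intervalIntegral.integral_nonneg (by linarith)
    fun s hs => (hH j).W_nonneg ⟨ht₀.le.trans hs.1, by linarith [hs.2]⟩ x
  have h6 := intervalIntegral.integral_add_adjacent_intervals (μ := volume)
    ((hc x).intervalIntegrable t₀ (t₀ + Λ)) ((hc x).intervalIntegrable (t₀ + Λ) (t₀ + ε))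
  have h7 := h3 x
  have h8 := h3 x₀
  have h9 : W j s x * (ε - Λ) ≤ (A + 2 * η) * (ε - Λ) := by
    have : 0 ≤ C * Λ * Λ := by positivity
    have e1 : t₀ + ε - (t₀ + Λ) = ε - Λ := by ring
    rw [e1] at h4
    nlinarith
  exact le_of_mul_le_mul_right h9 (by linarith)

lemma eventually_le_W
    (hH : ∀ j, ApproxSol m p M K ((1 / 2) ^ e j) (n j) T f u₀ (u j) (W j) (F j))
    (hU : ∀ t ∈ Icc 0 T, ∀ x, Tendsto (fun j => ∫ s in 0..t, W j s x) atTop (nhds (U t x)))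
    (hm : 1 < m) (hp0 : 0 < p) (hp : p ≤ 1) (hM : 0 < M) {t₀ C A η δ : ℝ}
    (ht₀ : 0 < t₀) (hδ : 0 < δ) (hδT : t₀ + δ ≤ T)
    (hC : C = m * (1 / (m - 1)) * M ^ m / (t₀ / 2)) (hη : 0 < η)
    (x₀ : EuclideanSpace ℝ (Fin N)) (hA : A * δ ≤ U (t₀ + δ) x₀ - U t₀ x₀ + C * δ * δ)
    (hδη : δ * (4 * C) ≤ η) : ∀ᶠ j in atTop, A - η ≤ W j (t₀ + δ) x₀ := by
  have hm1 : 0 < m - 1 := by linarith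
  have hC0 : 0 ≤ C := by rw [hC]; positivity
  have ht₀m : t₀ ∈ Icc 0 T := ⟨ht₀.le, by linarith⟩
  have ht₁m : t₀ + δ ∈ Icc 0 T := ⟨by linarith, hδT⟩
  have hev := (tendsto_integral_sub hH hU ht₀m ht₁m x₀).eventually_const_lt
    (u := U (t₀ + δ) x₀ - U t₀ x₀ - η * δ / 2) (by linarith [mul_pos hη hδ])
  filter_upwards [hev] with j hj
  have h4 := intervalIntegral_le_of_le (continuous_bcf_apply (hH j).cont_W x₀) (a := t₀)
    (b := t₀ + δ) (C := W j (t₀ + δ) x₀ + C * δ) (by linarith) (fun τ hτ => by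
      have h5 := (hH j).pow_sub_le_of_le hm hp0 hp hM.le (a₀ := t₀ / 2) (by linarith)
        (by linarith [hτ.1] : t₀ / 2 ≤ τ) hτ.2 hδT x₀
      rw [← hC] at h5
      have h6 : C * (t₀ + δ - τ) ≤ C * δ := by
        have := hτ.1
        gcongr
        linarith
      linarith)
  rw [add_sub_cancel_left] at h4
  have h9 : (A - η) * δ ≤ W j (t₀ + δ) x₀ * δ := by nlinarith
  exact le_of_mul_le_mul_right h9 hδ

/-- The approximate solutions do not jump upwards in the limit. -/
lemma eventually_W_le_add
    (hH : ∀ j, ApproxSol m p M K ((1 / 2) ^ e j) (n j) T f u₀ (u j) (W j) (F j))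
    (he : Tendsto e atTop atTop)
    (hU : ∀ t ∈ Icc 0 T, ∀ x, Tendsto (fun j => ∫ s in 0..t, W j s x) atTop (nhds (U t x)))
    (hm : 1 < m) (hp0 : 0 < p) (hp : p ≤ 1) (hM : 0 < M) (hK : 0 ≤ K) {t₀ : ℝ}
    (ht₀ : t₀ ∈ Ioo 0 T) (x₀ : EuclideanSpace ℝ (Fin N)) {η' : ℝ} (hη' : 0 < η') :
    ∃ δ > 0, δ < η' ∧ δ ≤ t₀ / 2 ∧ t₀ + δ < T ∧
      ∀ᶠ j in atTop, W j (t₀ + δ) x₀ ≤ W j (t₀ - δ) x₀ + η' := by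
  have hm1 : 0 < m - 1 := by linarith
  have hm0 : 0 < m := by linarith
  obtain ⟨ht0, htT⟩ := ht₀
  set C := m * (1 / (m - 1)) * M ^ m / (t₀ / 2) with hC
  have hC0 : 0 ≤ C := by positivity
  have ht₀m : t₀ ∈ Icc 0 T := ⟨ht0.le, htT.le⟩
  set Q : ℝ → ℝ := fun ε => (U (t₀ + ε) x₀ - U t₀ x₀) / ε + C * ε with hQ
  have hQ0 : ∀ ε ∈ Ioo 0 (T - t₀), 0 ≤ Q ε := fun ε hε => by
    have h1 : 0 ≤ U (t₀ + ε) x₀ - U t₀ x₀ := by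
      refine ge_of_tendsto' (tendsto_integral_sub hH hU ht₀m
        ⟨by linarith [hε.1], by linarith [hε.2]⟩ x₀) fun j => ?_
      exact intervalIntegral.integral_nonneg (by linarith [hε.1])
        fun s hs => (hH j).W_nonneg ⟨ht0.le.trans hs.1, by linarith [hs.2, hε.2]⟩ x₀
    have := hε.1
    simp only [hQ]
    positivity
  have hne : (Q '' Ioo 0 (T - t₀)).Nonempty := (nonempty_Ioo.2 (by linarith)).image _
  have hbdd : BddBelow (Q '' Ioo 0 (T - t₀)) := ⟨0, by rintro _ ⟨ε, hε, rfl⟩; exact hQ0 ε hε⟩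
  set A := sInf (Q '' Ioo 0 (T - t₀)) with hA
  have hA0 : 0 ≤ A := le_csInf hne (by rintro _ ⟨ε, hε, rfl⟩; exact hQ0 ε hε)
  have hAle : ∀ ε ∈ Ioo 0 (T - t₀), A * ε ≤ U (t₀ + ε) x₀ - U t₀ x₀ + C * ε * ε := fun ε hε => by
    have h1 : A ≤ Q ε := csInf_le hbdd ⟨ε, hε, rfl⟩
    have h2 := mul_le_mul_of_nonneg_right h1 hε.1.le
    have h3 := hε.1.ne'
    simp only [hQ] at h2
    rwa [add_mul, div_mul_cancel₀ _ h3] at h2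
  have hstep : ∀ η > 0, ∃ ε > 0, t₀ + ε ≤ T ∧
      U (t₀ + ε) x₀ - U t₀ x₀ + C * ε * ε < (A + η) * ε := fun η hη => by
    obtain ⟨_, ⟨ε, hε, rfl⟩, hlt⟩ := exists_lt_of_csInf_lt hne (lt_add_of_pos_right A hη)
    refine ⟨ε, hε.1, by linarith [hε.2], ?_⟩
    have h2 := mul_lt_mul_of_pos_right hlt hε.1
    have h3 := hε.1.ne'
    simp only [hQ] at h2
    rwa [add_mul, div_mul_cancel₀ _ h3] at h2
  have hsmall : ∀ D c : ℝ, 0 < c → ∀ᶠ δ in nhdsWithin (0 : ℝ) (Ioi 0), δ * D < c := fun D c hc => by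
    have h1 : Tendsto (fun δ : ℝ => δ * D) (nhdsWithin 0 (Ioi 0)) (nhds (0 * D)) :=
      ((continuous_id.mul continuous_const).tendsto 0).mono_left nhdsWithin_le_nhds
    rw [zero_mul] at h1
    exact h1.eventually_lt_const hc
  rcases le_or_gt A (η' / 2) with hcase | hcase
  · obtain ⟨ε, hε, hεT, hAε⟩ := hstep (η' / 4) (by positivity)
    obtain ⟨ρ, hρ, Λ, hΛ, hΛε, hΛt, hev⟩ := eventually_W_le_near hH he hU hm hp0 hp hM hK ht0 hε hεT
      hC hA0 (by positivity) x₀ hAε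
    refine ⟨min Λ (η' / 2), by positivity, (min_le_right _ _).trans_lt (by linarith),
      (min_le_left _ _).trans hΛt, by linarith [min_le_left Λ (η' / 2)], ?_⟩
    filter_upwards [hev] with j hj
    have hδ : 0 < min Λ (η' / 2) := by positivity
    have hδΛ := min_le_left Λ (η' / 2)
    have h1 := hj (t₀ + min Λ (η' / 2)) ⟨by linarith, by linarith⟩ x₀ (by simpa using hρ)
    have h2 := (hH j).W_nonneg (t := t₀ - min Λ (η' / 2)) ⟨by linarith, by linarith⟩ x₀
    linarith
  have hAp : 0 < A := by linarith
  set κ := max 3 (m * ((A + 2) ^ (1 / m)) ^ (m - 1)) with hκ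
  set κ' := max 3 (1 / (A ^ (1 / m)) ^ (m - 1)) with hκ'
  have hκ3 : 3 ≤ κ := le_max_left _ _
  have hκ3' : 3 ≤ κ' := le_max_left _ _
  set L := 8 * M / η' + 1 with hL
  have hL0 : 0 < L := by positivity
  have hML : M / L ≤ η' / 8 := by
    rw [div_le_iff₀ hL0, hL]
    field_simp
    linarith
  set B := κ * Real.exp (N * κ / 2 * L) with hB
  have hB0 : 0 < B := by positivity
  set η := min 1 (η' / (24 * B * κ')) with hη
  have hκp : 0 < κ' := by linarith
  have hη0 : 0 < η := by positivity
  have hη1 : η ≤ 1 := min_le_left _ _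
  have hBη : B * (κ' * (3 * η)) ≤ η' / 8 := by
    have := min_le_right 1 (η' / (24 * B * κ'))
    rw [← hη, le_div_iff₀ (by positivity)] at this
    linarith
  obtain ⟨ε, hε, hεT, hAε⟩ := hstep η hη0
  obtain ⟨ρ, hρ, Λ₀, hΛ₀, hΛε, hΛt, hev⟩ := eventually_W_le_near hH he hU hm hp0 hp hM hK ht0 hε hεT
      hC hA0 hη0 x₀ hAε
  set a := (A + 2 * η) ^ (1 / m) with ha
  have ha0 : 0 < a := by positivity
  have ham : a ^ m = A + 2 * η := by
    rw [ha, one_div, Real.rpow_inv_rpow (by positivity) hm0.ne']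
  have hκa : m * a ^ (m - 1) ≤ κ := by
    have h1 : a ≤ (A + 2) ^ (1 / m) :=
      Real.rpow_le_rpow (by positivity) (by linarith) (by positivity)
    refine le_trans ?_ (le_max_right _ _)
    gcongr
  have hκa' : 1 ≤ κ' * a ^ (m - 1) := by
    have h0 : A ^ (1 / m) ≤ a := Real.rpow_le_rpow hA0 (by linarith) (by positivity)
    have h1 : (A ^ (1 / m)) ^ (m - 1) ≤ a ^ (m - 1) := by gcongr
    calc 1 = 1 / (A ^ (1 / m)) ^ (m - 1) * (A ^ (1 / m)) ^ (m - 1) := by field_simp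
      _ ≤ κ' * a ^ (m - 1) := by
        gcongr
        exact le_max_right _ _
  set q := max (2 * (a + M) / ρ ^ 2) (2 * (a ^ m + M ^ m) / ρ ^ 2) with hq
  have hq1 : 2 * (a + M) ≤ q * ρ ^ 2 := by
    rw [← div_le_iff₀ (by positivity)]; exact le_max_left _ _
  have hq2 : 2 * (a ^ m + M ^ m) ≤ q * ρ ^ 2 := by
    rw [← div_le_iff₀ (by positivity)]; exact le_max_right _ _
  have hq0 : 0 ≤ q := by positivity
  set C₂ := m * (1 / (m - 1)) * M / t₀ with hC₂
  set D := B * (κ' * (C₂ + K * M ^ p + 2 * N * q) + (2 * N * q + K * M ^ p) * L) with hD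
  have hpow : ∀ D c : ℝ, 0 < c → ∀ᶠ i : ℕ in atTop, (1 / 2 : ℝ) ^ i * D < c := fun D c hc => by
    have h1 := (tendsto_pow_atTop_nhds_zero_of_lt_one (r := (1 / 2 : ℝ)) (by norm_num)
      (by norm_num)).mul_const D
    rw [zero_mul] at h1
    exact h1.eventually_lt_const hc
  obtain ⟨i, hi1, hi2, hi3⟩ := ((hpow D (η' / 8) (by positivity)).and
    ((hpow (C * L) (η' / 8) (by positivity)).and (hpow L Λ₀ hΛ₀))).exists
  set S : ℝ := (1 / 2) ^ i with hS
  have hS0 : 0 < S := by positivity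
  set Λ := S * L with hΛ
  have hΛp : 0 < Λ := by positivity
  obtain ⟨δ, hδ0, hd1, hd2, hd3, hd4, hd5⟩ :=
    ((eventually_mem_nhdsWithin (a := (0 : ℝ)) (s := Ioi 0)).and
    ((hsmall 2 Λ hΛp).and ((hsmall 1 η' hη').and ((hsmall (4 * C) η hη0).and
    ((hsmall (2 * (A + 2 * η)) (Λ * (η' / 8)) (by positivity)).and
      (hsmall 1 (T - t₀) (by linarith))))))).exists
  rw [mem_Ioi] at hδ0
  rw [mul_one] at hd2 hd5
  refine ⟨δ, hδ0, hd2, by linarith, by linarith, ?_⟩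
  filter_upwards [hev, eventually_le_W hH hU hm hp0 hp hM ht0 hδ0 (by linarith) hC hη0 x₀
    (hAle δ ⟨hδ0, hd5⟩) hd3.le, he.eventually_ge_atTop i] with j hj1 hj2 hji
  have hkS : ((2 ^ (e j - i) : ℕ) : ℝ) * (1 / 2) ^ e j = S := by
    have h1 : (1 / 2 : ℝ) ^ e j = (1 / 2) ^ (e j - i) * (1 / 2) ^ i := by
      rw [← pow_add, Nat.sub_add_cancel hji]
    rw [h1, ← mul_assoc, Nat.cast_pow, ← mul_pow]
    norm_num [hS]
  have hge := (hH j).integral_W_ge hm hp0 hp hM.le hK (a := a) (κ := κ) (κ' := κ') (q := q)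
    (ρ := ρ) (L := L) (θ := 3 * η) (b := t₀ + δ - Λ) (t₁ := t₀ + δ) (C := C₂)
    (k := 2 ^ (e j - i)) (x₀ := x₀) ha0 hκ3 hκa hκ3' hκa' hρ.le hq0 hq1 hq2 (by positivity) hL0.le
    (by linarith) (by rw [hkS, hΛ]; ring) (by linarith) (by linarith)
    (by rw [hC₂]; gcongr; linarith)
    (fun s hs x hx => by
      have hsT : s ∈ Icc 0 T := ⟨by linarith [hs.1], by linarith [hs.2]⟩
      have h1 := hj1 s ⟨by linarith [hs.1], by linarith [hs.2]⟩ x hx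
      rw [(hH j).W_eq s hsT, ← ham] at h1
      exact (Real.rpow_le_rpow_iff ((hH j).nonneg s hsT x) ha0.le hm0).1 h1)
    (by rw [ham]; linarith)
  rw [hkS, ham] at hge
  have hc := continuous_bcf_apply (hH j).cont_W x₀
  have hw0 := (hH j).W_nonneg (t := t₀ - δ) ⟨by linarith, by linarith⟩ x₀
  have hI1 := intervalIntegral_le_of_le hc (a := t₀ + δ - Λ) (b := t₀ - δ)
    (C := W j (t₀ - δ) x₀ + C * Λ) (by linarith) (fun τ hτ => by
      have h5 := (hH j).pow_sub_le_of_le hm hp0 hp hM.le (a₀ := t₀ / 2) (by linarith)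
        (by linarith [hτ.1] : t₀ / 2 ≤ τ) hτ.2 (by linarith) x₀
      rw [← hC] at h5
      have h6 : C * (t₀ - δ - τ) ≤ C * Λ := by
        have := hτ.1
        gcongr
        linarith
      linarith)
  have hI2 := intervalIntegral_le_of_le hc (a := t₀ - δ) (b := t₀ + δ)
    (C := A + 2 * η) (by linarith) (fun τ hτ =>
      hj1 τ ⟨by linarith [hτ.1], by linarith [hτ.2]⟩ x₀ (by simpa using hρ))
  have hI := intervalIntegral.integral_add_adjacent_intervals (μ := volume)
    (hc.intervalIntegrable (t₀ + δ - Λ) (t₀ - δ)) (hc.intervalIntegrable (t₀ - δ) (t₀ + δ))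
  have hI3 : (W j (t₀ - δ) x₀ + C * Λ) * (t₀ - δ - (t₀ + δ - Λ)) ≤
      (W j (t₀ - δ) x₀ + C * Λ) * Λ := by
    gcongr
    linarith
  have hup := hj1 (t₀ + δ) ⟨by linarith, by linarith⟩ x₀ (by simpa using hρ)
  have hY : κ * (Real.exp (N * κ / 2 * L) * (κ' * (3 * η + (C₂ + K * M ^ p) * S
      + q * (2 * N * S)) + (2 * N * q + K * M ^ p) * (L * S)))
      = B * (κ' * (3 * η)) + S * D := by
    rw [hD, hB]; ring
  rw [hY] at hge
  have hSM : S * M = Λ * (M / L) := by rw [hΛ]; field_simp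
  have hfin : Λ * (A + 2 * η - (η' / 8 + η' / 8) - η' / 8 - C * Λ - η' / 8)
      ≤ Λ * W j (t₀ - δ) x₀ := by
    have g1 : Λ * (A + 2 * η - (η' / 8 + η' / 8)) ≤
        L * S * (A + 2 * η - (B * (κ' * (3 * η)) + S * D)) := by
      have : L * S = Λ := by rw [hΛ]; ring
      rw [this]
      gcongr
    have g2 : S * M ≤ Λ * (η' / 8) := by rw [hSM]; gcongr
    linarith
  have hfin' := le_of_mul_le_mul_left hfin hΛp
  have hCΛ : C * Λ ≤ η' / 8 := by
    rw [hΛ]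
    linarith
  linarith

end

section

variable {N : ℕ} {m p M K h n T : ℝ} {f u₀ : EuclideanSpace ℝ (Fin N) → ℝ}
  {u W F : ℝ → (EuclideanSpace ℝ (Fin N) →ᵇ ℝ)}

lemma ApproxSol.mul_W_le_integral (H : ApproxSol m p M K h n T f u₀ u W F) (hm : 1 < m)
    (hp0 : 0 < p) (hp : p ≤ 1) (hM : 0 ≤ M) {a₀ a b C : ℝ} (ha₀ : 0 < a₀)
    (hC : C = m * (1 / (m - 1)) * M ^ m / a₀) (ha : a₀ ≤ a) (hab : a ≤ b) (hb : b ≤ T)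
    (x : EuclideanSpace ℝ (Fin N)) :
    (b - a) * W a x ≤ (∫ s in a..b, W s x) + C * (b - a) ^ 2 := by
  have hm1 : 0 < m - 1 := by linarith
  have hC0 : 0 ≤ C := by rw [hC]; positivity
  have := le_intervalIntegral_of_le (continuous_bcf_apply H.cont_W x) hab
    (C := W a x - C * (b - a)) (fun τ hτ => by
      have h5 := H.pow_sub_le_of_le hm hp0 hp hM ha₀ ha hτ.1 (hτ.2.trans hb) x
      rw [← hC] at h5
      have h6 : C * (τ - a) ≤ C * (b - a) := by
        have := hτ.2
        gcongr
      linarith)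
  nlinarith

lemma ApproxSol.integral_le_mul_W (H : ApproxSol m p M K h n T f u₀ u W F) (hm : 1 < m)
    (hp0 : 0 < p) (hp : p ≤ 1) (hM : 0 ≤ M) {a₀ a b C : ℝ} (ha₀ : 0 < a₀)
    (hC : C = m * (1 / (m - 1)) * M ^ m / a₀) (ha : a₀ ≤ a) (hab : a ≤ b) (hb : b ≤ T)
    (x : EuclideanSpace ℝ (Fin N)) :
    ∫ s in a..b, W s x ≤ (b - a) * W b x + C * (b - a) ^ 2 := by
  have hm1 : 0 < m - 1 := by linarith
  have hC0 : 0 ≤ C := by rw [hC]; positivity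
  have := intervalIntegral_le_of_le (continuous_bcf_apply H.cont_W x) hab
    (C := W b x + C * (b - a)) (fun τ hτ => by
      have h5 := H.pow_sub_le_of_le hm hp0 hp hM ha₀ (ha.trans hτ.1) hτ.2 hb x
      rw [← hC] at h5
      have h6 : C * (b - τ) ≤ C * (b - a) := by
        have := hτ.1
        gcongr
      linarith)
  nlinarith

end

section

variable {N : ℕ} {m p M K T : ℝ} {f u₀ : EuclideanSpace ℝ (Fin N) → ℝ} {e : ℕ → ℕ} {n : ℕ → ℝ}
  {u W F : ℕ → ℝ → (EuclideanSpace ℝ (Fin N) →ᵇ ℝ)} {U : ℝ → EuclideanSpace ℝ (Fin N) → ℝ}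

lemma exists_tendsto_W
    (hH : ∀ j, ApproxSol m p M K ((1 / 2) ^ e j) (n j) T f u₀ (u j) (W j) (F j))
    (he : Tendsto e atTop atTop)
    (hU : ∀ t ∈ Icc 0 T, ∀ x, Tendsto (fun j => ∫ s in 0..t, W j s x) atTop (nhds (U t x)))
    (hm : 1 < m) (hp0 : 0 < p) (hp : p ≤ 1) (hM : 0 < M) (hK : 0 ≤ K) {t : ℝ}
    (ht : t ∈ Ioo 0 T) (x : EuclideanSpace ℝ (Fin N)) :
    ∃ l, Tendsto (fun j => W j t x) atTop (nhds l) := by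
  have hm1 : 0 < m - 1 := by linarith
  obtain ⟨ht0, htT⟩ := ht
  set C := m * (1 / (m - 1)) * M ^ m / (t / 2) with hC
  have hC0 : 0 ≤ C := by positivity
  refine exists_tendsto_of_forall_approx fun ε hε => ?_
  obtain ⟨δ, hδ, hδη, hδt, hδT, hev⟩ := eventually_W_le_add hH he hU hm hp0 hp hM hK ⟨ht0, htT⟩ x
    (η' := ε / (1 + 2 * C)) (by positivity)
  have hεη : (1 + 2 * C) * (ε / (1 + 2 * C)) = ε := by field_simp
  set η := ε / (1 + 2 * C)
  refine ⟨fun j => (∫ s in t - δ..t, W j s x) / δ, _,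
    (tendsto_integral_sub hH hU ⟨by linarith, by linarith⟩ ⟨ht0.le, htT.le⟩ x).div_const δ, ?_⟩
  filter_upwards [hev] with j hj
  have ht2 : 0 < t / 2 := by linarith
  have h1 := (hH j).integral_le_mul_W hm hp0 hp hM.le ht2 hC (a := t - δ) (b := t) (by linarith)
    (by linarith) htT.le x
  have h2 := (hH j).mul_W_le_integral hm hp0 hp hM.le ht2 hC (a := t - δ) (b := t) (by linarith)
    (by linarith) htT.le x
  have h3 := (hH j).pow_sub_le_of_le hm hp0 hp hM.le (a₀ := t / 2) (t := t) (t' := t + δ)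
    ht2 (by linarith) (by linarith) hδT.le x
  rw [← hC, add_sub_cancel_left] at h3
  rw [sub_sub_cancel] at h1 h2
  have h4 : (∫ s in t - δ..t, W j s x) / δ ≤ W j t x + C * δ := by
    rw [div_le_iff₀ hδ]; linarith
  have h5 : W j (t - δ) x - C * δ ≤ (∫ s in t - δ..t, W j s x) / δ := by
    rw [le_div_iff₀ hδ]; linarith
  have h6 : C * δ ≤ C * η := by gcongr
  have h7 : 0 ≤ C * δ := by positivity
  rw [abs_le]
  constructor <;> linarith

lemma continuousAt_limit_W {w : ℝ → EuclideanSpace ℝ (Fin N) → ℝ}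
    (hH : ∀ j, ApproxSol m p M K ((1 / 2) ^ e j) (n j) T f u₀ (u j) (W j) (F j))
    (he : Tendsto e atTop atTop)
    (hU : ∀ t ∈ Icc 0 T, ∀ x, Tendsto (fun j => ∫ s in 0..t, W j s x) atTop (nhds (U t x)))
    (hUc : Continuous (Function.uncurry U))
    (hw : ∀ t ∈ Ioo 0 T, ∀ x, Tendsto (fun j => W j t x) atTop (nhds (w t x)))
    (hm : 1 < m) (hp0 : 0 < p) (hp : p ≤ 1) (hM : 0 < M) (hK : 0 ≤ K) {t₀ : ℝ}
    (ht₀ : t₀ ∈ Ioo 0 T) (x₀ : EuclideanSpace ℝ (Fin N)) :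
    ContinuousAt (Function.uncurry w) (t₀, x₀) := by
  have hm1 : 0 < m - 1 := by linarith
  have ht₀' := ht₀
  obtain ⟨ht0, htT⟩ := ht₀
  have ht4 : 0 < t₀ / 4 := by linarith
  set C := m * (1 / (m - 1)) * M ^ m / (t₀ / 4) with hC
  have hC0 : 0 ≤ C := by positivity
  have hlow : ∀ a b x, t₀ / 4 ≤ a → a ≤ b → b < T →
      (b - a) * w a x ≤ U b x - U a x + C * (b - a) ^ 2 := fun a b x ha hab hb =>
    le_of_tendsto_of_tendsto' ((hw a ⟨by linarith, by linarith⟩ x).const_mul (b - a))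
      ((tendsto_integral_sub hH hU ⟨by linarith, by linarith⟩ ⟨by linarith, hb.le⟩ x).add_const _)
      fun j => (hH j).mul_W_le_integral hm hp0 hp hM.le ht4 hC ha hab hb.le x
  have hupp : ∀ a b x, t₀ / 4 ≤ a → a ≤ b → b < T →
      U b x - U a x ≤ (b - a) * w b x + C * (b - a) ^ 2 := fun a b x ha hab hb =>
    le_of_tendsto_of_tendsto'
      (tendsto_integral_sub hH hU ⟨by linarith, by linarith⟩ ⟨by linarith, hb.le⟩ x)
      (((hw b ⟨by linarith, by linarith⟩ x).const_mul (b - a)).add_const _)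
      fun j => (hH j).integral_le_mul_W hm hp0 hp hM.le ht4 hC ha hab hb.le x
  have hmon : ∀ a b x, t₀ / 4 ≤ a → a ≤ b → b < T → w a x - C * (b - a) ≤ w b x :=
    fun a b x ha hab hb =>
      le_of_tendsto_of_tendsto' ((hw a ⟨by linarith, by linarith⟩ x).sub_const _)
      (hw b ⟨by linarith, by linarith⟩ x)
      fun j => (hH j).pow_sub_le_of_le hm hp0 hp hM.le ht4 ha hab hb.le x
  rw [Metric.continuousAt_iff']
  intro ε hε
  obtain ⟨δ, hδ, hδη, hδt, hδT, hev⟩ := eventually_W_le_add hH he hU hm hp0 hp hM hK ht₀' x₀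
    (η' := ε / (2 * (1 + 3 * C))) (by positivity)
  have hεη : (1 + 3 * C) * (ε / (2 * (1 + 3 * C))) = ε / 2 := by field_simp
  set η := ε / (2 * (1 + 3 * C))
  have hstar : w (t₀ + δ) x₀ ≤ w (t₀ - δ) x₀ + η :=
    le_of_tendsto_of_tendsto (hw _ ⟨by linarith, hδT⟩ x₀)
      ((hw _ ⟨by linarith, by linarith⟩ x₀).add_const η) hev
  have hCδ : C * δ ≤ C * η := by gcongr
  have hm1' := hmon (t₀ - δ) t₀ x₀ (by linarith) (by linarith) htT
  have hm2' := hmon t₀ (t₀ + δ) x₀ (by linarith) (by linarith) hδT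
  rw [sub_sub_cancel] at hm1'
  rw [add_sub_cancel_left] at hm2'
  have hg₁ : Continuous fun z : ℝ × EuclideanSpace ℝ (Fin N) =>
      (U (z.1 + δ) z.2 - U z.1 z.2) / δ + C * δ := by
    have h1 : Continuous fun z : ℝ × EuclideanSpace ℝ (Fin N) => U (z.1 + δ) z.2 :=
      hUc.comp ((continuous_fst.add continuous_const).prodMk continuous_snd)
    exact ((h1.sub hUc).div_const _).add continuous_const
  have hg₂ : Continuous fun z : ℝ × EuclideanSpace ℝ (Fin N) =>
      (U z.1 z.2 - U (z.1 - δ) z.2) / δ - C * δ := by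
    have h1 : Continuous fun z : ℝ × EuclideanSpace ℝ (Fin N) => U (z.1 - δ) z.2 :=
      hUc.comp ((continuous_fst.sub continuous_const).prodMk continuous_snd)
    exact ((hUc.sub h1).div_const _).sub continuous_const
  have hv₁ : (U (t₀ + δ) x₀ - U t₀ x₀) / δ + C * δ < w t₀ x₀ + ε := by
    have h1 := hupp t₀ (t₀ + δ) x₀ (by linarith) (by linarith) hδT
    rw [add_sub_cancel_left] at h1
    have h2 : (U (t₀ + δ) x₀ - U t₀ x₀) / δ ≤ w (t₀ + δ) x₀ + C * δ := by
      rw [div_le_iff₀ hδ]; linarith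
    linarith
  have hv₂ : w t₀ x₀ - ε < (U t₀ x₀ - U (t₀ - δ) x₀) / δ - C * δ := by
    have h1 := hlow (t₀ - δ) t₀ x₀ (by linarith) (by linarith) htT
    rw [sub_sub_cancel] at h1
    have h2 : w (t₀ - δ) x₀ - C * δ ≤ (U t₀ x₀ - U (t₀ - δ) x₀) / δ := by
      rw [le_div_iff₀ hδ]; linarith
    linarith
  have hfst : Tendsto (fun z : ℝ × EuclideanSpace ℝ (Fin N) => z.1) (nhds (t₀, x₀)) (nhds t₀) :=
    continuous_fst.tendsto _
  filter_upwards [hg₁.continuousAt.eventually_lt_const hv₁,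
    hg₂.continuousAt.eventually_const_lt hv₂,
    hfst.eventually_lt_const (by linarith : t₀ < T - δ),
    hfst.eventually_const_lt (by linarith : t₀ / 4 + δ < t₀)] with z h1 h2 h3 h4
  have h5 := hlow z.1 (z.1 + δ) z.2 (by linarith) (by linarith) (by linarith)
  have h6 := hupp (z.1 - δ) z.1 z.2 (by linarith) (by linarith) (by linarith)
  rw [add_sub_cancel_left] at h5
  rw [sub_sub_cancel] at h6
  have h7 : w z.1 z.2 - C * δ ≤ (U (z.1 + δ) z.2 - U z.1 z.2) / δ := by
    rw [le_div_iff₀ hδ]; linarith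
  have h8 : (U z.1 z.2 - U (z.1 - δ) z.2) / δ ≤ w z.1 z.2 + C * δ := by
    rw [div_le_iff₀ hδ]; linarith
  rw [Real.dist_eq, abs_lt]
  simp only [Function.uncurry]
  constructor <;> linarith

end

lemma continuous_of_tendsto_of_equicontinuous {α : Type*} [TopologicalSpace α] {g : ℕ → α → ℝ}
    {G : α → ℝ} (heq : ∀ a, ∀ ε > 0, ∀ᶠ b in nhds a, ∀ᶠ j in atTop, |g j b - g j a| ≤ ε)
    (hG : ∀ a, Tendsto (fun j => g j a) atTop (nhds (G a))) : Continuous G := by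
  refine continuous_iff_continuousAt.2 fun a => Metric.continuousAt_iff'.2 fun ε hε => ?_
  filter_upwards [heq a (ε / 2) (by positivity)] with b hb
  rw [Real.dist_eq]
  exact (le_of_tendsto ((hG b).sub (hG a)).abs hb).trans_lt (by linarith)

section

variable {N : ℕ} {m p M K T : ℝ} {f u₀ : EuclideanSpace ℝ (Fin N) → ℝ} {n : ℕ → ℝ}
  {u W F : ℕ → ℝ → (EuclideanSpace ℝ (Fin N) →ᵇ ℝ)}

lemma exists_subseq_integral_tendsto
    (hH : ∀ j, ApproxSol m p M K ((1 / 2) ^ j) (n j) T f u₀ (u j) (W j) (F j))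
    (hm : 1 < m) (hp0 : 0 < p) (hM : 0 < M) (hK : 0 ≤ K) (hT : 0 < T) :
    ∃ φ : ℕ → ℕ, StrictMono φ ∧ ∃ U : ℝ → EuclideanSpace ℝ (Fin N) → ℝ,
      Continuous (Function.uncurry U) ∧
      ∀ t ∈ Icc 0 T, ∀ x, Tendsto (fun j => ∫ s in 0..t, W (φ j) s x) atTop (nhds (U t x)) := by
  have hm0 : 0 < m := by linarith
  set g : ℕ → Icc 0 T × EuclideanSpace ℝ (Fin N) → ℝ :=
    fun j z => ∫ s in (0 : ℝ)..z.1, W j s z.2 with hg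
  have hlip : ∀ j, ∀ s ∈ Icc 0 T, ∀ t ∈ Icc 0 T, ∀ x,
      |(∫ τ in 0..t, W j τ x) - ∫ τ in 0..s, W j τ x| ≤ M ^ m * |t - s| := by
    intro j s hs t ht x
    have hc := continuous_bcf_apply (hH j).cont_W x
    rw [intervalIntegral.integral_interval_sub_left (hc.intervalIntegrable _ _)
      (hc.intervalIntegrable _ _), ← Real.norm_eq_abs]
    refine intervalIntegral.norm_integral_le_of_norm_le_const fun τ hτ => ?_
    have hτT : τ ∈ Icc 0 T := by
      have h1 := uIoc_subset_uIcc hτ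
      exact (ordConnected_Icc.uIcc_subset hs ht) h1
    rw [Real.norm_of_nonneg ((hH j).W_nonneg hτT x)]
    exact (hH j).W_le hm hτT x
  have heq : ∀ a, ∀ ε > 0, ∀ᶠ b in nhds a, ∀ᶠ j in atTop, |g j b - g j a| ≤ ε := by
    rintro ⟨t, x⟩ ε hε
    obtain ⟨ρ, hρ, i₀, hi₀⟩ := ApproxSol.integral_equicontinuous (p := p) hm hp0 hM.le hK hT.le N
      (by positivity : 0 < ε / 2)
    have h1 : Tendsto (fun z : Icc 0 T × EuclideanSpace ℝ (Fin N) => M ^ m * |(z.1 : ℝ) - t|)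
        (nhds (t, x)) (nhds (M ^ m * |(t : ℝ) - t|)) :=
      ((((continuous_subtype_val.comp continuous_fst).sub continuous_const).abs).const_mul
        _).tendsto (t, x)
    have h2 : Tendsto (fun z : Icc 0 T × EuclideanSpace ℝ (Fin N) => ‖z.2 - x‖)
        (nhds (t, x)) (nhds ‖x - x‖) := ((continuous_snd.sub continuous_const).norm).tendsto (t, x)
    rw [sub_self, abs_zero, mul_zero] at h1
    rw [sub_self, norm_zero] at h2
    filter_upwards [h1.eventually_lt_const (by positivity : 0 < ε / 2),
      h2.eventually_lt_const hρ] with z hz1 hz2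
    filter_upwards [eventually_ge_atTop i₀] with j hj
    have h3 := hlip j t t.2 z.1 z.1.2 z.2
    have h4 := hi₀ j hj (hH j) t t.2 z.2 x hz2
    calc |g j z - g j (t, x)| ≤ |(∫ τ in (0 : ℝ)..z.1, W j τ z.2) - ∫ τ in (0 : ℝ)..t, W j τ z.2|
          + |(∫ τ in (0 : ℝ)..t, W j τ z.2) - ∫ τ in (0 : ℝ)..t, W j τ x| := abs_sub_le _ _ _
      _ ≤ ε := by linarith
  have h0 : (0 : ℝ) ∈ Icc 0 T := ⟨le_rfl, hT.le⟩
  have : Nonempty (Icc 0 T × EuclideanSpace ℝ (Fin N)) := ⟨(⟨0, h0⟩, 0)⟩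
  obtain ⟨φ, hφ, G, hG⟩ := exists_subseq_tendsto_of_equicontinuous g (B := M ^ m * T)
    (fun j z => by
      have h1 := hlip j 0 h0 z.1 z.1.2 z.2
      rw [intervalIntegral.integral_same, sub_zero, sub_zero, abs_of_nonneg z.1.2.1] at h1
      exact h1.trans (by have := z.1.2.2; gcongr)) heq
  have hGc : Continuous G := continuous_of_tendsto_of_equicontinuous (g := fun j => g (φ j))
    (fun a ε hε => (heq a ε hε).mono fun b hb => hφ.tendsto_atTop.eventually hb) hG
  refine ⟨φ, hφ, fun t x => G (projIcc 0 T hT.le t, x), ?_, fun t ht x => ?_⟩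
  · exact hGc.comp ((continuous_projIcc.comp continuous_fst).prodMk continuous_snd)
  · have := hG (⟨t, ht⟩, x)
    simpa only [projIcc_of_mem hT.le ht] using this

/-- A subsequence of the approximate solutions converges, at every point, to a continuous limit. -/
lemma exists_subseq_W_tendsto
    (hH : ∀ j, ApproxSol m p M K ((1 / 2) ^ j) (n j) T f u₀ (u j) (W j) (F j))
    (hm : 1 < m) (hp0 : 0 < p) (hp : p ≤ 1) (hM : 0 < M) (hK : 0 ≤ K) (hT : 0 < T) :
    ∃ φ : ℕ → ℕ, StrictMono φ ∧ ∃ w : ℝ → EuclideanSpace ℝ (Fin N) → ℝ,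
      (∀ t ∈ Ioo 0 T, ∀ x, Tendsto (fun j => W (φ j) t x) atTop (nhds (w t x))) ∧
      ∀ t ∈ Ioo 0 T, ∀ x, ContinuousAt (Function.uncurry w) (t, x) := by
  obtain ⟨φ, hφ, U, hUc, hU⟩ := exists_subseq_integral_tendsto hH hm hp0 hM hK hT
  have hH' : ∀ j, ApproxSol m p M K ((1 / 2) ^ φ j) (n (φ j)) T f u₀
      (u (φ j)) (W (φ j)) (F (φ j)) :=
    fun j => hH (φ j)
  have hex : ∀ t x, ∃ l, t ∈ Ioo 0 T → Tendsto (fun j => W (φ j) t x) atTop (nhds l) := by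
    intro t x
    by_cases ht : t ∈ Ioo 0 T
    · obtain ⟨l, hl⟩ := exists_tendsto_W hH' hφ.tendsto_atTop hU hm hp0 hp hM hK ht x
      exact ⟨l, fun _ => hl⟩
    · exact ⟨0, fun h => absurd h ht⟩
  choose w hw using hex
  exact ⟨φ, hφ, w, fun t ht x => hw t x ht, fun t ht x =>
    continuousAt_limit_W hH' hφ.tendsto_atTop hU hUc (fun t ht x => hw t x ht) hm hp0 hp hM hK ht x⟩

end

section TestFunctions

variable {N : ℕ} {T : ℝ} {η : EuclideanSpace ℝ (Fin N) → ℝ → ℝ}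

lemma IsTestFn.hasDerivAt (hη : IsTestFn T η) (x : EuclideanSpace ℝ (Fin N)) (t : ℝ) :
    HasDerivAt (η x) (fderiv ℝ (Function.uncurry η) (x, t) (0, 1)) t := by
  have h1 : DifferentiableAt ℝ (Function.uncurry η) (x, t) :=
    hη.contDiff_two.differentiable (by norm_num) _
  have h2 : HasDerivAt (fun s : ℝ => (x, s)) ((0 : EuclideanSpace ℝ (Fin N)), (1:ℝ)) t :=
    (hasDerivAt_const t x).prodMk (hasDerivAt_id t)
  exact h1.hasFDerivAt.comp_hasDerivAt t h2

lemma IsTestFn.continuous_deriv (hη : IsTestFn T η) :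
    Continuous fun z : EuclideanSpace ℝ (Fin N) × ℝ => deriv (η z.1) z.2 := by
  have : (fun z : EuclideanSpace ℝ (Fin N) × ℝ => deriv (η z.1) z.2)
      = fun z => fderiv ℝ (Function.uncurry η) z (0, 1) := by
    ext z; exact (hη.hasDerivAt z.1 z.2).deriv
  rw [this]
  exact (hη.contDiff_two.continuous_fderiv (by norm_num)).clm_apply continuous_const

lemma IsTestFn.hasCompactSupport_deriv (hη : IsTestFn T η) :
    HasCompactSupport fun z : EuclideanSpace ℝ (Fin N) × ℝ => deriv (η z.1) z.2 := by
  have : (fun z : EuclideanSpace ℝ (Fin N) × ℝ => deriv (η z.1) z.2)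
      = fun z => fderiv ℝ (Function.uncurry η) z (0, 1) := by
    ext z; exact (hη.hasDerivAt z.1 z.2).deriv
  rw [this]
  exact hη.2.1.fderiv_apply ℝ (0, 1)

/-- An integrable envelope for a test function and its time derivative. -/
lemma IsTestFn.exists_envelope (hη : IsTestFn T η) :
    ∃ g : EuclideanSpace ℝ (Fin N) → ℝ, Integrable g ∧
      ∀ x t, |η x t| ≤ g x ∧ |deriv (η x) t| ≤ g x := by
  obtain ⟨C, hC0, hC⟩ := hη.exists_bound
  obtain ⟨D, hD⟩ := hη.hasCompactSupport_deriv.exists_bound_of_continuous hη.continuous_deriv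
  have hD0 : 0 ≤ D := (norm_nonneg _).trans (hD 0)
  set S : Set (EuclideanSpace ℝ (Fin N)) :=
    Prod.fst '' (tsupport (Function.uncurry η)) ∪
      Prod.fst '' (tsupport fun z : EuclideanSpace ℝ (Fin N) × ℝ => deriv (η z.1) z.2) with hS
  have hSc : IsCompact S := (hη.2.1.isCompact.image continuous_fst).union
    (hη.hasCompactSupport_deriv.isCompact.image continuous_fst)
  refine ⟨S.indicator fun _ => C + D, ?_, fun x t => ?_⟩
  · rw [integrable_indicator_iff hSc.measurableSet]
    exact integrableOn_const hSc.measure_lt_top.ne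
  · by_cases hx : x ∈ S
    · rw [indicator_of_mem hx]
      have h1 := hC x t
      have h2 : |deriv (η x) t| ≤ D := hD (x, t)
      constructor <;> linarith
    · rw [indicator_of_notMem hx]
      have h1 : η x t = 0 := by
        by_contra hne
        exact hx (Or.inl ⟨(x, t), subset_tsupport _ hne, rfl⟩)
      have h2 : deriv (η x) t = 0 := by
        by_contra hne
        exact hx (Or.inr ⟨(x, t), subset_tsupport
          (fun z : EuclideanSpace ℝ (Fin N) × ℝ => deriv (η z.1) z.2) hne, rfl⟩)
      simp [h1, h2]

lemma IsTestFn.continuous_slice (hη : IsTestFn T η) (t : ℝ) : Continuous fun y => η y t :=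
  hη.1.continuous.comp (Continuous.prodMk_left t)

lemma IsTestFn.continuous_heatAvg (hη : IsTestFn T η) (s t : ℝ) :
    Continuous fun x => heatAvg s η x t := by
  obtain ⟨C, -, hC⟩ := hη.exists_bound
  have := (heatOp N s (BoundedContinuousFunction.ofNormedAddCommGroup (fun y => η y t)
    (hη.continuous_slice t) C fun y => hC y t)).continuous
  refine this.congr fun x => ?_
  rw [heatOp_apply]
  rfl

lemma abs_heatAvg_le {C : ℝ} (hC : ∀ x t, |η x t| ≤ C) (s : ℝ)
    (x : EuclideanSpace ℝ (Fin N)) (t : ℝ) :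
    |heatAvg s η x t| ≤ C := by
  have := norm_integral_le_of_norm_le_const (μ := heatMeasure N s)
    (f := fun y => η (x + y) t) (C := C) (Eventually.of_forall fun y => hC (x + y) t)
  simpa [heatAvg] using this

end TestFunctions

section Identity

variable {N : ℕ} {m p M K h n T : ℝ} {f u₀ : EuclideanSpace ℝ (Fin N) → ℝ}
  {u W F : ℝ → (EuclideanSpace ℝ (Fin N) →ᵇ ℝ)} {η : EuclideanSpace ℝ (Fin N) → ℝ → ℝ}

lemma continuous_bcf_uncurry {u : ℝ → (EuclideanSpace ℝ (Fin N) →ᵇ ℝ)} (hu : Continuous u) :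
    Continuous fun z : EuclideanSpace ℝ (Fin N) × ℝ => u z.2 z.1 :=
  (hu.comp continuous_snd).eval continuous_fst

lemma ApproxSol.integral_mul_testFn (H : ApproxSol m p M K h n T f u₀ u W F) (hη : IsTestFn T η)
    (hW : ∀ t ∈ Icc 0 T, Integrable (W t)) {t : ℝ} (ht : t ∈ Ioo 0 T) :
    IntegrableOn (fun τ => ∫ x, (W τ x * ((heatAvg h η x τ - η x τ) / h)
        + u τ x * _root_.deriv (η x) τ)) (Ioo 0 t) ∧
      IntegrableOn (fun τ => ∫ x, F τ x * η x τ) (Ioo 0 t) ∧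
      ∫ x, u t x * η x t =
        (∫ τ in Ioo 0 t, ∫ x, (W τ x * ((heatAvg h η x τ - η x τ) / h)
          + u τ x * _root_.deriv (η x) τ)) + ∫ τ in Ioo 0 t, ∫ x, F τ x * η x τ := by
  set a : EuclideanSpace ℝ (Fin N) × ℝ → ℝ := fun z =>
    (h⁻¹ * (heatOp N h (W z.2) z.1 - W z.2 z.1)) * η z.1 z.2 + u z.2 z.1 * _root_.deriv (η z.1) z.2
    with ha
  set b : EuclideanSpace ℝ (Fin N) × ℝ → ℝ := fun z => F z.2 z.1 * η z.1 z.2 with hb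
  have hηc : Continuous fun z : EuclideanSpace ℝ (Fin N) × ℝ => η z.1 z.2 := hη.1.continuous
  have hηs : HasCompactSupport fun z : EuclideanSpace ℝ (Fin N) × ℝ => η z.1 z.2 := hη.2.1
  have hPW : Continuous fun z : EuclideanSpace ℝ (Fin N) × ℝ => heatOp N h (W z.2) z.1 :=
    continuous_bcf_uncurry (u := fun s => heatOp N h (W s))
      ((heatOp N h).continuous.comp H.cont_W)
  have hac : Continuous a :=
    (((continuous_const.mul (hPW.sub (continuous_bcf_uncurry H.cont_W))).mul hηc).add
      ((continuous_bcf_uncurry H.cont).mul hη.continuous_deriv))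
  have hbc : Continuous b := (continuous_bcf_uncurry H.cont_F).mul hηc
  have has : HasCompactSupport a := hηs.mul_left.add hη.hasCompactSupport_deriv.mul_left
  have hbs : HasCompactSupport b := hηs.mul_left
  set ν : Measure ℝ := volume.restrict (Ioo 0 t) with hν
  have hai : Integrable a ((volume : Measure (EuclideanSpace ℝ (Fin N))).prod ν) :=
    hac.integrable_of_hasCompactSupport has
  have hbi : Integrable b ((volume : Measure (EuclideanSpace ℝ (Fin N))).prod ν) :=
    hbc.integrable_of_hasCompactSupport hbs
  have hA : ∀ τ ∈ Ioo 0 t, ∫ x, a (x, τ) = ∫ x, (W τ x * ((heatAvg h η x τ - η x τ) / h)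
        + u τ x * _root_.deriv (η x) τ) := by
    intro τ hτ
    have hτ' : τ ∈ Icc 0 T := ⟨hτ.1.le, hτ.2.le.trans ht.2.le⟩
    obtain ⟨g, hg, hgb⟩ := hη.exists_envelope
    obtain ⟨C, -, hC⟩ := hη.exists_bound
    have hbm : ∀ w : EuclideanSpace ℝ (Fin N) →ᵇ ℝ, Integrable fun x => w x * η x τ := fun w =>
      (hη.integrable_slice τ).bdd_mul w.continuous.aestronglyMeasurable
        (Eventually.of_forall w.norm_coe_le_norm)
    have hud : Integrable fun x => u τ x * _root_.deriv (η x) τ := by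
      refine (Integrable.mono' hg ?_ (Eventually.of_forall fun x => (hgb x τ).2)).bdd_mul
        (u τ).continuous.aestronglyMeasurable (Eventually.of_forall (u τ).norm_coe_le_norm)
      exact (hη.continuous_deriv.comp (Continuous.prodMk_left τ)).aestronglyMeasurable
    have hWa : Integrable fun x => W τ x * heatAvg h η x τ :=
      (hW τ hτ').mul_bdd (c := C) (hη.continuous_heatAvg h τ).aestronglyMeasurable
        (Eventually.of_forall fun x => abs_heatAvg_le hC h x τ)
    have e1 : ∀ x, a (x, τ) = h⁻¹ * (heatOp N h (W τ) x * η x τ - W τ x * η x τ)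
        + u τ x * _root_.deriv (η x) τ := fun x => by simp only [ha]; ring
    have e2 : ∀ x, W τ x * ((heatAvg h η x τ - η x τ) / h) + u τ x * _root_.deriv (η x) τ
        = h⁻¹ * (W τ x * heatAvg h η x τ - W τ x * η x τ)
        + u τ x * _root_.deriv (η x) τ := fun x => by field_simp
    have i1 : Integrable fun x => h⁻¹ * (heatOp N h (W τ) x * η x τ - W τ x * η x τ) :=
      ((hbm _).sub (hbm _)).const_mul _
    have i2 : Integrable fun x => h⁻¹ * (W τ x * heatAvg h η x τ - W τ x * η x τ) :=
      (hWa.sub (hbm _)).const_mul _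
    simp_rw [e1, e2]
    rw [integral_add i1 hud, integral_add i2 hud, integral_const_mul, integral_const_mul,
      integral_sub (hbm _) (hbm _), integral_sub hWa (hbm _),
      hη.integral_heatOp_mul H.h_pos.le]
  have hAi : IntegrableOn (fun τ => ∫ x, a (x, τ)) (Ioo 0 t) := hai.integral_prod_right
  have hBi : IntegrableOn (fun τ => ∫ x, b (x, τ)) (Ioo 0 t) := hbi.integral_prod_right
  refine ⟨hAi.congr_fun hA measurableSet_Ioo, hBi, ?_⟩
  rw [← setIntegral_congr_fun measurableSet_Ioo hA, ← integral_add hAi hBi]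
  have hsum : ∀ᵐ τ ∂ν, (∫ x, a (x, τ)) + ∫ x, b (x, τ) = ∫ x, (a (x, τ) + b (x, τ)) := by
    filter_upwards [hai.prod_left_ae, hbi.prod_left_ae] with τ h1 h2
    rw [integral_add h1 h2]
  rw [integral_congr_ae hsum, ← integral_integral_swap (f := fun x τ => a (x, τ) + b (x, τ))
    (hai.add hbi)]
  refine integral_congr_ae (Eventually.of_forall fun x => ?_)
  have hd : ∀ τ ∈ uIcc 0 t, HasDerivAt (fun s => u s x * η x s) (a (x, τ) + b (x, τ)) τ := by
    intro τ hτ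
    rw [uIcc_of_le ht.1.le] at hτ
    have h1 := hasDerivAt_bcf_apply (H.deriv τ ⟨hτ.1, hτ.2.trans ht.2.le⟩) x
    have h2 := hη.hasDerivAt x τ
    rw [← h2.deriv] at h2
    refine (h1.mul h2).congr_deriv ?_
    simp only [ha, hb, BoundedContinuousFunction.add_apply, BoundedContinuousFunction.sub_apply,
      BoundedContinuousFunction.smul_apply, smul_eq_mul]
    ring
  have := intervalIntegral.integral_eq_sub_of_hasDerivAt hd
    (((hac.add hbc).comp (Continuous.prodMk_right x)).intervalIntegrable 0 t)
  rw [hη.2.2 x 0 (by simp), mul_zero, sub_zero, intervalIntegral.integral_of_le ht.1.le,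
    integral_Ioc_eq_integral_Ioo] at this
  exact this.symm

end Identity

lemma integrable_exp_neg_norm {N : ℕ} {c : ℝ} (hc : 0 < c) :
    Integrable fun x : EuclideanSpace ℝ (Fin N) => Real.exp (-(c * ‖x‖)) := by
  have h1 := integrable_one_add_norm (E := EuclideanSpace ℝ (Fin N)) (μ := volume)
    (r := ((N + 1 : ℕ) : ℝ)) (by simp)
  refine (h1.const_mul (Real.exp c * (N + 1).factorial / c ^ (N + 1))).mono'
    (Continuous.aestronglyMeasurable (by fun_prop)) (Eventually.of_forall fun x => ?_)
  have hx : 0 < 1 + ‖x‖ := by positivity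
  have h2 := Real.pow_div_factorial_le_exp (c * (1 + ‖x‖)) (by positivity) (N + 1)
  rw [Real.norm_of_nonneg (Real.exp_pos _).le, Real.rpow_neg hx.le, Real.rpow_natCast,
    Real.exp_neg]
  have h3 : Real.exp (c * (1 + ‖x‖)) = Real.exp c * Real.exp (c * ‖x‖) := by
    rw [← Real.exp_add]; ring_nf
  rw [h3, mul_pow, div_le_iff₀ (by positivity)] at h2
  rw [← div_eq_mul_inv, inv_eq_one_div, div_div, div_le_div_iff₀ (by positivity) (by positivity)]
  linarith

lemma exists_norm_le_mul_abs {N : ℕ} (hN : 1 ≤ N) (x : EuclideanSpace ℝ (Fin N)) :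
    ∃ i, ‖x‖ ≤ N * |x i| := by
  have : NeZero N := ⟨by omega⟩
  obtain ⟨i, -, hi⟩ := Finset.exists_max_image (Finset.univ : Finset (Fin N)) (fun i => |x i|)
    ⟨0, Finset.mem_univ _⟩
  have hN1 : (1:ℝ) ≤ N := by exact_mod_cast hN
  refine ⟨i, ?_⟩
  rw [EuclideanSpace.norm_eq]
  refine Real.sqrt_le_iff.2 ⟨by positivity, ?_⟩
  calc ∑ j, ‖x j‖ ^ 2 ≤ ∑ _j : Fin N, |x i| ^ 2 := by
        refine Finset.sum_le_sum fun j hj => ?_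
        rw [Real.norm_eq_abs]
        exact pow_le_pow_left₀ (abs_nonneg _) (hi j hj) 2
    _ = N * |x i| ^ 2 := by simp
    _ ≤ (N * |x i|) ^ 2 := by
        rw [mul_pow]
        refine mul_le_mul_of_nonneg_right ?_ (by positivity)
        nlinarith

section Barrier

variable {N : ℕ} {m p M K h n T L r : ℝ} {f u₀ : EuclideanSpace ℝ (Fin N) → ℝ}
  {u W F : ℝ → (EuclideanSpace ℝ (Fin N) →ᵇ ℝ)}

lemma ApproxSol.le_exp_rpow (H : ApproxSol m p M K h n T f u₀ u W F) (hm : 1 < m) (hp0 : 0 < p)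
    (hp : p ≤ 1) (hmp : 2 ≤ m + p) (hM : 0 ≤ M) (hn : 0 < n)
    (hnh : ((|1 / (m - 1) - 1| + 1) * n) ^ 2 * h ≤ 1)
    (hL0 : 0 ≤ L) (hLT : L * T ≤ 1)
    (hL : (1 + 1 / (m - 1)) ^ 2 * gaussSecondMoment + K * (2 * max 1 (M ^ (m - 1)))
      ≤ 1 / (m - 1) * L)
    (hu1 : ∀ x, u₀ x ≤ M) (hr : ∀ x, u₀ x ≠ 0 → ∀ i, |x i| ≤ r)
    {t : ℝ} (ht : t ∈ Icc 0 T) (x : EuclideanSpace ℝ (Fin N)) (i : Fin N) :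
    u t x ≤ (Real.exp (n * (r + M ^ (m - 1) + 1 - |x i|)) / n) ^ (1 / (m - 1)) := by
  obtain ⟨e, he, hex⟩ : ∃ e : ℝ, e ^ 2 = 1 ∧ e * x i = -|x i| := by
    rcases le_total 0 (x i) with h0 | h0
    · exact ⟨-1, by norm_num, by rw [abs_of_nonneg h0]; ring⟩
    · exact ⟨1, by norm_num, by rw [abs_of_nonpos h0]; ring⟩
  have hea : |e| = 1 := by
    have : |e| ^ 2 = 1 := by rw [sq_abs, he]
    exact (pow_eq_one_iff_of_nonneg (abs_nonneg e) two_ne_zero).1 this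
  have h1 := H.le_softPlus_rpow hm hp0 hp hmp hM hn rfl hnh hL he hu1 (i := i) (r := r)
    (fun y hy => by
      have h2 : |e * y i| ≤ r := by rw [abs_mul, hea, one_mul]; exact hr y hy i
      linarith [neg_abs_le (e * y i)]) t ht x
  refine h1.trans (Real.rpow_le_rpow (softPlus_pos hn _).le ((softPlus_le hn _).trans ?_) ?_)
  · have h3 : L * t ≤ 1 := (mul_le_mul_of_nonneg_left ht.2 hL0).trans hLT
    gcongr
    rw [hex]; linarith
  · exact (one_div_pos.2 (by linarith)).le

/-- The barrier gives exponential decay of the approximate solutions. -/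
lemma ApproxSol.W_le_exp (H : ApproxSol m p M K h n T f u₀ u W F) (hN : 1 ≤ N) (hm : 1 < m)
    (hM : 0 ≤ M) (hn : 1 ≤ n) {b : ℝ} {t : ℝ} (ht : t ∈ Icc 0 T)
    (hb : ∀ x i, u t x ≤ (Real.exp (n * (b - |x i|)) / n) ^ (1 / (m - 1)))
    (x : EuclideanSpace ℝ (Fin N)) :
    W t x ≤ (M ^ m + 1) * Real.exp (m / (m - 1) * b)
      * Real.exp (-(m / (m - 1) / N * ‖x‖)) := by
  obtain ⟨i, hi⟩ := exists_norm_le_mul_abs hN x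
  have hN0 : (0:ℝ) < N := by exact_mod_cast hN
  have hc : 0 < m / (m - 1) := div_pos (by linarith) (by linarith)
  have hMm : 0 ≤ M ^ m := Real.rpow_nonneg hM m
  have hW1 := H.W_le hm ht x
  have hxi : ‖x‖ / N ≤ |x i| := by rw [div_le_iff₀ hN0]; linarith
  rw [mul_assoc, ← Real.exp_add]
  have hexp : Real.exp (m / (m - 1) * (b - |x i|))
      ≤ Real.exp (m / (m - 1) * b + -(m / (m - 1) / N * ‖x‖)) := by
    refine Real.exp_le_exp.2 ?_
    have := mul_le_mul_of_nonneg_left hxi hc.le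
    have e : m / (m - 1) / N * ‖x‖ = m / (m - 1) * (‖x‖ / N) := by ring
    rw [e]; linarith
  suffices hs : W t x ≤ (M ^ m + 1) * Real.exp (m / (m - 1) * (b - |x i|)) from
    hs.trans (mul_le_mul_of_nonneg_left hexp (by positivity))
  rcases le_total b |x i| with hbx | hbx
  · rw [H.W_eq t ht]
    have h1 : u t x ≤ Real.exp (1 / (m - 1) * (b - |x i|)) := by
      refine (hb x i).trans ?_
      rw [mul_comm (1 / (m - 1)) (b - _), Real.exp_mul (b - _)]
      refine Real.rpow_le_rpow (by positivity) ?_ (one_div_pos.2 (by linarith)).le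
      rw [div_le_iff₀ (zero_lt_one.trans_le hn)]
      calc Real.exp (n * (b - |x i|)) ≤ Real.exp (b - |x i|) :=
            Real.exp_le_exp.2 (by nlinarith)
        _ ≤ Real.exp (b - |x i|) * n := le_mul_of_one_le_right (Real.exp_pos _).le hn
    calc u t x ^ m ≤ Real.exp (1 / (m - 1) * (b - |x i|)) ^ m :=
          Real.rpow_le_rpow (H.nonneg t ht x) h1 (by linarith)
      _ = Real.exp (m / (m - 1) * (b - |x i|)) := by rw [← Real.exp_mul]; ring_nf
      _ ≤ _ := le_mul_of_one_le_left (Real.exp_pos _).le (le_add_of_nonneg_left hMm)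
  · have : 1 ≤ Real.exp (m / (m - 1) * (b - |x i|)) :=
      Real.one_le_exp (mul_nonneg hc.le (by linarith))
    nlinarith

end Barrier

lemma tendsto_srcFun {p : ℝ} (hp : 0 < p) {n v : ℕ → ℝ} {a : ℝ} (hn : Tendsto n atTop atTop)
    (hn0 : ∀ j, 0 ≤ n j) (hv0 : ∀ j, 0 ≤ v j) (hv : Tendsto v atTop (nhds a)) :
    Tendsto (fun j => srcFun p (n j) (v j)) atTop (nhds (a ^ p)) := by
  have hvp : Tendsto (fun j => v j ^ p) atTop (nhds (a ^ p)) :=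
    hv.rpow_const (Or.inr hp.le)
  have ha : 0 ≤ a := ge_of_tendsto' hv hv0
  rcases ha.eq_or_lt with rfl | ha
  · rw [Real.zero_rpow hp.ne'] at hvp ⊢
    exact squeeze_zero (fun j => srcFun_nonneg (hn0 j) (hv0 j))
      (fun j => srcFun_le_rpow _ _ _) hvp
  · refine hvp.congr' ?_
    filter_upwards [(hn.atTop_mul_pos ha hv).eventually_ge_atTop (a ^ p + 1),
      hvp.eventually_le_const (lt_add_one (a ^ p))] with j h1 h2
    exact (min_eq_left (h2.trans h1)).symm

section Limit

variable {N : ℕ} {m p M K T : ℝ} {f u₀ : EuclideanSpace ℝ (Fin N) → ℝ} {h n : ℕ → ℝ}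
  {u W F : ℕ → ℝ → (EuclideanSpace ℝ (Fin N) →ᵇ ℝ)} {η : EuclideanSpace ℝ (Fin N) → ℝ → ℝ}
  {w : ℝ → EuclideanSpace ℝ (Fin N) → ℝ} {G : EuclideanSpace ℝ (Fin N) → ℝ}

lemma tendsto_u_of_tendsto_W
    (hH : ∀ j, ApproxSol m p M K (h j) (n j) T f u₀ (u j) (W j) (F j)) (hm : 1 < m) {t : ℝ}
    (ht : t ∈ Icc 0 T) {x : EuclideanSpace ℝ (Fin N)} {a : ℝ}
    (hw : Tendsto (fun j => W j t x) atTop (nhds a)) :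
    Tendsto (fun j => u j t x) atTop (nhds (a ^ (1 / m))) := by
  refine (hw.rpow_const (Or.inr (one_div_pos.2 (by linarith)).le)).congr fun j => ?_
  rw [(hH j).W_eq t ht, ← Real.rpow_mul ((hH j).nonneg t ht x), mul_one_div,
    div_self (by linarith), Real.rpow_one]

/-- Passage to the limit in the weak formulation of the approximate problems. -/
lemma weakForm_of_tendsto
    (hH : ∀ j, ApproxSol m p M K (h j) (n j) T f u₀ (u j) (W j) (F j)) (hm : 1 < m) (hp : 0 < p)
    (hM : 0 ≤ M) (hh : Tendsto h atTop (nhds 0)) (hn : Tendsto n atTop atTop)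
    (hG : Integrable G) (hWG : ∀ j, ∀ t ∈ Icc 0 T, ∀ x, W j t x ≤ G x)
    (hw : ∀ t ∈ Ioo 0 T, ∀ x, Tendsto (fun j => W j t x) atTop (nhds (w t x)))
    (hη : IsTestFn T η) {t : ℝ} (ht : t ∈ Ioo 0 T) :
    ∫ x, w t x ^ (1 / m) * η x t =
      (∫ τ in Ioo 0 t, ∫ x, (w τ x * lapl (fun y => η y τ) x
        + w τ x ^ (1 / m) * deriv (η x) τ)) +
      ∫ τ in Ioo 0 t, ∫ x, f x * (w τ x ^ (1 / m)) ^ p * η x τ := by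
  obtain ⟨g, hg, hgb⟩ := hη.exists_envelope
  obtain ⟨C, hC0, hC⟩ := hη.exists_second_deriv_bound
  have hsub : ∀ τ ∈ Ioo 0 t, τ ∈ Ioo 0 T := fun τ hτ => ⟨hτ.1, hτ.2.trans ht.2⟩
  have hu : ∀ τ ∈ Ioo 0 T, ∀ x, Tendsto (fun j => u j τ x) atTop (nhds (w τ x ^ (1 / m))) :=
    fun τ hτ x => tendsto_u_of_tendsto_W hH hm ⟨hτ.1.le, hτ.2.le⟩ (hw τ hτ x)
  have huM : ∀ j, ∀ τ ∈ Ioo 0 T, ∀ x, |u j τ x| ≤ M := fun j τ hτ x => by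
    rw [abs_of_nonneg ((hH j).nonneg τ ⟨hτ.1.le, hτ.2.le⟩ x)]
    exact (hH j).le_M τ ⟨hτ.1.le, hτ.2.le⟩ x
  have hWi : ∀ j, ∀ τ ∈ Icc 0 T, Integrable (W j τ) := fun j τ hτ =>
    hG.mono' (W j τ).continuous.aestronglyMeasurable (Eventually.of_forall fun x => by
      rw [Real.norm_of_nonneg ((hH j).W_nonneg hτ x)]; exact hWG j τ hτ x)
  have hηc : ∀ τ, Continuous fun x => η x τ := hη.continuous_slice
  have hηd : ∀ τ, Continuous fun x => deriv (η x) τ := fun τ =>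
    hη.continuous_deriv.comp (Continuous.prodMk_left τ)
  have hA0 : ∀ j, ∀ τ ∈ Ioo 0 T, ∀ x, ‖W j τ x * ((heatAvg (h j) η x τ - η x τ) / h j)
      + u j τ x * deriv (η x) τ‖ ≤ G x * (C * (2 * N)) + M * g x := by
    intro j τ hτ x
    have hτ' : τ ∈ Icc 0 T := ⟨hτ.1.le, hτ.2.le⟩
    have hj := (hH j).h_pos
    have hG0 : 0 ≤ G x := ((hH j).W_nonneg hτ' x).trans (hWG j τ hτ' x)
    refine (norm_add_le _ _).trans (add_le_add ?_ ?_)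
    · rw [norm_mul, Real.norm_of_nonneg ((hH j).W_nonneg hτ' x), Real.norm_eq_abs, abs_div,
        abs_of_pos hj]
      refine mul_le_mul (hWG j τ hτ' x) ?_ (by positivity) hG0
      rw [div_le_iff₀ hj]
      have := hη.abs_heatAvg_sub_le hC hj.le x τ
      linarith
    · rw [norm_mul]
      exact mul_le_mul (huM j τ hτ x) (hgb x τ).2 (norm_nonneg _) hM
  have hB0 : ∀ j, ∀ τ ∈ Ioo 0 T, ∀ x, ‖F j τ x * η x τ‖ ≤ K * M ^ p * g x := by
    intro j τ hτ x
    have hτ' : τ ∈ Icc 0 T := ⟨hτ.1.le, hτ.2.le⟩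
    have hF := (hH j).F_nonneg hτ' x
    have hF1 := (hH j).F_le hp hτ' x
    rw [norm_mul, Real.norm_of_nonneg hF]
    exact mul_le_mul hF1 (hgb x τ).1 (norm_nonneg _) (hF.trans hF1)
  have hIA : Integrable fun x => G x * (C * (2 * N)) + M * g x :=
    (hG.mul_const _).add (hg.const_mul _)
  have hIB : Integrable fun x => K * M ^ p * g x := hg.const_mul _
  have hh' : Tendsto h atTop (nhdsWithin 0 (Ioi 0)) :=
    tendsto_nhdsWithin_iff.2 ⟨hh, Eventually.of_forall fun j => (hH j).h_pos⟩
  have hA1 : ∀ τ ∈ Ioo 0 T, Tendsto (fun j => ∫ x, (W j τ x *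
      ((heatAvg (h j) η x τ - η x τ) / h j) + u j τ x * deriv (η x) τ)) atTop
      (nhds (∫ x, (w τ x * lapl (fun y => η y τ) x + w τ x ^ (1 / m) * deriv (η x) τ))) := by
    intro τ hτ
    refine tendsto_integral_of_dominated_convergence _ (fun j => ?_) hIA
      (fun j => Eventually.of_forall (hA0 j τ hτ)) (Eventually.of_forall fun x => ?_)
    · have := hη.continuous_heatAvg (h j) τ
      exact Continuous.aestronglyMeasurable
        (((W j τ).continuous.mul ((this.sub (hηc τ)).div_const _)).add
          ((u j τ).continuous.mul (hηd τ)))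
    · exact ((hw τ hτ x).mul ((hη.tendsto_heatAvg_sub_div x τ).comp hh')).add
        ((hu τ hτ x).mul_const _)
  have hB1 : ∀ τ ∈ Ioo 0 T, Tendsto (fun j => ∫ x, F j τ x * η x τ) atTop
      (nhds (∫ x, f x * (w τ x ^ (1 / m)) ^ p * η x τ)) := by
    intro τ hτ
    have hτ' : τ ∈ Icc 0 T := ⟨hτ.1.le, hτ.2.le⟩
    refine tendsto_integral_of_dominated_convergence _ (fun j => ?_) hIB
      (fun j => Eventually.of_forall (hB0 j τ hτ)) (Eventually.of_forall fun x => ?_)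
    · exact Continuous.aestronglyMeasurable ((F j τ).continuous.mul (hηc τ))
    · refine Tendsto.mul_const _ ?_
      simp_rw [fun j => (hH j).F_eq τ hτ' x]
      exact (tendsto_srcFun hp hn (fun j => (hH j).n_nonneg)
        (fun j => (hH j).nonneg τ hτ' x) (hu τ hτ x)).const_mul _
  have hL : Tendsto (fun j => ∫ x, u j t x * η x t) atTop
      (nhds (∫ x, w t x ^ (1 / m) * η x t)) := by
    refine tendsto_integral_of_dominated_convergence (fun x => M * g x) (fun j => ?_)
      (hg.const_mul _) (fun j => Eventually.of_forall fun x => ?_)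
      (Eventually.of_forall fun x => (hu t ht x).mul_const _)
    · exact Continuous.aestronglyMeasurable ((u j t).continuous.mul (hηc t))
    · rw [norm_mul]
      exact mul_le_mul (huM j t ht x) (hgb x t).1 (norm_nonneg _) hM
  have hid := fun j => (hH j).integral_mul_testFn hη (hWi j) ht
  have hA2 : Tendsto (fun j => ∫ τ in Ioo 0 t, ∫ x, (W j τ x *
      ((heatAvg (h j) η x τ - η x τ) / h j) + u j τ x * deriv (η x) τ)) atTop
      (nhds (∫ τ in Ioo 0 t, ∫ x, (w τ x * lapl (fun y => η y τ) x
        + w τ x ^ (1 / m) * deriv (η x) τ))) := by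
    refine tendsto_integral_of_dominated_convergence
      (fun _ => ∫ x, (G x * (C * (2 * N)) + M * g x))
      (fun j => (hid j).1.aestronglyMeasurable) (integrable_const _) (fun j => ?_) ?_
    · exact ae_restrict_of_forall_mem measurableSet_Ioo fun τ hτ =>
        norm_integral_le_of_norm_le hIA (Eventually.of_forall (hA0 j τ (hsub τ hτ)))
    · exact ae_restrict_of_forall_mem measurableSet_Ioo fun τ hτ => hA1 τ (hsub τ hτ)
  have hB2 : Tendsto (fun j => ∫ τ in Ioo 0 t, ∫ x, F j τ x * η x τ) atTop
      (nhds (∫ τ in Ioo 0 t, ∫ x, f x * (w τ x ^ (1 / m)) ^ p * η x τ)) := by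
    refine tendsto_integral_of_dominated_convergence (fun _ => ∫ x, K * M ^ p * g x)
      (fun j => (hid j).2.1.aestronglyMeasurable) (integrable_const _) (fun j => ?_) ?_
    · exact ae_restrict_of_forall_mem measurableSet_Ioo fun τ hτ =>
        norm_integral_le_of_norm_le hIB (Eventually.of_forall (hB0 j τ (hsub τ hτ)))
    · exact ae_restrict_of_forall_mem measurableSet_Ioo fun τ hτ => hB1 τ (hsub τ hτ)
  exact tendsto_nhds_unique (hL.congr fun j => (hid j).2.2) (hA2.add hB2)

end Limit

section InitialTime

variable {N : ℕ} {m p M K T : ℝ} {f u₀ : EuclideanSpace ℝ (Fin N) → ℝ} {h n : ℕ → ℝ}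
  {u W F : ℕ → ℝ → (EuclideanSpace ℝ (Fin N) →ᵇ ℝ)}
  {w : ℝ → EuclideanSpace ℝ (Fin N) → ℝ}

lemma tendsto_limit_initial
    (hH : ∀ j, ApproxSol m p M K (h j) (n j) T f u₀ (u j) (W j) (F j)) (hm : 1 < m) (hp0 : 0 < p)
    (hp : p ≤ 1) (hM : 0 < M) (hT : 0 < T) (hu₀ : Continuous u₀) (hu0 : ∀ x, 0 ≤ u₀ x)
    (hu1 : ∀ x, u₀ x ≤ M)
    (hw : ∀ t ∈ Ioo 0 T, ∀ x, Tendsto (fun j => W j t x) atTop (nhds (w t x)))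
    (x₀ : EuclideanSpace ℝ (Fin N)) :
    Tendsto (fun t => w t x₀) (nhdsWithin 0 (Ioi 0)) (nhds (u₀ x₀ ^ m)) := by
  have hm0 : 0 < m := by linarith
  have hg : Continuous fun x => u₀ x ^ m := hu₀.rpow_const fun _ => Or.inr hm0.le
  have hg0 : ∀ x, 0 ≤ u₀ x ^ m := fun x => Real.rpow_nonneg (hu0 x) m
  have hgM : ∀ x, u₀ x ^ m ≤ M ^ m := fun x => Real.rpow_le_rpow (hu0 x) (hu1 x) hm0.le
  have hMm : 0 ≤ M ^ m := Real.rpow_nonneg hM.le m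
  have hK : 0 ≤ K := ((hH 0).f_nonneg 0).trans ((hH 0).f_le 0)
  rw [Metric.tendsto_nhds]
  intro ε hε
  obtain ⟨δ, hδ, hδε⟩ := Metric.continuous_iff.1 hg x₀ (ε / 2) (by positivity)
  set q := M ^ m / δ ^ 2 with hq
  have hq0 : 0 ≤ q := by positivity
  have hfar : ∀ x, δ ≤ ‖x - x₀‖ → M ^ m ≤ q * ‖x - x₀‖ ^ 2 := fun x hx => by
    calc M ^ m = q * δ ^ 2 := by rw [hq]; field_simp
      _ ≤ q * ‖x - x₀‖ ^ 2 := by gcongr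
  have hi1 : ∀ x, u₀ x ^ m ≤ (u₀ x₀ ^ m + ε / 2) + q * ‖x - x₀‖ ^ 2 := fun x => by
    rcases lt_or_ge ‖x - x₀‖ δ with hx | hx
    · have h1 := hδε x (by rwa [dist_eq_norm])
      rw [Real.dist_eq, abs_lt] at h1
      have : 0 ≤ q * ‖x - x₀‖ ^ 2 := by positivity
      linarith [h1.2]
    · linarith [hfar x hx, hgM x, hg0 x₀]
  have hi2 : ∀ x, (u₀ x₀ ^ m - ε / 2) - q * ‖x - x₀‖ ^ 2 ≤ u₀ x ^ m := fun x => by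
    rcases lt_or_ge ‖x - x₀‖ δ with hx | hx
    · have h1 := hδε x (by rwa [dist_eq_norm])
      rw [Real.dist_eq, abs_lt] at h1
      have : 0 ≤ q * ‖x - x₀‖ ^ 2 := by positivity
      linarith [h1.1]
    · linarith [hfar x hx, hgM x₀, hg0 x]
  set l := m * M ^ (m - 1) * (2 * N * q + K * M ^ p) with hl
  have hl2 : m * M ^ (m - 1) * (2 * N * q) ≤ l := by
    rw [hl]
    gcongr
    exact le_add_of_nonneg_right (by positivity)
  have hlt : Tendsto (fun t : ℝ => l * t) (nhdsWithin 0 (Ioi 0)) (nhds 0) := by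
    have : Tendsto (fun t : ℝ => l * t) (nhds 0) (nhds (l * 0)) :=
      (continuous_const.mul continuous_id).tendsto 0
    rw [mul_zero] at this
    exact this.mono_left nhdsWithin_le_nhds
  filter_upwards [hlt.eventually_lt_const (by positivity : 0 < ε / 2),
    Ioo_mem_nhdsGT hT] with t h1 ht
  have ht' : t ∈ Icc 0 T := ⟨ht.1.le, ht.2.le⟩
  have hup : w t x₀ ≤ (u₀ x₀ ^ m + ε / 2) + l * t := le_of_tendsto' (hw t ht x₀) fun j =>
    (hH j).pow_le_initial hm hp0 hp hM (by linarith [hg0 x₀]) hq0 le_rfl hi1 t ht'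
  have hlo : (u₀ x₀ ^ m - ε / 2) - l * t ≤ w t x₀ := ge_of_tendsto' (hw t ht x₀) fun j =>
    (hH j).initial_le_pow hm hp0 hp hM hu0 (by linarith [hgM x₀]) hq0 hl2 hi2 t ht'
  rw [Real.dist_eq, abs_lt]
  constructor <;> linarith

end InitialTime

/-- Bounded pointwise convergence of continuous functions implies convergence in `L¹` on compact
sets. -/
lemma tendsto_setIntegral_abs_sub {N : ℕ} {v : EuclideanSpace ℝ (Fin N) → ℝ → ℝ}
    {v₀ : EuclideanSpace ℝ (Fin N) → ℝ} {l : Filter ℝ} [l.IsCountablyGenerated] {M : ℝ}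
    (hc : ∀ᶠ t in l, Continuous fun x => v x t) (hc₀ : Continuous v₀)
    (hb : ∀ᶠ t in l, ∀ x, |v x t - v₀ x| ≤ M)
    (hv : ∀ x, Tendsto (v x) l (nhds (v₀ x))) {S : Set (EuclideanSpace ℝ (Fin N))}
    (hS : IsCompact S) :
    Tendsto (fun t => ∫ x in S, |v x t - v₀ x|) l (nhds 0) := by
  have : IsFiniteMeasure (volume.restrict S) := ⟨by simpa using hS.measure_lt_top⟩
  have h0 : (0:ℝ) = ∫ x in S, (0:ℝ) := by simp
  rw [h0]
  refine tendsto_integral_filter_of_dominated_convergence (fun _ => M) ?_ ?_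
    (integrable_const M) (Eventually.of_forall fun x => ?_)
  · filter_upwards [hc] with t ht
    exact (ht.sub hc₀).abs.aestronglyMeasurable
  · filter_upwards [hb] with t ht
    exact Eventually.of_forall fun x => by rw [Real.norm_eq_abs, abs_abs]; exact ht x
  · have := ((hv x).sub_const (v₀ x)).abs
    simpa using this

/-- Local existence of compactly supported solutions when m + p ≥ 2 and σ > 0. -/
theorem local_existence_compactly_supported
    {N : ℕ} (hN : 1 ≤ N) {m p σ : ℝ} (hm : 1 < m) (hp0 : 0 < p) (hp1 : p < 1)
    (hσ : 0 < σ) (hmp : 2 ≤ m + p)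
    (u₀ : EuclideanSpace ℝ (Fin N) → ℝ)
    (hu₀cont : Continuous u₀) (hu₀bdd : ∃ C : ℝ, ∀ x, u₀ x ≤ C)
    (hu₀supp : HasCompactSupport u₀)
    (hu₀nonneg : ∀ x, 0 ≤ u₀ x) (hu₀ne : u₀ ≠ 0) :
    ∃ T > (0:ℝ), ∃ u : EuclideanSpace ℝ (Fin N) → ℝ → ℝ,
      IsWeakSolution m p σ T u u₀ ∧
      ∀ t ∈ Ioo (0:ℝ) T,
        Continuous (fun x => u x t) ∧ HasCompactSupport (fun x => u x t) := by
  obtain ⟨C, hC⟩ := hu₀bdd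
  set M₀ := max C 0 with hM₀
  set M := M₀ + 1 with hMdef
  have hM₀0 : 0 ≤ M₀ := le_max_right _ _
  have hM : 0 < M := by linarith
  have hu0M₀ : ∀ x, u₀ x ≤ M₀ := fun x => (hC x).trans (le_max_left _ _)
  have hu0M : ∀ x, u₀ x ≤ M := fun x => (hu0M₀ x).trans (by linarith)
  obtain ⟨r, hr⟩ : ∃ r, ∀ x, u₀ x ≠ 0 → ∀ i, |x i| ≤ r := by
    obtain ⟨r, hr⟩ := hu₀supp.isCompact.isBounded.exists_norm_le
    exact ⟨r, fun x hx i => (PiLp.norm_apply_le x i).trans (hr x (subset_tsupport _ hx))⟩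
  set b := r + M ^ (m - 1) + 1 with hb
  set K := (1 + N * |b|) ^ σ with hK
  have hK0 : 0 < K := by positivity
  set γ := 1 / (m - 1) with hγ
  have hm1 : 0 < m - 1 := by linarith
  have hγ0 : 0 < γ := one_div_pos.2 hm1
  have hS := gaussSecondMoment_nonneg
  set A := (1 + γ) ^ 2 * gaussSecondMoment + K * (2 * max 1 (M ^ (m - 1))) with hA
  have hA0 : 0 ≤ A := by positivity
  set L := A * (m - 1) with hLdef
  have hL0 : 0 ≤ L := by positivity
  have hL : A ≤ γ * L := by
    rw [hLdef, hγ]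
    field_simp
    exact le_rfl
  have hMp : 0 < M ^ p := Real.rpow_pos_of_pos hM p
  set T := 1 / (K * M ^ p + L + 1) with hT
  have hden : 0 < K * M ^ p + L + 1 := by positivity
  have hT0 : 0 < T := one_div_pos.2 hden
  have hKT : M₀ + K * M ^ p * T ≤ M := by
    have : K * M ^ p * T ≤ 1 := by
      rw [hT, mul_one_div, div_le_one hden]; linarith
    linarith
  have hLT : L * T ≤ 1 := by
    rw [hT, mul_one_div, div_le_one hden]
    have : 0 ≤ K * M ^ p := by positivity
    linarith
  have hbase : ∀ x : EuclideanSpace ℝ (Fin N), 0 < 1 + ‖x‖ := fun x => by positivity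
  have hfc : Continuous fun x : EuclideanSpace ℝ (Fin N) => min ((1 + ‖x‖) ^ σ) K :=
    ((continuous_const.add continuous_norm).rpow_const fun x => Or.inl (hbase x).ne').min
      continuous_const
  have hf0 : ∀ x : EuclideanSpace ℝ (Fin N), 0 ≤ min ((1 + ‖x‖) ^ σ) K := fun x =>
    le_min (Real.rpow_nonneg (hbase x).le σ) hK0.le
  set f : EuclideanSpace ℝ (Fin N) →ᵇ ℝ := BoundedContinuousFunction.ofNormedAddCommGroup
    (fun x => min ((1 + ‖x‖) ^ σ) K) hfc K (fun x => by
      rw [Real.norm_of_nonneg (hf0 x)]; exact min_le_right _ _) with hf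
  have hfx : ∀ x, f x = min ((1 + ‖x‖) ^ σ) K := fun x => rfl
  set U₀ : EuclideanSpace ℝ (Fin N) →ᵇ ℝ := BoundedContinuousFunction.ofNormedAddCommGroup
    u₀ hu₀cont M₀ (fun x => by rw [Real.norm_of_nonneg (hu₀nonneg x)]; exact hu0M₀ x) with hU₀
  have hex := fun j : ℕ => exists_approxSol (m := m) (p := p) (M := M) (K := K)
    (h := (1 / 2) ^ j) (n := j) (T := T) (M₀ := M₀) hm.le hp0 hp1.le hM.le (by positivity)
    (Nat.cast_nonneg j) hT0.le f U₀ hf0 (fun x => min_le_right _ _) hu₀nonneg hu0M₀ hKT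
  choose u W F hH using hex
  obtain ⟨φ, hφ, w, hw, hwc⟩ := exists_subseq_W_tendsto hH hm hp0 hp1.le hM hK0.le hT0
  obtain ⟨j₀, hj₀⟩ : ∃ j₀ : ℕ, ∀ j ≥ j₀,
      1 ≤ (j:ℝ) ∧ ((|γ - 1| + 1) * (j:ℝ)) ^ 2 * (1 / 2 : ℝ) ^ j ≤ 1 := by
    have h1 : Tendsto (fun j : ℕ => ((|γ - 1| + 1) * (j:ℝ)) ^ 2 * (1 / 2 : ℝ) ^ j) atTop
        (nhds 0) := by
      have := (tendsto_pow_const_mul_const_pow_of_abs_lt_one 2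
        (by norm_num [abs_of_pos] : |(1 / 2 : ℝ)| < 1)).const_mul ((|γ - 1| + 1) ^ 2)
      rw [mul_zero] at this
      refine this.congr fun j => by ring
    obtain ⟨j₀, hj₀⟩ := eventually_atTop.1 ((h1.eventually_le_const one_pos).and
      (eventually_ge_atTop 1))
    exact ⟨j₀, fun j hj => ⟨by exact_mod_cast (hj₀ j hj).2, (hj₀ j hj).1⟩⟩
  set ψ : ℕ → ℕ := fun k => φ (k + j₀) with hψ
  have hψj : ∀ k, j₀ ≤ ψ k := fun k => (Nat.le_add_left j₀ k).trans (hφ.id_le _)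
  have hψt : Tendsto ψ atTop atTop := hφ.tendsto_atTop.comp (tendsto_add_atTop_nat j₀)
  have hHψ : ∀ k, ApproxSol m p M K ((1 / 2) ^ ψ k) (ψ k : ℝ) T f U₀ (u (ψ k)) (W (ψ k))
    (F (ψ k)) := fun k => hH (ψ k)
  have hwψ : ∀ t ∈ Ioo 0 T, ∀ x, Tendsto (fun k => W (ψ k) t x) atTop (nhds (w t x)) :=
    fun t ht x => (hw t ht x).comp (tendsto_add_atTop_nat j₀)
  have hbar : ∀ k, ∀ t ∈ Icc 0 T, ∀ x i,
      u (ψ k) t x ≤ (Real.exp (ψ k * (b - |x i|)) / ψ k) ^ (1 / (m - 1)) := fun k t ht x i =>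
    (hHψ k).le_exp_rpow hm hp0 hp1.le hmp hM.le (zero_lt_one.trans_le (hj₀ _ (hψj k)).1)
      (hj₀ _ (hψj k)).2 hL0 hLT hL hu0M hr ht x i
  have hm0 : 0 < m := by linarith
  set v : EuclideanSpace ℝ (Fin N) → ℝ → ℝ := fun x t => w t x ^ (1 / m) with hv
  have huv : ∀ t ∈ Ioo 0 T, ∀ x, Tendsto (fun k => u (ψ k) t x) atTop (nhds (v x t)) :=
    fun t ht x => tendsto_u_of_tendsto_W hHψ hm ⟨ht.1.le, ht.2.le⟩ (hwψ t ht x)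
  have hw0 : ∀ t ∈ Ioo 0 T, ∀ x, 0 ≤ w t x := fun t ht x =>
    ge_of_tendsto' (hwψ t ht x) fun k => (hHψ k).W_nonneg ⟨ht.1.le, ht.2.le⟩ x
  have hv0 : ∀ t ∈ Ioo 0 T, ∀ x, 0 ≤ v x t := fun t ht x => Real.rpow_nonneg (hw0 t ht x) _
  have hvM : ∀ t ∈ Ioo 0 T, ∀ x, v x t ≤ M := fun t ht x =>
    le_of_tendsto' (huv t ht x) fun k => (hHψ k).le_M t ⟨ht.1.le, ht.2.le⟩ x
  have hvm : ∀ t ∈ Ioo 0 T, ∀ x, v x t ^ m = w t x := fun t ht x => by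
    rw [hv, ← Real.rpow_mul (hw0 t ht x), one_div_mul_cancel hm0.ne', Real.rpow_one]
  have hn : Tendsto (fun k => (ψ k : ℝ)) atTop atTop :=
    tendsto_natCast_atTop_atTop.comp hψt
  have hvz : ∀ t ∈ Ioo 0 T, ∀ x i, b ≤ |x i| → v x t = 0 := fun t ht x i hx => by
    refine le_antisymm ?_ (hv0 t ht x)
    have h1 : Tendsto (fun k => (1 / (ψ k : ℝ)) ^ (1 / (m - 1))) atTop (nhds 0) := by
      have := ((tendsto_const_nhds (x := (1:ℝ))).div_atTop hn).rpow_const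
        (Or.inr hγ0.le : (0:ℝ) ≠ 0 ∨ 0 ≤ γ)
      rwa [Real.zero_rpow hγ0.ne'] at this
    refine le_of_tendsto_of_tendsto' (huv t ht x) h1 fun k => ?_
    refine (hbar k t ⟨ht.1.le, ht.2.le⟩ x i).trans (Real.rpow_le_rpow (by positivity) ?_ hγ0.le)
    gcongr
    exact Real.exp_le_one_iff.2 (mul_nonpos_of_nonneg_of_nonpos (Nat.cast_nonneg _) (by linarith))
  have hvR : ∀ t ∈ Ioo 0 T, ∀ x, v x t ≠ 0 → ‖x‖ ≤ N * |b| := fun t ht x hx => by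
    obtain ⟨i, hi⟩ := exists_norm_le_mul_abs hN x
    have : |x i| < b := by
      by_contra hcon
      exact hx (hvz t ht x i (not_lt.1 hcon))
    refine hi.trans (mul_le_mul_of_nonneg_left (this.le.trans (le_abs_self b)) (Nat.cast_nonneg N))
  have hvc : ∀ t ∈ Ioo 0 T, Continuous fun x => v x t := fun t ht =>
    Continuous.rpow_const (continuous_iff_continuousAt.2 fun x =>
      ContinuousAt.comp (f := fun x => (t, x)) (hwc t ht x) (by fun_prop))
      fun _ => Or.inr (one_div_pos.2 hm0).le
  have hvt : ∀ t ∈ Ioo 0 T, ∀ x, ContinuousAt (v x) t := fun t ht x =>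
    ContinuousAt.rpow_const (ContinuousAt.comp (f := fun t => (t, x)) (hwc t ht x) (by fun_prop))
      (Or.inr (one_div_pos.2 hm0).le)
  have hcN : 0 < m / (m - 1) / N := by
    have : (0:ℝ) < N := by exact_mod_cast hN
    positivity
  refine ⟨T, hT0, v, ⟨fun x t ht => hv0 t ht x, ?_, fun S _ a c ha hc => ⟨M, fun x _ t ht =>
    hvM t ⟨ha.trans_le ht.1, ht.2.trans_lt hc⟩ x⟩, ?_, ?_⟩, fun t ht => ⟨hvc t ht, ?_⟩⟩
  · intro S hSc s hs
    refine tendsto_setIntegral_abs_sub (M := M) ?_ (hvc s hs) ?_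
      (fun x => (hvt s hs x).tendsto.mono_left nhdsWithin_le_nhds) hSc
    · filter_upwards [self_mem_nhdsWithin] with t ht using hvc t ht
    · filter_upwards [self_mem_nhdsWithin] with t ht x
      have h1 := hv0 t ht x
      have h2 := hv0 s hs x
      have h3 := hvM t ht x
      have h4 := hvM s hs x
      rw [abs_le]; constructor <;> linarith
  · intro η hη t ht
    have hlim := weakForm_of_tendsto hHψ hm hp0 hM.le
      ((tendsto_pow_atTop_nhds_zero_of_lt_one (by norm_num) (by norm_num)).comp hψt) hn
      ((integrable_exp_neg_norm hcN).const_mul ((M ^ m + 1) * Real.exp (m / (m - 1) * b)))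
      (fun k t ht x => (hHψ k).W_le_exp hN hm hM.le (hj₀ _ (hψj k)).1 ht (hbar k t ht) x)
      hwψ hη ht
    have e1 : ∀ τ ∈ Ioo 0 t,
        ∫ x, (-(v x τ * deriv (η x) τ) - v x τ ^ m * lapl (fun y => η y τ) x)
          = -∫ x, (w τ x * lapl (fun y => η y τ) x + w τ x ^ (1 / m) * deriv (η x) τ) := by
      intro τ hτ
      rw [← integral_neg]
      refine integral_congr_ae (Eventually.of_forall fun x => ?_)
      simp only [hvm τ ⟨hτ.1, hτ.2.trans ht.2⟩ x]
      simp only [hv]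
      ring
    have e2 : ∀ τ ∈ Ioo 0 t, ∫ x, (1 + ‖x‖) ^ σ * v x τ ^ p * η x τ
        = ∫ x, f x * (w τ x ^ (1 / m)) ^ p * η x τ := by
      intro τ hτ
      have hτ' : τ ∈ Ioo 0 T := ⟨hτ.1, hτ.2.trans ht.2⟩
      refine integral_congr_ae (Eventually.of_forall fun x => ?_)
      by_cases hx : v x τ = 0
      · have hx' : w τ x ^ (1 / m) = 0 := hx
        simp only [hx, hx', Real.zero_rpow hp0.ne', mul_zero]
      · have hle : (1 + ‖x‖) ^ σ ≤ K :=
          Real.rpow_le_rpow (hbase x).le (by linarith [hvR τ hτ' x hx]) hσ.le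
        simp only [hfx, min_eq_left hle, hv]
    rw [setIntegral_congr_fun measurableSet_Ioo e1, setIntegral_congr_fun measurableSet_Ioo e2,
      integral_neg, hlim]
    ring
  · intro S hSc
    have hTm : Ioo 0 T ∈ nhdsWithin (0:ℝ) (Ioi 0) := Ioo_mem_nhdsGT hT0
    refine tendsto_setIntegral_abs_sub (M := M) ?_ hu₀cont ?_ (fun x => ?_) hSc
    · filter_upwards [hTm] with t ht using hvc t ht
    · filter_upwards [hTm] with t ht x
      have h1 := hv0 t ht x
      have h2 := hu₀nonneg x
      have h3 := hvM t ht x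
      have h4 := hu0M x
      rw [abs_le]; constructor <;> linarith
    · have := (tendsto_limit_initial hHψ hm hp0 hp1.le hM hT0 hu₀cont hu₀nonneg hu0M hwψ
        x).rpow_const (Or.inr (one_div_pos.2 hm0).le : _ ∨ 0 ≤ 1 / m)
      have e : (U₀ x ^ m) ^ (1 / m) = u₀ x := by
        change (u₀ x ^ m) ^ (1 / m) = u₀ x
        rw [← Real.rpow_mul (hu₀nonneg x), mul_one_div, div_self hm0.ne', Real.rpow_one]
      rwa [e] at this
  · refine HasCompactSupport.intro (isCompact_closedBall (0 : EuclideanSpace ℝ (Fin N)) (N * |b|))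
      fun x hx => ?_
    by_contra hne
    exact hx (by rw [mem_closedBall_zero_iff]; exact hvR t ht x hne)
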